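/- arXiv:1012.1735 — 7 statements merged into one kernel-verified Lean document; each statement's English description precedes it below -/
import Mathlib

section
/- Let n ≥ 1 and k, ℓ ≥ 1. Let A₀, …, A_n be complex ℓ×k matrices and let X = Σ_{i=0}^{n} A_i ∂_i be the associated homogeneous constant-coefficient first-order partial differential operator, with formal adjoint X*φ = −Σ_{i=0}^{n} A_i^* ∂_i φ (A_i^* the conjugate transpose). Let B be the open unit ball of ℝ^{1+n} and let h ∈ L²_loc(B; ℂ^k). If Xh = 0 in the distributional sense on B \ {0}, i.e. ∫_B ⟨h(x), (X*φ)(x)⟩ dx = 0 for every φ ∈ C_c^∞(B \ {0}; ℂ^ℓ), then Xh = 0 in the distributional sense on all of B, i.e. ∫_B ⟨h(x), (X*φ)(x)⟩ dx = 0 for every φ ∈ C_c^∞(B; ℂ^ℓ). -/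
open MeasureTheory Metric Filter Topology
open scoped ENNReal NNReal

/-- The pointwise pairing `⟨v, -∑ᵢ Aᵢ* L eᵢ⟩`, the integrand of `⟨h, X*φ⟩` for `v = h x` and
`L = Dφ(x)`. -/
noncomputable def adjointPairing {d k l : ℕ} (A : Fin d → Matrix (Fin l) (Fin k) ℂ)
    (v : Fin k → ℂ) (L : EuclideanSpace ℝ (Fin d) →L[ℝ] (Fin l → ℂ)) : ℂ :=
  ∑ j, (starRingEnd ℂ) (v j) *
    (-∑ i, ∑ p, (starRingEnd ℂ) (A i p j) * L (EuclideanSpace.single i 1) p)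

lemma adjointPairing_add {d k l : ℕ} (A : Fin d → Matrix (Fin l) (Fin k) ℂ)
    (v : Fin k → ℂ) (L L' : EuclideanSpace ℝ (Fin d) →L[ℝ] (Fin l → ℂ)) :
    adjointPairing A v (L + L') = adjointPairing A v L + adjointPairing A v L' := by
  simp only [adjointPairing, add_apply, Pi.add_apply, mul_add, neg_add,
    Finset.sum_add_distrib]

lemma norm_adjointPairing_le {d k l : ℕ} (A : Fin d → Matrix (Fin l) (Fin k) ℂ)
    (v : Fin k → ℂ) (L : EuclideanSpace ℝ (Fin d) →L[ℝ] (Fin l → ℂ)) :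
    ‖adjointPairing A v L‖ ≤ (∑ j, ∑ i, ∑ p, ‖A i p j‖) * ‖L‖ * ‖v‖ := by
  have hL (i : Fin d) (p : Fin l) : ‖L (EuclideanSpace.single i 1) p‖ ≤ ‖L‖ := by
    refine (norm_le_pi_norm _ p).trans ((L.le_opNorm _).trans ?_)
    simp
  calc ‖adjointPairing A v L‖
      ≤ ∑ j, ‖v‖ * ∑ i, ∑ p, ‖A i p j‖ * ‖L‖ := by
        refine norm_sum_le_of_le _ fun j _ => ?_
        rw [norm_mul, norm_neg, RCLike.norm_conj]
        refine mul_le_mul (norm_le_pi_norm v j) ?_ (norm_nonneg _) (norm_nonneg _)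
        refine norm_sum_le_of_le _ fun i _ => norm_sum_le_of_le _ fun p _ => ?_
        rw [norm_mul, RCLike.norm_conj]
        exact mul_le_mul_of_nonneg_left (hL i p) (norm_nonneg _)
    _ = (∑ j, ∑ i, ∑ p, ‖A i p j‖) * ‖L‖ * ‖v‖ := by
        simp only [Finset.mul_sum, Finset.sum_mul]
        refine Finset.sum_congr rfl fun j _ => Finset.sum_congr rfl fun i _ =>
          Finset.sum_congr rfl fun p _ => by ring

lemma measurable_adjointPairing {d k l : ℕ} (A : Fin d → Matrix (Fin l) (Fin k) ℂ)
    {h : EuclideanSpace ℝ (Fin d) → Fin k → ℂ} (hh : Measurable h)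
    {L : EuclideanSpace ℝ (Fin d) → EuclideanSpace ℝ (Fin d) →L[ℝ] (Fin l → ℂ)}
    (hL : Continuous L) : Measurable fun x => adjointPairing A (h x) (L x) := by
  have h1 (j : Fin k) : Measurable fun x => (starRingEnd ℂ) (h x j) :=
    Complex.continuous_conj.measurable.comp ((measurable_pi_apply j).comp hh)
  have h2 (i : Fin d) (p : Fin l) : Measurable fun x => L x (EuclideanSpace.single i 1) p :=
    ((continuous_apply p).comp (hL.clm_apply continuous_const)).measurable
  unfold adjointPairing
  exact Finset.measurable_sum _ fun j _ => (h1 j).mul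
    (Finset.measurable_sum _ fun i _ => Finset.measurable_sum _ fun p _ =>
      (h2 i p).const_mul _).neg

lemma enorm_sq_le_sum {ι F : Type*} [Fintype ι] [SeminormedAddCommGroup F] (v : ι → F) :
    ‖v‖ₑ ^ 2 ≤ ∑ j, ‖v j‖ₑ ^ 2 := by
  have key : ‖v‖₊ ^ 2 ≤ ∑ j, ‖v j‖₊ ^ 2 := by
    rw [← NNReal.le_sqrt_iff_sq_le]
    refine pi_nnnorm_le_iff.2 fun j => ?_
    rw [NNReal.le_sqrt_iff_sq_le]
    exact Finset.single_le_sum (f := fun j => ‖v j‖₊ ^ 2) (fun _ _ => zero_le) (Finset.mem_univ j)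
  simp only [enorm_eq_nnnorm]
  exact_mod_cast key

/-- In dimension at least two, the `L¹` norm of an `L²` function over the ball of radius `ε` is
`o(ε)`. -/
lemma tendsto_inv_mul_lintegral_closedBall {E F : Type*} [NormedAddCommGroup E] [NormedSpace ℝ E]
    [FiniteDimensional ℝ E] [MeasurableSpace E] [BorelSpace E] (μ : Measure E)
    [μ.IsAddHaarMeasure] [NormedAddCommGroup F] (hd : 2 ≤ Module.finrank ℝ E) {h : E → F} {r : ℝ}
    (hr : 0 < r) (hh : MemLp h 2 (μ.restrict (closedBall 0 r))) :
    Tendsto (fun ε : ℝ => ENNReal.ofReal ε⁻¹ * ∫⁻ x in closedBall 0 ε, ‖h x‖ₑ ∂μ)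
      (𝓝[>] 0) (𝓝 0) := by
  have hvol : Tendsto (fun ε : ℝ => (μ.restrict (closedBall 0 r)) (closedBall 0 ε))
      (𝓝[>] 0) (𝓝 0) := by
    have hball : Tendsto (fun ε : ℝ => μ (closedBall (0 : E) ε)) (𝓝[>] 0) (𝓝 0) := by
      have : Nontrivial E := Module.nontrivial_of_finrank_pos (R := ℝ) (by omega)
      have := tendsto_measure_cthickening_of_isCompact (μ := μ) (isCompact_singleton (x := (0 : E)))
      rw [measure_singleton] at this
      refine (this.mono_left nhdsWithin_le_nhds).congr' ?_
      filter_upwards [self_mem_nhdsWithin] with ε hε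
      rw [cthickening_singleton _ (le_of_lt hε)]
    exact tendsto_of_tendsto_of_tendsto_of_le_of_le tendsto_const_nhds hball
      (fun _ => zero_le) fun _ => Measure.restrict_apply_le _ _
  have hsq : Tendsto (fun ε : ℝ => ∫⁻ x in closedBall 0 ε, ‖h x‖ₑ ^ (2 : ℝ)
      ∂(μ.restrict (closedBall 0 r))) (𝓝[>] 0) (𝓝 0) := by
    refine tendsto_setLIntegral_zero ?_ hvol
    simpa using (lintegral_rpow_enorm_lt_top_of_eLpNorm_lt_top (by simp) (by simp) hh.2).ne
  have hlim : Tendsto (fun ε : ℝ => (∫⁻ x in closedBall 0 ε, ‖h x‖ₑ ^ (2 : ℝ)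
      ∂(μ.restrict (closedBall 0 r))) ^ (1 / 2 : ℝ) * μ (closedBall 0 1) ^ (1 / 2 : ℝ))
      (𝓝[>] 0) (𝓝 0) := by
    have h1 := (ENNReal.continuous_rpow_const (y := (1 / 2 : ℝ))).tendsto 0 |>.comp hsq
    have h2 := ENNReal.Tendsto.mul_const (b := μ (closedBall 0 1) ^ (1 / 2 : ℝ)) h1
      (Or.inr (ENNReal.rpow_ne_top_of_nonneg (by norm_num)
        (isCompact_closedBall _ _).measure_ne_top))
    simpa using h2
  refine tendsto_of_tendsto_of_tendsto_of_le_of_le' tendsto_const_nhds hlim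
    (Eventually.of_forall fun _ => zero_le) ?_
  filter_upwards [Ioc_mem_nhdsGT (lt_min hr one_pos)] with ε hε
  obtain ⟨hε0, hε⟩ := hε
  have hεr : ε ≤ r := hε.trans (min_le_left _ _)
  have hε1 : ε ≤ 1 := hε.trans (min_le_right _ _)
  have hsub : closedBall (0 : E) ε ⊆ closedBall 0 r := closedBall_subset_closedBall hεr
  rw [Measure.restrict_restrict isClosed_closedBall.measurableSet,
    Set.inter_eq_self_of_subset_left hsub]
  have hmeas : AEStronglyMeasurable h (μ.restrict (closedBall 0 ε)) :=
    hh.1.mono_measure (Measure.restrict_mono hsub le_rfl)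
  have hCS := eLpNorm_le_eLpNorm_mul_rpow_measure_univ (p := 1) (q := 2)
    (by norm_num) hmeas
  rw [eLpNorm_one_eq_lintegral_enorm, eLpNorm_eq_lintegral_rpow_enorm_toReal (by simp) (by simp),
    Measure.restrict_apply_univ] at hCS
  have hexp : (1 / (1 : ℝ≥0∞).toReal - 1 / (2 : ℝ≥0∞).toReal : ℝ) = 1 / 2 := by norm_num
  rw [hexp, ENNReal.toReal_ofNat] at hCS
  have hball : μ (closedBall (0 : E) ε) ^ (1 / 2 : ℝ) ≤
      ENNReal.ofReal ε * μ (closedBall 0 1) ^ (1 / 2 : ℝ) := by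
    rw [Measure.addHaar_closedBall' _ _ hε0.le, ENNReal.mul_rpow_of_nonneg _ _ (by norm_num)]
    gcongr
    calc ENNReal.ofReal (ε ^ Module.finrank ℝ E) ^ (1 / 2 : ℝ)
        ≤ ENNReal.ofReal (ε ^ 2) ^ (1 / 2 : ℝ) := by
          gcongr ENNReal.ofReal ?_ ^ _
          exact pow_le_pow_of_le_one hε0.le hε1 hd
      _ = ENNReal.ofReal ε := by
          rw [ENNReal.ofReal_rpow_of_nonneg (by positivity) (by norm_num), ← Real.sqrt_eq_rpow,
            Real.sqrt_sq hε0.le]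
  calc ENNReal.ofReal ε⁻¹ * ∫⁻ x in closedBall 0 ε, ‖h x‖ₑ ∂μ
      ≤ ENNReal.ofReal ε⁻¹ * ((∫⁻ x in closedBall 0 ε, ‖h x‖ₑ ^ (2 : ℝ) ∂μ) ^ (1 / 2 : ℝ) *
          (ENNReal.ofReal ε * μ (closedBall 0 1) ^ (1 / 2 : ℝ))) := by
        gcongr
        exact hCS.trans (by gcongr)
    _ = (ENNReal.ofReal ε⁻¹ * ENNReal.ofReal ε) *
          ((∫⁻ x in closedBall 0 ε, ‖h x‖ₑ ^ (2 : ℝ) ∂μ) ^ (1 / 2 : ℝ) *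
          μ (closedBall 0 1) ^ (1 / 2 : ℝ)) := by ring
    _ = _ := by
        rw [← ENNReal.ofReal_mul (inv_nonneg.2 hε0.le), inv_mul_cancel₀ hε0.ne',
          ENNReal.ofReal_one, one_mul]

lemma integrableOn_adjointPairing_fderiv {d k l : ℕ} (A : Fin d → Matrix (Fin l) (Fin k) ℂ)
    {h : EuclideanSpace ℝ (Fin d) → Fin k → ℂ} (hh : Measurable h)
    {U : Set (EuclideanSpace ℝ (Fin d))}
    (hloc : ∀ K ⊆ U, IsCompact K → MemLp h 2 (volume.restrict K))
    {φ : EuclideanSpace ℝ (Fin d) → Fin l → ℂ} (hφ : ContDiff ℝ 1 φ)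
    (hc : HasCompactSupport φ) (hU : tsupport φ ⊆ U) :
    IntegrableOn (fun x => adjointPairing A (h x) (fderiv ℝ φ x)) U := by
  have hcont : Continuous (fderiv ℝ φ) := hφ.continuous_fderiv one_ne_zero
  obtain ⟨C, hC⟩ := (hc.fderiv ℝ).exists_bound_of_continuous hcont
  have hzero : ∀ x ∉ tsupport φ, adjointPairing A (h x) (fderiv ℝ φ x) = 0 := fun x hx => by
    rw [fderiv_of_notMem_tsupport ℝ hx]
    simp [adjointPairing]
  have : IsFiniteMeasure ((volume : Measure (EuclideanSpace ℝ (Fin d))).restrict (tsupport φ)) :=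
    isFiniteMeasure_restrict.2 hc.isCompact.measure_ne_top
  have hint : IntegrableOn (fun x => adjointPairing A (h x) (fderiv ℝ φ x)) (tsupport φ) := by
    refine (((hloc _ hU hc.isCompact).integrable (by norm_num)).norm.const_mul
      ((∑ j, ∑ i, ∑ p, ‖A i p j‖) * C)).mono'
      (measurable_adjointPairing A hh hcont).aestronglyMeasurable
      (Eventually.of_forall fun x => (norm_adjointPairing_le A _ _).trans ?_)
    gcongr
    exact hC x
  exact ((integrableOn_iff_integrable_of_support_subset
    (Function.support_subset_iff'.2 hzero)).1 hint).integrableOn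

/-- Rescaled cutoff of a test function to the ball of radius `ε`, with derivative `O(ε⁻¹)`. -/
lemma exists_cutoff_near_zero {E F : Type*} [NormedAddCommGroup E] [InnerProductSpace ℝ E]
    [FiniteDimensional ℝ E] [NormedAddCommGroup F] [NormedSpace ℝ F] {φ : E → F}
    (hφ : ContDiff ℝ (⊤ : ℕ∞) φ) (hc : HasCompactSupport φ) :
    ∃ C : ℝ, ∀ ε : ℝ, 0 < ε → ε ≤ 1 → ∃ φ₁ : E → F, ContDiff ℝ (⊤ : ℕ∞) φ₁ ∧
      tsupport φ₁ ⊆ tsupport φ ∧ tsupport φ₁ ⊆ closedBall 0 ε ∧ (∀ᶠ x in 𝓝 0, φ₁ x = φ x) ∧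
      ∀ x, ‖fderiv ℝ φ₁ x‖ ≤ ε⁻¹ * C := by
  let f : ContDiffBump (0 : E) := ⟨1 / 2, 1, by norm_num, by norm_num⟩
  have hf : ContDiff ℝ (⊤ : ℕ∞) f := f.contDiff
  have htop : ((⊤ : ℕ∞) : WithTop ℕ∞) ≠ 0 := by simp
  obtain ⟨C₀, hC₀⟩ := hc.exists_bound_of_continuous hφ.continuous
  obtain ⟨C₁, hC₁⟩ := (hc.fderiv ℝ).exists_bound_of_continuous (hφ.continuous_fderiv htop)
  obtain ⟨C₂, hC₂⟩ :=
    (f.hasCompactSupport.fderiv ℝ).exists_bound_of_continuous (hf.continuous_fderiv htop)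
  have hC₀' : 0 ≤ C₀ := (norm_nonneg _).trans (hC₀ 0)
  have hC₁' : 0 ≤ C₁ := (norm_nonneg _).trans (hC₁ 0)
  have hC₂' : 0 ≤ C₂ := (norm_nonneg _).trans (hC₂ 0)
  refine ⟨C₁ + C₂ * C₀, fun ε hε hε1 => ?_⟩
  have hψ : ContDiff ℝ (⊤ : ℕ∞) fun x : E => f (ε⁻¹ • x) := hf.comp (contDiff_const_smul _)
  refine ⟨fun x => f (ε⁻¹ • x) • φ x, hψ.smul hφ,
    closure_mono (Function.support_smul_subset_right _ _), ?_, ?_, fun x => ?_⟩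
  · refine closure_minimal (fun x hx => ?_) isClosed_closedBall
    have hx' : ε⁻¹ • x ∈ Function.support f := left_ne_zero_of_smul hx
    rw [f.support_eq, mem_ball_zero_iff, norm_smul, norm_inv, Real.norm_of_nonneg hε.le,
      inv_mul_lt_iff₀ hε] at hx'
    simpa [f] using hx'.le
  · have ht : Tendsto (fun x : E => ε⁻¹ • x) (𝓝 0) (𝓝 0) := by
      simpa using (continuous_const_smul ε⁻¹).tendsto (0 : E)
    filter_upwards [ht.eventually f.eventuallyEq_one] with x hx
    rw [hx, Pi.one_apply, one_smul]
  · rw [fderiv_fun_smul (hψ.differentiable htop x) (hφ.differentiable htop x)]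
    have h1 : ‖fderiv ℝ (fun x : E => f (ε⁻¹ • x)) x‖ ≤ ε⁻¹ * C₂ := by
      rw [fderiv_comp_smul, norm_smul, norm_inv, Real.norm_of_nonneg hε.le]
      gcongr
      exact hC₂ _
    calc _ ≤ ‖f (ε⁻¹ • x) • fderiv ℝ φ x‖ +
          ‖(fderiv ℝ (fun x : E => f (ε⁻¹ • x)) x).smulRight (φ x)‖ := norm_add_le _ _
      _ ≤ 1 * C₁ + ε⁻¹ * C₂ * C₀ := by
          rw [norm_smul, ContinuousLinearMap.norm_smulRight_apply,
            Real.norm_of_nonneg (f.nonneg' _)]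
          gcongr
          exacts [f.le_one, hC₁ x, hC₀ x]
      _ ≤ ε⁻¹ * C₁ + ε⁻¹ * C₂ * C₀ := by
          gcongr
          exact (one_le_inv₀ hε).2 hε1
      _ = ε⁻¹ * (C₁ + C₂ * C₀) := by ring

/-- **Removable singularity for first order constant-coefficient operators.**
If `h ∈ L²_loc(B; ℂᵏ)` and `Xh = 0` distributionally on `B \ {0}`, then `Xh = 0`
distributionally on the whole unit ball `B`. -/
theorem removable_singularity_first_order
    (n k l : ℕ) (hn : 1 ≤ n) (hk : 1 ≤ k) (hl : 1 ≤ l)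
    (A : Fin (n + 1) → Matrix (Fin l) (Fin k) ℂ)
    (h : EuclideanSpace ℝ (Fin (n + 1)) → Fin k → ℂ)
    (hmeas : Measurable h)
    (hloc : ∀ K : Set (EuclideanSpace ℝ (Fin (n + 1))), IsCompact K →
      K ⊆ ball (0 : EuclideanSpace ℝ (Fin (n + 1))) 1 →
      (∫⁻ x in K, (∑ j, ((‖h x j‖₊ : ℝ≥0∞) ^ 2))) < ⊤)
    (hdist : ∀ φ : EuclideanSpace ℝ (Fin (n + 1)) → Fin l → ℂ,
      ContDiff ℝ (⊤ : ℕ∞) φ → HasCompactSupport φ →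
      tsupport φ ⊆ ball (0 : EuclideanSpace ℝ (Fin (n + 1))) 1 \ {0} →
      (∫ x in ball (0 : EuclideanSpace ℝ (Fin (n + 1))) 1,
        ∑ j, (starRingEnd ℂ) (h x j) *
          (-∑ i, ∑ p, (starRingEnd ℂ) (A i p j) *
            fderiv ℝ φ x (EuclideanSpace.single i 1) p)) = 0) :
    ∀ φ : EuclideanSpace ℝ (Fin (n + 1)) → Fin l → ℂ,
      ContDiff ℝ (⊤ : ℕ∞) φ → HasCompactSupport φ →
      tsupport φ ⊆ ball (0 : EuclideanSpace ℝ (Fin (n + 1))) 1 →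
      (∫ x in ball (0 : EuclideanSpace ℝ (Fin (n + 1))) 1,
        ∑ j, (starRingEnd ℂ) (h x j) *
          (-∑ i, ∑ p, (starRingEnd ℂ) (A i p j) *
            fderiv ℝ φ x (EuclideanSpace.single i 1) p)) = 0 := by
  intro φ hφ hc hsupp
  change ∫ x in ball 0 1, adjointPairing A (h x) (fderiv ℝ φ x) = 0
  replace hdist : ∀ φ : EuclideanSpace ℝ (Fin (n + 1)) → Fin l → ℂ,
      ContDiff ℝ (⊤ : ℕ∞) φ → HasCompactSupport φ →
      tsupport φ ⊆ ball (0 : EuclideanSpace ℝ (Fin (n + 1))) 1 \ {0} →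
      ∫ x in ball 0 1, adjointPairing A (h x) (fderiv ℝ φ x) = 0 := hdist
  have htop : (1 : WithTop ℕ∞) ≤ ((⊤ : ℕ∞) : WithTop ℕ∞) := by exact_mod_cast le_top
  have hL2 : ∀ K ⊆ ball (0 : EuclideanSpace ℝ (Fin (n + 1))) 1, IsCompact K →
      MemLp h 2 (volume.restrict K) := fun K hKU hK => by
    refine ⟨hmeas.aestronglyMeasurable, ?_⟩
    rw [eLpNorm_lt_top_iff_lintegral_rpow_enorm_lt_top (by simp) (by simp)]
    refine (lintegral_mono fun x => ?_).trans_lt (hloc K hK hKU)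
    simpa [enorm_eq_nnnorm] using enorm_sq_le_sum (h x)
  have hlim := tendsto_inv_mul_lintegral_closedBall volume
    (E := EuclideanSpace ℝ (Fin (n + 1))) (by simpa using hn) (r := 1 / 2) (by norm_num)
    (hL2 _ (closedBall_subset_ball (by norm_num)) (isCompact_closedBall _ _))
  obtain ⟨C, hC⟩ := exists_cutoff_near_zero hφ hc
  set M : ℝ := ∑ j, ∑ i, ∑ p, ‖A i p j‖
  have hM : 0 ≤ M := by positivity
  have hlim' := ENNReal.Tendsto.const_mul (a := ENNReal.ofReal (M * C)) hlim
    (Or.inr ENNReal.ofReal_ne_top)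
  rw [mul_zero] at hlim'
  rw [← enorm_eq_zero, ← nonpos_iff_eq_zero]
  refine ge_of_tendsto hlim' ?_
  filter_upwards [Ioc_mem_nhdsGT one_pos] with ε hε
  obtain ⟨φ₁, hφ₁, hsupp₁, hball, heq, hbound⟩ := hC ε hε.1 hε.2
  have hc₁ : HasCompactSupport φ₁ := hc.mono' ((subset_tsupport _).trans hsupp₁)
  have hfar : ∫ x in ball 0 1, adjointPairing A (h x) (fderiv ℝ (φ - φ₁) x) = 0 := by
    refine hdist _ (hφ.sub hφ₁) (hc.sub hc₁) fun x hx => ⟨?_, ?_⟩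
    · exact hsupp ((tsupport_sub φ φ₁ |>.trans (Set.union_subset le_rfl hsupp₁)) hx)
    · rintro rfl
      refine notMem_tsupport_iff_eventuallyEq.2 ?_ hx
      filter_upwards [heq] with x hx
      simp [hx]
  have hsplit : ∫ x in ball 0 1, adjointPairing A (h x) (fderiv ℝ φ x) =
      ∫ x in ball 0 1, adjointPairing A (h x) (fderiv ℝ φ₁ x) := by
    have hadd (x : EuclideanSpace ℝ (Fin (n + 1))) : adjointPairing A (h x) (fderiv ℝ φ x) =
        adjointPairing A (h x) (fderiv ℝ φ₁ x) +
          adjointPairing A (h x) (fderiv ℝ (φ - φ₁) x) := by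
      rw [← adjointPairing_add, fderiv_sub (hφ.differentiable (by simp) x)
        (hφ₁.differentiable (by simp) x), add_sub_cancel]
    simp_rw [hadd]
    rw [integral_add, hfar, add_zero]
    · exact integrableOn_adjointPairing_fderiv A hmeas hL2 (hφ₁.of_le htop) hc₁
        (hsupp₁.trans hsupp)
    · exact integrableOn_adjointPairing_fderiv A hmeas hL2 ((hφ.sub hφ₁).of_le htop) (hc.sub hc₁)
        ((tsupport_sub φ φ₁).trans (Set.union_subset hsupp (hsupp₁.trans hsupp)))
  rw [hsplit]
  calc ‖∫ x in ball 0 1, adjointPairing A (h x) (fderiv ℝ φ₁ x)‖ₑ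
      ≤ ∫⁻ x in ball 0 1, ‖adjointPairing A (h x) (fderiv ℝ φ₁ x)‖ₑ :=
        enorm_integral_le_lintegral_enorm _
    _ ≤ ∫⁻ x, ‖adjointPairing A (h x) (fderiv ℝ φ₁ x)‖ₑ := setLIntegral_le_lintegral _ _
    _ ≤ ∫⁻ x, (closedBall 0 ε).indicator
          (fun x => ENNReal.ofReal (M * C) * ENNReal.ofReal ε⁻¹ * ‖h x‖ₑ) x := by
        refine lintegral_mono fun x => ?_
        by_cases hx : x ∈ closedBall (0 : EuclideanSpace ℝ (Fin (n + 1))) ε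
        · rw [Set.indicator_of_mem hx, ← ENNReal.ofReal_mul' (inv_nonneg.2 hε.1.le),
            ← ofReal_norm, ← ofReal_norm,
            ← ENNReal.ofReal_mul' (norm_nonneg _)]
          refine ENNReal.ofReal_le_ofReal ((norm_adjointPairing_le A _ _).trans ?_)
          calc M * ‖fderiv ℝ φ₁ x‖ * ‖h x‖ ≤ M * (ε⁻¹ * C) * ‖h x‖ := by
                gcongr
                exact hbound x
            _ = M * C * ε⁻¹ * ‖h x‖ := by ring
        · rw [fderiv_of_notMem_tsupport ℝ fun hmem => hx (hball hmem)]
          simp [adjointPairing]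
    _ = ENNReal.ofReal (M * C) * (ENNReal.ofReal ε⁻¹ * ∫⁻ x in closedBall 0 ε, ‖h x‖ₑ) := by
        rw [lintegral_indicator isClosed_closedBall.measurableSet,
          lintegral_const_mul _ hmeas.enorm, mul_assoc]
end

section
/- Let n, m ≥ 1, let B ⊂ ℝ^{1+n} be the open unit ball, and let A : B → ℒ(ℂ^{(1+n)m}) be bounded measurable. Suppose g ∈ L²_loc(B; ℂ^{(1+n)m}) (viewed as an m-tuple of vector fields g^α = (g^α_0, …, g^α_n), α = 1, …, m) satisfies, in the distributional sense on B \ {0}: (a) div(Ag) = 0, i.e. ∫_B ⟨A(x)g(x), ∇φ(x)⟩ dx = 0 for all φ ∈ C_c^∞(B \ {0}; ℂ^m), where (∇φ)^α_i = ∂_i φ^α; and (b) curl g = 0, i.e. ∫_B (g^α_i ∂_j φ − g^α_j ∂_i φ) dx = 0 for all 0 ≤ i, j ≤ n, all α, and all scalar φ ∈ C_c^∞(B \ {0}). Then there exists a locally integrable u : B → ℂ^m whose distributional gradient equals g on all of B (i.e. ∫_B u^α ∂_i φ dx = −∫_B g^α_i φ dx for all φ ∈ C_c^∞(B) and all i,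 α) and which is a weak solution of div(A ∇u) = 0 in B, i.e. ∫_B ⟨A(x)g(x), ∇φ(x)⟩ dx = 0 for all φ ∈ C_c^∞(B; ℂ^m). -/
open MeasureTheory Metric
open scoped ENNReal NNReal

theorem add_smul_sub_mem_ball {E : Type*} [NormedAddCommGroup E] [NormedSpace ℝ E]
    {a x : E} {r t : ℝ} (ha : a ∈ ball (0 : E) r)
    (hx : x ∈ ball (0 : E) r) (ht : 0 ≤ t) (ht1 : t ≤ 1) : a + t • (x - a) ∈ ball (0 : E) r :=
  (convex_ball _ _).add_smul_sub_mem ha hx ⟨ht, ht1⟩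

section Homothety

variable {E : Type*} [NormedAddCommGroup E] [NormedSpace ℝ E] [FiniteDimensional ℝ E]
  [MeasurableSpace E] [BorelSpace E] (μ : Measure E) [μ.IsAddHaarMeasure]

theorem lintegral_comp_homothety {f : E → ℝ≥0∞} (hf : Measurable f) (a : E) {t : ℝ} (ht : 0 < t) :
    ∫⁻ x, f (a + t • (x - a)) ∂μ
      = ENNReal.ofReal ((t ^ Module.finrank ℝ E)⁻¹) * ∫⁻ x, f x ∂μ := by
  have h1 : ∫⁻ x, f (a + t • (x - a)) ∂μ = ∫⁻ x, f (a + t • x) ∂μ :=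
    lintegral_sub_right_eq_self (fun x => f (a + t • x)) a
  have h2 : ∫⁻ x, f (a + t • x) ∂μ = ∫⁻ y, f (a + y) ∂(μ.map (t • ·)) := by
    rw [lintegral_map (by fun_prop) (by fun_prop)]
  rw [h1, h2, Measure.map_addHaar_smul μ ht.ne', lintegral_smul_measure,
    lintegral_add_left_eq_self, abs_of_pos (by positivity), smul_eq_mul]

theorem integral_comp_homothety (f : E → ℂ) (a : E) {t : ℝ} (ht : 0 < t) :
    ∫ x, f (a + t • (x - a)) ∂μ = ((t ^ Module.finrank ℝ E)⁻¹ : ℝ) * ∫ x, f x ∂μ := by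
  rw [integral_sub_right_eq_self (fun x => f (a + t • x)) a,
    Measure.integral_comp_smul μ (fun x => f (a + x)), integral_add_left_eq_self,
    abs_of_pos (by positivity)]
  simp

theorem lintegral_segment_le {f : E → ℝ≥0∞} (hf : Measurable f) (r t : ℝ) (ht : 0 < t)
    (ht1 : t ≤ 1) :
    ∫⁻ a in ball (0 : E) r, ∫⁻ x in ball (0 : E) r, f (a + t • (x - a)) ∂μ ∂μ
      ≤ μ (ball 0 r) * (ENNReal.ofReal (2 ^ Module.finrank ℝ E) * ∫⁻ y in ball (0 : E) r, f y ∂μ) := by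
  have hind : Measurable ((ball (0 : E) r).indicator f) := hf.indicator measurableSet_ball
  have key : ∀ (b : E) (s : ℝ), b ∈ ball (0 : E) r → 1 / 2 ≤ s → s ≤ 1 →
      ∫⁻ x in ball (0 : E) r, f (b + s • (x - b)) ∂μ
        ≤ ENNReal.ofReal (2 ^ Module.finrank ℝ E) * ∫⁻ y in ball (0 : E) r, f y ∂μ := by
    intro b s hb hs hs1
    calc ∫⁻ x in ball (0 : E) r, f (b + s • (x - b)) ∂μ
        = ∫⁻ x in ball (0 : E) r, (ball (0 : E) r).indicator f (b + s • (x - b)) ∂μ := by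
          refine setLIntegral_congr_fun measurableSet_ball fun x hx => ?_
          rw [Set.indicator_of_mem (add_smul_sub_mem_ball hb hx (by linarith) hs1)]
      _ ≤ ∫⁻ x, (ball (0 : E) r).indicator f (b + s • (x - b)) ∂μ := setLIntegral_le_lintegral _ _
      _ = ENNReal.ofReal ((s ^ Module.finrank ℝ E)⁻¹) * ∫⁻ y in ball (0 : E) r, f y ∂μ := by
          rw [lintegral_comp_homothety μ hind b (by linarith), lintegral_indicator measurableSet_ball]
      _ ≤ _ := by
          gcongr
          rw [← inv_pow]
          have : s⁻¹ ≤ 2 := by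
            rw [inv_le_comm₀ (by linarith) (by norm_num)]; linarith
          gcongr
  rcases le_total (1 / 2) t with h | h
  · calc _ ≤ ∫⁻ a in ball (0 : E) r, (ENNReal.ofReal (2 ^ Module.finrank ℝ E) *
          ∫⁻ y in ball (0 : E) r, f y ∂μ) ∂μ :=
          setLIntegral_mono measurable_const fun a ha => key a t ha h ht1
      _ = _ := by rw [setLIntegral_const, mul_comm]
  · rw [lintegral_lintegral_swap (by fun_prop)]
    calc _ ≤ ∫⁻ x in ball (0 : E) r, (ENNReal.ofReal (2 ^ Module.finrank ℝ E) *
          ∫⁻ y in ball (0 : E) r, f y ∂μ) ∂μ := by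
          refine setLIntegral_mono measurable_const fun x hx => ?_
          convert key x (1 - t) hx (by linarith) (by linarith) using 4 with a
          module
      _ = _ := by rw [setLIntegral_const, mul_comm]

theorem ae_lintegral_segment_lt_top {f : E → ℝ≥0∞} (hf : Measurable f) (r : ℝ)
    (hfr : ∫⁻ y in ball (0 : E) r, f y ∂μ < ⊤) :
    ∀ᵐ a ∂μ, a ∈ ball (0 : E) r →
      ∫⁻ t in Set.Ioc (0 : ℝ) 1, ∫⁻ x in ball (0 : E) r, f (a + t • (x - a)) ∂μ < ⊤ := by
  rw [← ae_restrict_iff' measurableSet_ball]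
  refine ae_lt_top' (AEMeasurable.lintegral_prod_right' (f := fun p : E × ℝ =>
    ∫⁻ x in ball (0 : E) r, f (p.1 + p.2 • (x - p.1)) ∂μ) ?_) ?_
  · exact (Measurable.lintegral_prod_right' (f := fun p : (E × ℝ) × E =>
      f (p.1.1 + p.1.2 • (p.2 - p.1.1))) (by fun_prop)).aemeasurable
  · rw [lintegral_lintegral_swap]
    · refine ne_top_of_le_ne_top ?_ (setLIntegral_mono (measurable_const) fun t ht =>
        lintegral_segment_le μ hf r t ht.1 ht.2)
      rw [setLIntegral_const]
      exact ENNReal.mul_ne_top (ENNReal.mul_ne_top measure_ball_lt_top.ne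
        (ENNReal.mul_ne_top ENNReal.ofReal_ne_top hfr.ne)) (by simp)
    · exact (Measurable.lintegral_prod_right' (f := fun p : (E × ℝ) × E =>
        f (p.1.1 + p.1.2 • (p.2 - p.1.1))) (by fun_prop)).aemeasurable

end Homothety

theorem integrable_mul_of_tsupport_subset_ball {E : Type*} [NormedAddCommGroup E]
    [ProperSpace E] [MeasurableSpace E] [BorelSpace E] (μ : Measure E) {h w : E → ℂ}
    (hh : ∀ r < 1, IntegrableOn h (ball (0 : E) r) μ) (hw : Continuous w)
    (hws : tsupport w ⊆ ball (0 : E) 1) : Integrable (fun x => h x * w x) μ := by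
  obtain ⟨r, hr, hsub⟩ := exists_lt_subset_ball (isClosed_tsupport w) hws
  have hcs : HasCompactSupport w :=
    (isCompact_closedBall (0 : E) r).of_isClosed_subset (isClosed_tsupport w)
      (hsub.trans ball_subset_closedBall)
  obtain ⟨C, hC⟩ := hw.bounded_above_of_compact_support hcs
  refine (integrableOn_iff_integrable_of_support_subset (s := ball (0 : E) r) ?_).1
    ((hh r hr).mul_bdd (c := C) hw.aestronglyMeasurable (.of_forall hC))
  intro x hx
  by_contra hxr
  exact hx (by simp [image_eq_zero_of_notMem_tsupport fun h' => hxr (hsub h')])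

/-- Cutting a test function off near the origin costs at most a factor `k` in the gradient. -/
theorem exists_cutoff_near_zero_s1 {E : Type*} [NormedAddCommGroup E] [NormedSpace ℝ E]
    [FiniteDimensional ℝ E] {ψ : E → ℂ} (hψ : ContDiff ℝ (⊤ : ℕ∞) ψ)
    (hψc : HasCompactSupport ψ) :
    ∃ C : ℝ, 0 ≤ C ∧ ∀ k : ℕ, 1 ≤ k → ∃ χ : E → ℂ, ContDiff ℝ (⊤ : ℕ∞) χ ∧
      tsupport χ ⊆ tsupport ψ ∩ closedBall 0 (2 / k) ∧ (0 : E) ∉ tsupport (fun x => ψ x - χ x) ∧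
      ∀ x, ‖fderiv ℝ χ x‖ ≤ C * k := by
  let f : ContDiffBump (0 : E) := ⟨1, 2, one_pos, one_lt_two⟩
  have hf : ContDiff ℝ (⊤ : ℕ∞) f := f.contDiff
  obtain ⟨C₀, hC₀⟩ := hψ.continuous.bounded_above_of_compact_support hψc
  obtain ⟨C₁, hC₁⟩ := (hψ.continuous_fderiv (by simp)).bounded_above_of_compact_support
    (hψc.fderiv ℝ)
  obtain ⟨C₂, hC₂⟩ := (hf.continuous_fderiv (by simp)).bounded_above_of_compact_support
    (f.hasCompactSupport.fderiv ℝ)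
  have h0 : 0 ≤ C₀ := (norm_nonneg _).trans (hC₀ 0)
  have h1 : 0 ≤ C₁ := (norm_nonneg _).trans (hC₁ 0)
  have h2 : 0 ≤ C₂ := (norm_nonneg _).trans (hC₂ 0)
  refine ⟨C₁ + C₂ * C₀, by positivity, fun k hk => ?_⟩
  have hk0 : (1 : ℝ) ≤ k := by exact_mod_cast hk
  have hkpos : (0 : ℝ) < k := by linarith
  have hη : ContDiff ℝ (⊤ : ℕ∞) (fun x : E => f ((k : ℝ) • x)) := by fun_prop
  refine ⟨fun x => f ((k : ℝ) • x) • ψ x, hη.smul hψ, ?_, ?_, fun x => ?_⟩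
  · refine Set.subset_inter ?_ ?_
    · exact closure_mono (Function.support_smul_subset_right (fun x => f ((k : ℝ) • x)) ψ)
    · refine closure_minimal (fun x hx => ?_) isClosed_closedBall
      have : (k : ℝ) • x ∈ Function.support f := by
        intro h; exact hx (by simp [h])
      rw [f.support_eq, mem_ball_zero_iff, norm_smul, Real.norm_of_nonneg hkpos.le] at this
      rw [mem_closedBall_zero_iff, le_div_iff₀ hkpos, mul_comm]
      exact this.le
  · rw [notMem_tsupport_iff_eventuallyEq]
    filter_upwards [ball_mem_nhds (0 : E) (inv_pos.2 hkpos)] with x hx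
    have : (k : ℝ) • x ∈ closedBall (0 : E) f.rIn := by
      rw [mem_ball_zero_iff, inv_eq_one_div, lt_div_iff₀ hkpos, mul_comm] at hx
      rw [mem_closedBall_zero_iff, norm_smul, Real.norm_of_nonneg hkpos.le]
      exact hx.le
    simp [f.one_of_mem_closedBall this]
  · have hd1 : HasFDerivAt (fun x : E => f ((k : ℝ) • x))
        ((k : ℝ) • fderiv ℝ f ((k : ℝ) • x)) x := by
      have := ((hf.differentiable (by simp)) ((k : ℝ) • x)).hasFDerivAt.comp x
        ((hasFDerivAt_id x).const_smul (k : ℝ))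
      refine this.congr_fderiv ?_
      ext y; simp
    have hd2 := ((hψ.differentiable (by simp)) x).hasFDerivAt
    rw [(hd1.fun_smul hd2).fderiv]
    calc _ ≤ ‖f ((k : ℝ) • x)‖ * ‖fderiv ℝ ψ x‖ + ‖(k : ℝ) • fderiv ℝ f ((k : ℝ) • x)‖ * ‖ψ x‖ := by
          refine (norm_add_le _ _).trans ?_
          rw [norm_smul, ContinuousLinearMap.norm_smulRight_apply]
      _ ≤ 1 * C₁ + k * C₂ * C₀ := by
          rw [norm_smul, Real.norm_of_nonneg hkpos.le, Real.norm_of_nonneg f.nonneg]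
          gcongr
          · exact f.le_one
          · exact hC₁ x
          · exact hC₂ _
          · exact hC₀ x
      _ ≤ _ := by nlinarith

section Removable

variable {E : Type*} [NormedAddCommGroup E] [NormedSpace ℝ E] [FiniteDimensional ℝ E]
  [MeasurableSpace E] [BorelSpace E] (μ : Measure E) [μ.IsAddHaarMeasure]

theorem tendsto_setIntegral_closedBall_zero {f : E → ℝ} {s : ℝ} (hs : 0 < s)
    (hd : 0 < Module.finrank ℝ E)
    (hf : IntegrableOn f (ball (0 : E) s) μ) :
    Filter.Tendsto (fun k : ℕ => ∫ x in closedBall (0 : E) (2 / k), f x ∂μ) Filter.atTop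
      (nhds 0) := by
  have hk : Filter.Tendsto (fun k : ℕ => (2 : ℝ) / k) Filter.atTop (nhds 0) :=
    tendsto_const_div_atTop_nhds_zero_nat 2
  have hm : Filter.Tendsto (fun k : ℕ => μ (closedBall (0 : E) (2 / k))) Filter.atTop (nhds 0) := by
    have h1 : ∀ k : ℕ, μ (closedBall (0 : E) (2 / k)) =
        ENNReal.ofReal (((2 : ℝ) / k) ^ Module.finrank ℝ E) * μ (ball 0 1) := fun k =>
      Measure.addHaar_closedBall μ 0 (by positivity)
    simp_rw [h1]
    have h2 := ENNReal.Tendsto.mul_const (b := μ (ball (0 : E) 1))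
      (ENNReal.tendsto_ofReal (hk.pow (Module.finrank ℝ E))) (Or.inr measure_ball_lt_top.ne)
    simpa [hd.ne'] using h2
  have := Integrable.tendsto_setIntegral_nhds_zero (μ := μ.restrict (ball (0 : E) s)) hf
    (l := Filter.atTop) (s := fun k : ℕ => closedBall (0 : E) (2 / k))
    (tendsto_of_tendsto_of_tendsto_of_le_of_le tendsto_const_nhds hm (fun _ => zero_le)
      fun k => Measure.restrict_apply_le _ _)
  refine this.congr' ?_
  filter_upwards [hk.eventually_lt_const hs] with k hk
  rw [Measure.restrict_restrict measurableSet_closedBall,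
    Set.inter_eq_left.2 (closedBall_subset_ball hk)]

/-- In dimension at least two a point is removable for locally square integrable fields satisfying
a first-order homogeneous differential equation in the sense of distributions. -/
theorem integral_mul_fderiv_eq_zero_of_punctured {ι : Type*} [Fintype ι]
    (hd : 2 ≤ Module.finrank ℝ E) {F : E → ι → ℂ} (v : ι → E)
    (hF : ∀ r < 1, ∀ i, MemLp (F · i) 2 (μ.restrict (ball (0 : E) r)))
    (h : ∀ ψ : E → ℂ, ContDiff ℝ (⊤ : ℕ∞) ψ → HasCompactSupport ψ →
      tsupport ψ ⊆ ball (0 : E) 1 \ {0} →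
      ∫ x in ball (0 : E) 1, ∑ i, F x i * fderiv ℝ ψ x (v i) ∂μ = 0)
    {ψ : E → ℂ} (hψ : ContDiff ℝ (⊤ : ℕ∞) ψ) (hψc : HasCompactSupport ψ)
    (hψs : tsupport ψ ⊆ ball (0 : E) 1) :
    ∫ x in ball (0 : E) 1, ∑ i, F x i * fderiv ℝ ψ x (v i) ∂μ = 0 := by
  have hint : ∀ χ : E → ℂ, ContDiff ℝ (⊤ : ℕ∞) χ → tsupport χ ⊆ ball (0 : E) 1 → ∀ i,
      Integrable (fun x => F x i * fderiv ℝ χ x (v i)) μ := fun χ hχ hχs i =>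
    integrable_mul_of_tsupport_subset_ball μ
      (fun r hr =>
        haveI : IsFiniteMeasure (μ.restrict (ball (0 : E) r)) :=
          isFiniteMeasure_restrict.2 measure_ball_lt_top.ne
        (hF r hr i).integrable one_le_two)
      ((hχ.continuous_fderiv (by simp)).clm_apply continuous_const)
      ((tsupport_fderiv_apply_subset ℝ (v i)).trans hχs)
  have hsq : ∀ i, IntegrableOn (fun x => ‖F x i‖ ^ 2) (ball (0 : E) (1 / 2)) μ := fun i =>
    (memLp_two_iff_integrable_sq_norm (hF _ (by norm_num) i).1).1 (hF _ (by norm_num) i)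
  obtain ⟨C, hC, hcut⟩ := exists_cutoff_near_zero_s1 hψ hψc
  set V : ℝ := μ.real (closedBall (0 : E) 1) with hV
  set I : ℂ := ∫ x in ball (0 : E) 1, ∑ i, F x i * fderiv ℝ ψ x (v i) ∂μ with hI
  have hbound : ∀ l : ℝ, 0 < l → ∀ k : ℕ, 5 ≤ k →
      ‖I‖ ≤ ∑ i, C * ‖v i‖ * (l⁻¹ * ∫ x in closedBall (0 : E) (2 / k), ‖F x i‖ ^ 2 ∂μ
        + 4 * l * V) := by
    intro l hl k hk
    have hk0 : (5 : ℝ) ≤ k := by exact_mod_cast hk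
    have hkpos : (0 : ℝ) < k := by linarith
    have hk2 : (2 : ℝ) / k < 1 / 2 := by rw [div_lt_iff₀ hkpos]; linarith
    obtain ⟨χ, hχ, hχs, hχ0, hχb⟩ := hcut k (by omega)
    have hχψ : tsupport χ ⊆ tsupport ψ := hχs.trans Set.inter_subset_left
    have hsub : tsupport (fun x => ψ x - χ x) ⊆ tsupport ψ :=
      (tsupport_sub ψ χ).trans (Set.union_subset subset_rfl hχψ)
    have h0 := h (fun x => ψ x - χ x) (hψ.sub hχ)
      (hψc.of_isClosed_subset (isClosed_tsupport _) hsub)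
      fun x hx => ⟨hψs (hsub hx), fun hx0 => hχ0 (Set.mem_singleton_iff.1 hx0 ▸ hx)⟩
    have hIχ : I = ∫ x in ball (0 : E) 1, ∑ i, F x i * fderiv ℝ χ x (v i) ∂μ := by
      rw [hI, ← sub_eq_zero, ← integral_sub, ← h0]
      · congr 1 with x
        rw [← Finset.sum_sub_distrib]
        refine Finset.sum_congr rfl fun i _ => ?_
        rw [fderiv_fun_sub (hψ.differentiable (by simp) x) (hχ.differentiable (by simp) x)]
        simp [mul_sub]
      · exact (integrable_finsetSum _ fun i _ => hint ψ hψ hψs i).integrableOn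
      · exact (integrable_finsetSum _ fun i _ => hint χ hχ (hχψ.trans hψs) i).integrableOn
    rw [hIχ, integral_finsetSum _ fun i _ => (hint χ hχ (hχψ.trans hψs) i).integrableOn]
    refine (norm_sum_le _ _).trans (Finset.sum_le_sum fun i _ => ?_)
    have hz : ∀ x ∉ closedBall (0 : E) (2 / k), F x i * fderiv ℝ χ x (v i) = 0 := by
      intro x hx
      have : fderiv ℝ χ x = 0 := image_eq_zero_of_notMem_tsupport fun h' =>
        hx (hχs (tsupport_fderiv_subset ℝ h')).2
      simp [this]
    have hcb : closedBall (0 : E) (2 / k) ⊆ ball 0 1 := closedBall_subset_ball (by linarith)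
    rw [setIntegral_eq_of_subset_of_forall_sdiff_eq_zero measurableSet_ball hcb
      fun x hx => hz x hx.2]
    have hsqk : IntegrableOn (fun x => ‖F x i‖ ^ 2) (closedBall (0 : E) (2 / k)) μ :=
      (hsq i).mono_set (closedBall_subset_ball hk2)
    have hcst : IntegrableOn (fun _ : E => l * (k : ℝ) ^ 2) (closedBall (0 : E) (2 / k)) μ :=
      integrableOn_const (measure_closedBall_lt_top.ne)
    calc ‖∫ x in closedBall (0 : E) (2 / k), F x i * fderiv ℝ χ x (v i) ∂μ‖
        ≤ ∫ x in closedBall (0 : E) (2 / k),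
            C * ‖v i‖ * (l⁻¹ * ‖F x i‖ ^ 2 + l * (k : ℝ) ^ 2) ∂μ := by
          refine norm_integral_le_of_norm_le (((hsqk.const_mul _).add hcst).const_mul _)
            (.of_forall fun x => ?_)
          have h1 : ‖fderiv ℝ χ x (v i)‖ ≤ C * k * ‖v i‖ :=
            (ContinuousLinearMap.le_opNorm _ _).trans (by gcongr; exact hχb x)
          have h2 : ‖F x i‖ * k ≤ l⁻¹ * ‖F x i‖ ^ 2 + l * (k : ℝ) ^ 2 := by
            have : l⁻¹ * ‖F x i‖ ^ 2 + l * (k : ℝ) ^ 2 - ‖F x i‖ * k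
              = l⁻¹ * ((‖F x i‖ - l * k / 2) ^ 2 + 3 / 4 * (l * k) ^ 2) := by
              field_simp; ring
            have : 0 ≤ l⁻¹ * ((‖F x i‖ - l * k / 2) ^ 2 + 3 / 4 * (l * k) ^ 2) := by positivity
            linarith
          calc ‖F x i * fderiv ℝ χ x (v i)‖ ≤ ‖F x i‖ * (C * k * ‖v i‖) := by
                rw [norm_mul]; gcongr
            _ = C * ‖v i‖ * (‖F x i‖ * k) := by ring
            _ ≤ _ := by gcongr
      _ = C * ‖v i‖ * (l⁻¹ * ∫ x in closedBall (0 : E) (2 / k), ‖F x i‖ ^ 2 ∂μ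
            + μ.real (closedBall (0 : E) (2 / k)) * (l * (k : ℝ) ^ 2)) := by
          rw [integral_const_mul, integral_add (hsqk.const_mul _) hcst, integral_const_mul,
            setIntegral_const, smul_eq_mul]
      _ ≤ _ := by
          have hpow : ((2 : ℝ) / k) ^ Module.finrank ℝ E ≤ (2 / k) ^ 2 :=
            pow_le_pow_of_le_one (by positivity) (by linarith) hd
          have hvol : μ.real (closedBall (0 : E) (2 / k)) * (l * (k : ℝ) ^ 2) ≤ 4 * l * V := by
            rw [Measure.addHaar_real_closedBall' μ 0 (by positivity), ← hV]
            calc ((2 : ℝ) / k) ^ Module.finrank ℝ E * V * (l * (k : ℝ) ^ 2)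
                ≤ ((2 : ℝ) / k) ^ 2 * V * (l * (k : ℝ) ^ 2) := by gcongr
              _ = 4 * l * V := by field_simp; ring
          gcongr
  have hlim : ∀ l : ℝ, 0 < l → ‖I‖ ≤ (∑ i, C * ‖v i‖ * (4 * V)) * l := by
    intro l hl
    have hlim : Filter.Tendsto (fun k : ℕ => ∑ i, C * ‖v i‖ *
        (l⁻¹ * ∫ x in closedBall (0 : E) (2 / (k : ℕ)), ‖F x i‖ ^ 2 ∂μ + 4 * l * V)) Filter.atTop
        (nhds (∑ i, C * ‖v i‖ * (l⁻¹ * 0 + 4 * l * V))) :=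
      tendsto_finsetSum _ fun i _ => (((tendsto_setIntegral_closedBall_zero μ
        (by norm_num : (0 : ℝ) < 1 / 2) (by omega) (hsq i)).const_mul _).add_const _).const_mul _
    refine (ge_of_tendsto hlim (Filter.eventually_atTop.2 ⟨5, hbound l hl⟩)).trans_eq ?_
    rw [Finset.sum_mul]
    exact Finset.sum_congr rfl fun i _ => by ring
  set K := ∑ i, C * ‖v i‖ * (4 * V)
  have hK : Filter.Tendsto (fun l : ℝ => K * l) (nhdsWithin 0 (Set.Ioi 0)) (nhds (K * 0)) :=
    ((continuous_const_mul K).tendsto 0).mono_left nhdsWithin_le_nhds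
  have := ge_of_tendsto hK (Filter.eventually_of_mem self_mem_nhdsWithin hlim)
  rw [mul_zero] at this
  exact norm_le_zero_iff.1 this

end Removable

/-- A function `P` integrable near `0` cannot behave like `L / t` there unless `L = 0`. -/
theorem eq_zero_of_tendsto_mul_of_integrableOn {P : ℝ → ℂ} {L : ℂ}
    (hP : IntegrableOn P (Set.Ioc 0 1))
    (hL : Filter.Tendsto (fun t : ℝ => (t : ℂ) * P t) (nhdsWithin 0 (Set.Ioi 0)) (nhds L)) :
    L = 0 := by
  by_contra hne
  have hpos : 0 < ‖L‖ := norm_pos_iff.2 hne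
  have hev := hL.norm.eventually_const_lt (half_lt_self hpos)
  obtain ⟨ε, hε, hsub⟩ := mem_nhdsGT_iff_exists_Ioc_subset.1 hev
  set s := min ε 1
  have hs : 0 < s := lt_min hε one_pos
  have hint : IntegrableOn (fun t : ℝ => (‖L‖ / 2) * t⁻¹) (Set.Ioc 0 s) := by
    refine Integrable.mono' (hP.mono_set (Set.Ioc_subset_Ioc_right (min_le_right _ _))).norm
      (by fun_prop) ?_
    refine (ae_restrict_iff' measurableSet_Ioc).2 (.of_forall fun t ht => ?_)
    have h1 : ‖L‖ / 2 < ‖(t : ℂ) * P t‖ := hsub ⟨ht.1, ht.2.trans (min_le_left _ _)⟩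
    rw [norm_mul, Complex.norm_real, Real.norm_of_nonneg ht.1.le] at h1
    rw [Real.norm_of_nonneg (by have := ht.1; positivity), ← div_eq_mul_inv, div_le_iff₀ ht.1,
      mul_comm]
    exact h1.le
  have h2 : IntervalIntegrable (fun t : ℝ => t⁻¹) volume 0 s := by
    rw [intervalIntegrable_iff_integrableOn_Ioc_of_le hs.le]
    have := hint.const_mul (‖L‖ / 2)⁻¹
    refine this.congr (.of_forall fun t => ?_)
    field_simp
  rw [intervalIntegrable_inv_iff] at h2
  rcases h2 with h2 | h2
  · exact hs.ne h2
  · exact h2 (by simp [hs.le])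

theorem hasDerivAt_zpow_mul_comp_inv_homothety {E : Type*} [NormedAddCommGroup E]
    [NormedSpace ℝ E] {φ : E → ℂ} (hφ : Differentiable ℝ φ) (n : ℕ)
    (a y : E) {t : ℝ} (ht : 0 < t) :
    HasDerivAt (fun t : ℝ => ((t ^ (-(n : ℤ)) : ℝ) : ℂ) * φ (a + t⁻¹ • (y - a)))
      (-((((t ^ (n + 1))⁻¹ : ℝ) : ℂ) * (n * φ (a + t⁻¹ • (y - a)) +
        fderiv ℝ φ (a + t⁻¹ • (y - a)) (a + t⁻¹ • (y - a) - a)))) t := by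
  have h1 := (hasDerivAt_zpow (-(n : ℤ)) t (Or.inl ht.ne')).ofReal_comp
  have h2 : HasDerivAt (fun t : ℝ => a + t⁻¹ • (y - a)) ((-(t ^ 2)⁻¹) • (y - a)) t :=
    ((hasDerivAt_inv ht.ne').smul_const (y - a)).const_add a
  have h3 := (hφ (a + t⁻¹ • (y - a))).hasFDerivAt.comp_hasDerivAt t h2
  refine (h1.mul h3).congr_deriv ?_
  have e1 : t ^ (-(n : ℤ) - 1) = (t ^ (n + 1))⁻¹ := by
    rw [← zpow_natCast, ← zpow_neg]; congr 1; push_cast; ring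
  have e2 : t ^ (-(n : ℤ)) = t * (t ^ (n + 1))⁻¹ := by
    rw [zpow_neg, zpow_natCast, pow_succ]; field_simp
  have ht' : (t : ℂ) ≠ 0 := by exact_mod_cast ht.ne'
  simp only [Function.comp_apply, add_sub_cancel_left, map_smul, e1, e2, Complex.real_smul]
  push_cast
  field_simp
  ring

section Segment

variable {E : Type*} [NormedAddCommGroup E] [NormedSpace ℝ E] [FiniteDimensional ℝ E]
  [MeasurableSpace E] [BorelSpace E] (μ : Measure E) [μ.IsAddHaarMeasure]

theorem integrableOn_ball_comp_homothety {h : E → ℂ}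
    (hh : ∀ r < 1, IntegrableOn h (ball (0 : E) r) μ) {a : E} (ha : a ∈ ball (0 : E) 1) {t : ℝ}
    (ht : 0 < t) (ht1 : t ≤ 1) (r : ℝ) (hr : r < 1) :
    IntegrableOn (fun x => h (a + t • (x - a))) (ball (0 : E) r) μ := by
  rw [mem_ball_zero_iff] at ha
  obtain ⟨s, hs, hs1⟩ := exists_between (max_lt hr ha)
  rw [max_lt_iff] at hs
  refine IntegrableOn.mono_set ?_ (ball_subset_ball hs.1.le)
  have h1 : Integrable ((ball (0 : E) s).indicator h) μ :=
    (integrable_indicator_iff measurableSet_ball).2 (hh s hs1)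
  have h2 := ((h1.comp_add_left a).comp_smul ht.ne').comp_sub_right a
  refine h2.integrableOn.congr_fun (fun x hx => ?_) measurableSet_ball
  exact Set.indicator_of_mem
    (add_smul_sub_mem_ball (mem_ball_zero_iff.2 hs.2) hx ht.le ht1) _

theorem integrable_comp_segment {h : E → ℂ} (hm : Measurable h) (a : E) (r : ℝ)
    (hfin : ∫⁻ t in Set.Ioc (0 : ℝ) 1, ∫⁻ x in ball (0 : E) r, ‖h (a + t • (x - a))‖ₑ ∂μ < ⊤) :
    Integrable (fun p : ℝ × E => h (a + p.1 • (p.2 - a)))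
      ((volume.restrict (Set.Ioc 0 1)).prod (μ.restrict (ball (0 : E) r))) := by
  refine ⟨(hm.comp (by fun_prop)).aestronglyMeasurable, ?_⟩
  rw [HasFiniteIntegral, lintegral_prod _ (by fun_prop)]
  exact hfin

theorem integral_Ioc_segment_eq {n : ℕ} (hn : Module.finrank ℝ E = n + 1) {h φ : E → ℂ}
    (hh : ∀ r < 1, IntegrableOn h (ball (0 : E) r) μ) (hφ : ContDiff ℝ (⊤ : ℕ∞) φ)
    (hφs : tsupport φ ⊆ ball (0 : E) 1) {a : E} (ha : a ∈ ball (0 : E) 1)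
    {δ : ℝ} (hδ : 0 < δ) (hδ1 : δ ≤ 1) :
    ∫ t in δ..1, ∫ x, h (a + t • (x - a)) * (n * φ x + fderiv ℝ φ x (x - a)) ∂μ
      = δ * ∫ x, h (a + δ • (x - a)) * φ x ∂μ - ∫ x, h x * φ x ∂μ := by
  obtain ⟨r₀, hr₀, hsub₀⟩ := exists_lt_subset_ball (isClosed_tsupport φ) hφs
  rw [mem_ball_zero_iff] at ha
  set r := max r₀ ((‖a‖ + 1) / 2)
  have hr : r < 1 := max_lt hr₀ (by linarith)
  have har : a ∈ ball (0 : E) r :=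
    mem_ball_zero_iff.2 (lt_max_of_lt_right (by linarith))
  have hsub : tsupport φ ⊆ ball (0 : E) r := hsub₀.trans (ball_subset_ball (le_max_left _ _))
  have hφc : HasCompactSupport φ := (isCompact_closedBall (0 : E) r).of_isClosed_subset
    (isClosed_tsupport _) (hsub.trans ball_subset_closedBall)
  set κ : E → ℂ := fun x => n * φ x + fderiv ℝ φ x (x - a) with hκ
  have hκc : Continuous κ := by
    have := hφ.continuous_fderiv (by simp)
    have := hφ.continuous
    fun_prop
  have hκ0 : ∀ x ∉ tsupport φ, κ x = 0 := fun x hx => by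
    have h1 : φ x = 0 := image_eq_zero_of_notMem_tsupport hx
    have h2 : fderiv ℝ φ x = 0 :=
      image_eq_zero_of_notMem_tsupport fun h' => hx (tsupport_fderiv_subset ℝ h')
    simp [hκ, h1, h2]
  obtain ⟨C, hC⟩ := hκc.bounded_above_of_compact_support (HasCompactSupport.intro hφc hκ0)
  have hmem : ∀ t : ℝ, 0 < t → t ≤ 1 → ∀ y, a + t⁻¹ • (y - a) ∈ tsupport φ →
      y ∈ ball (0 : E) r := fun t ht ht1 y hy => by
    have := add_smul_sub_mem_ball har (hsub hy) ht.le ht1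
    simpa [smul_smul, ht.ne'] using this
  have hhom : ∀ (w : E → ℂ) (t : ℝ), 0 < t → ∫ x, h (a + t • (x - a)) * w x ∂μ
      = ∫ y, h y * ((((t ^ (n + 1))⁻¹ : ℝ) : ℂ) * w (a + t⁻¹ • (y - a))) ∂μ := by
    intro w t ht
    have := integral_comp_homothety μ (fun y => h y * w (a + t⁻¹ • (y - a))) a ht
    simp only [add_sub_cancel_left, smul_smul, inv_mul_cancel₀ ht.ne', one_smul,
      add_sub_cancel] at this
    rw [this, hn, ← integral_const_mul]
    congr 1 with y
    ring
  set H : E → ℂ := (ball (0 : E) r).indicator h with hH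
  have hHi : Integrable H μ := (integrable_indicator_iff measurableSet_ball).2 (hh r hr)
  have hHmul : ∀ (w : E → ℂ) (t : ℝ), (∀ x ∉ tsupport φ, w x = 0) → 0 < t → t ≤ 1 →
      ∀ (c : ℂ) y, h y * (c * w (a + t⁻¹ • (y - a))) = H y * (c * w (a + t⁻¹ • (y - a))) := by
    intro w t hw ht ht1 c y
    by_cases hy : y ∈ ball (0 : E) r
    · rw [hH, Set.indicator_of_mem hy]
    · rw [hw _ fun h' => hy (hmem t ht ht1 y h')]; simp
  have hφ0 : ∀ x ∉ tsupport φ, φ x = 0 := fun x hx => image_eq_zero_of_notMem_tsupport hx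
  have hI : ∀ t ∈ Set.Ioc δ 1, ∫ x, h (a + t • (x - a)) * κ x ∂μ
      = ∫ y, H y * ((((t ^ (n + 1))⁻¹ : ℝ) : ℂ) * κ (a + t⁻¹ • (y - a))) ∂μ := fun t ht => by
    rw [hhom κ t (hδ.trans ht.1)]
    congr 1 with y
    exact hHmul κ t hκ0 (hδ.trans ht.1) ht.2 _ y
  have hP : ∀ t : ℝ, 0 < t → t ≤ 1 → t * ∫ x, h (a + t • (x - a)) * φ x ∂μ
      = ∫ y, H y * (((t ^ (-(n : ℤ)) : ℝ) : ℂ) * φ (a + t⁻¹ • (y - a))) ∂μ := fun t ht ht1 => by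
    rw [hhom φ t ht, ← integral_const_mul]
    congr 1 with y
    rw [hHmul φ t hφ0 ht ht1]
    have e2 : t ^ (-(n : ℤ)) = t * (t ^ (n + 1))⁻¹ := by
      rw [zpow_neg, zpow_natCast, pow_succ]; field_simp
    rw [e2]; push_cast; ring
  have hPint : ∀ t : ℝ, Integrable
      (fun y => H y * (((t ^ (-(n : ℤ)) : ℝ) : ℂ) * φ (a + t⁻¹ • (y - a)))) μ := fun t => by
    obtain ⟨B, hB⟩ := hφ.continuous.bounded_above_of_compact_support hφc
    have := hφ.continuous
    refine hHi.mul_bdd (c := ‖((t ^ (-(n : ℤ)) : ℝ) : ℂ)‖ * B)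
      (Continuous.aestronglyMeasurable (by fun_prop)) (.of_forall fun y => ?_)
    rw [norm_mul]
    gcongr
    exact hB _
  have hP1 := hP 1 one_pos le_rfl
  simp only [one_smul, add_sub_cancel, Complex.ofReal_one, one_mul] at hP1
  rw [hP1, hP δ hδ hδ1, intervalIntegral.integral_of_le hδ1,
    setIntegral_congr_fun measurableSet_Ioc hI, integral_integral_swap, ← integral_sub]
  · congr 1 with y
    rw [integral_const_mul, ← mul_sub, ← intervalIntegral.integral_of_le hδ1]
    congr 1
    have hd := fun t (ht : t ∈ Set.uIcc δ 1) =>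
      (hasDerivAt_zpow_mul_comp_inv_homothety (hφ.differentiable (by simp)) n a y
        (hδ.trans_le (Set.uIcc_of_le hδ1 ▸ ht).1)).neg
    simp only [neg_neg] at hd
    rw [intervalIntegral.integral_eq_sub_of_hasDerivAt hd]
    · simp; ring
    · refine ContinuousOn.intervalIntegrable ?_
      rw [Set.uIcc_of_le hδ1]
      have hne : ∀ t ∈ Set.Icc δ 1, t ≠ 0 := fun t ht => (hδ.trans_le ht.1).ne'
      have h1 : ContinuousOn (fun t : ℝ => (((t ^ (n + 1))⁻¹ : ℝ) : ℂ)) (Set.Icc δ 1) :=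
        Complex.continuous_ofReal.comp_continuousOn
          ((continuousOn_pow _).inv₀ fun t ht => pow_ne_zero _ (hne t ht))
      have h2 : ContinuousOn (fun t : ℝ => a + t⁻¹ • (y - a)) (Set.Icc δ 1) :=
        ((continuousOn_inv₀.mono fun t ht => hne t ht).smul continuousOn_const).const_add a
      exact h1.mul (hκc.comp_continuousOn h2)
  · exact hPint δ
  · simpa using hPint 1
  · have hH2 : Integrable (fun p : ℝ × E => H p.2)
        ((volume.restrict (Set.Ioc δ 1)).prod μ) := hHi.comp_snd _
    refine hH2.mul_bdd (c := (δ ^ (n + 1))⁻¹ * C) ?_ ?_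
    · have := hκc.measurable
      exact Measurable.aestronglyMeasurable (by fun_prop)
    · rw [← Measure.restrict_univ (μ := μ), Measure.prod_restrict]
      refine (ae_restrict_iff' (measurableSet_Ioc.prod .univ)).2 (.of_forall fun p hp => ?_)
      have hp1 : δ < p.1 := hp.1.1
      have hp0 : 0 < p.1 := hδ.trans hp1
      rw [norm_mul, Complex.norm_real, Real.norm_of_nonneg (by positivity)]
      gcongr
      exact hC _

end Segment

section Poincare

variable {n : ℕ}

theorem sum_sub_mul_fderiv_single (φ : EuclideanSpace ℝ (Fin (n + 1)) → ℂ)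
    (x a : EuclideanSpace ℝ (Fin (n + 1))) :
    ∑ j, ((x j - a j : ℝ) : ℂ) * fderiv ℝ φ x (EuclideanSpace.single j 1)
      = fderiv ℝ φ x (x - a) := by
  have h : x - a = ∑ j, (x j - a j) • EuclideanSpace.single j (1 : ℝ) := by
    ext k
    simp [Pi.single_apply]
  conv_rhs => rw [h, map_sum]
  simp

/-- Derivative of the test function whose curl identity expresses the homotopy formula along segments
emanating from `a`. -/
theorem fderiv_coord_mul_comp_inv_homothety {φ : EuclideanSpace ℝ (Fin (n + 1)) → ℂ}
    (hφ : Differentiable ℝ φ) (a x v : EuclideanSpace ℝ (Fin (n + 1))) (j : Fin (n + 1))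
    {t : ℝ} (ht : 0 < t) :
    fderiv ℝ (fun y : EuclideanSpace ℝ (Fin (n + 1)) =>
        ((y j - a j : ℝ) : ℂ) * φ (a + t⁻¹ • (y - a))) (a + t • (x - a)) v
      = (v j : ℂ) * φ x + ((x j - a j : ℝ) : ℂ) * fderiv ℝ φ x v := by
  set y := a + t • (x - a) with hy
  have hx : a + t⁻¹ • (y - a) = x := by simp [hy, smul_smul, ht.ne']
  have h1 : HasFDerivAt (fun y : EuclideanSpace ℝ (Fin (n + 1)) => ((y j - a j : ℝ) : ℂ))
      (Complex.ofRealCLM.comp (EuclideanSpace.proj j)) y :=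
    Complex.ofRealCLM.hasFDerivAt.comp y
      (((EuclideanSpace.proj (𝕜 := ℝ) j).hasFDerivAt (x := y)).sub_const (a j))
  have h2 : HasFDerivAt (fun y : EuclideanSpace ℝ (Fin (n + 1)) => a + t⁻¹ • (y - a))
      (t⁻¹ • ContinuousLinearMap.id ℝ _) y :=
    ((((hasFDerivAt_id y).sub_const a).const_smul t⁻¹).const_add a)
  have h3 := (hφ (a + t⁻¹ • (y - a))).hasFDerivAt.comp y h2
  rw [hx] at h3
  have hyj : y j - a j = t * (x j - a j) := by simp [hy]
  have ht' : (t : ℂ) ≠ 0 := by exact_mod_cast ht.ne'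
  have h4 := (h1.mul h3).fderiv
  simp only [Function.comp_def] at h4
  rw [show (fun y : EuclideanSpace ℝ (Fin (n + 1)) =>
        ((y j - a j : ℝ) : ℂ) * φ (a + t⁻¹ • (y - a))) = (fun y : EuclideanSpace ℝ (Fin (n + 1)) =>
        ((y j - a j : ℝ) : ℂ)) * (fun y => φ (a + t⁻¹ • (y - a))) from rfl, h4]
  simp only [hx, hyj]
  simp
  field_simp
  ring

variable {g : EuclideanSpace ℝ (Fin (n + 1)) → Fin (n + 1) → ℂ}

theorem integral_segment_mul_fderiv_of_curl_eq_zero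
    (hg : ∀ j, ∀ r < 1, IntegrableOn (g · j) (ball (0 : EuclideanSpace ℝ (Fin (n + 1))) r))
    (hcurl : ∀ φ : EuclideanSpace ℝ (Fin (n + 1)) → ℂ,
      ContDiff ℝ (⊤ : ℕ∞) φ → HasCompactSupport φ →
      tsupport φ ⊆ ball (0 : EuclideanSpace ℝ (Fin (n + 1))) 1 → ∀ i j,
      ∫ x in ball (0 : EuclideanSpace ℝ (Fin (n + 1))) 1,
        (g x i * fderiv ℝ φ x (EuclideanSpace.single j 1) -
          g x j * fderiv ℝ φ x (EuclideanSpace.single i 1)) = 0)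
    {φ : EuclideanSpace ℝ (Fin (n + 1)) → ℂ} (hφ : ContDiff ℝ (⊤ : ℕ∞) φ)
    (hφc : HasCompactSupport φ)
    (hφs : tsupport φ ⊆ ball (0 : EuclideanSpace ℝ (Fin (n + 1))) 1)
    {a : EuclideanSpace ℝ (Fin (n + 1))}
    (ha : a ∈ ball (0 : EuclideanSpace ℝ (Fin (n + 1))) 1) {t : ℝ} (ht : 0 < t) (ht1 : t ≤ 1)
    (i : Fin (n + 1)) :
    ∫ x, (∑ j, ((x j - a j : ℝ) : ℂ) * g (a + t • (x - a)) j) *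
        fderiv ℝ φ x (EuclideanSpace.single i 1)
      = ∫ x, g (a + t • (x - a)) i * (n * φ x + fderiv ℝ φ x (x - a)) := by
  set γ : EuclideanSpace ℝ (Fin (n + 1)) → Fin (n + 1) → ℂ := fun x => g (a + t • (x - a)) with hγ
  have hγi : ∀ j, ∀ w : EuclideanSpace ℝ (Fin (n + 1)) → ℂ, Continuous w →
      (∀ x ∉ tsupport φ, w x = 0) → Integrable (fun x => γ x j * w x) := fun j w hw hw0 =>
    integrable_mul_of_tsupport_subset_ball volume
      (integrableOn_ball_comp_homothety volume (hg j) ha ht ht1) hw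
      ((closure_minimal (fun x (hx : w x ≠ 0) => by_contra fun h' => hx (hw0 x h'))
        (isClosed_tsupport φ)).trans hφs)
  have hφ0 : ∀ x ∉ tsupport φ, φ x = 0 := fun x hx => image_eq_zero_of_notMem_tsupport hx
  have hdφ0 : ∀ x ∉ tsupport φ, fderiv ℝ φ x = 0 := fun x hx =>
    image_eq_zero_of_notMem_tsupport fun h' => hx (tsupport_fderiv_subset ℝ h')
  have hcφ := hφ.continuous
  have hcd := hφ.continuous_fderiv (by simp)
  have key : ∀ j, ∫ x, (γ x i * (φ x + ((x j - a j : ℝ) : ℂ) *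
        fderiv ℝ φ x (EuclideanSpace.single j 1)) -
      γ x j * ((if j = i then 1 else 0) * φ x + ((x j - a j : ℝ) : ℂ) *
        fderiv ℝ φ x (EuclideanSpace.single i 1))) = 0 := by
    intro j
    set χ : EuclideanSpace ℝ (Fin (n + 1)) → ℂ := fun y =>
      ((y j - a j : ℝ) : ℂ) * φ (a + t⁻¹ • (y - a)) with hχ
    have hχd : ContDiff ℝ (⊤ : ℕ∞) χ := by
      refine ContDiff.mul (Complex.ofRealCLM.contDiff.comp ?_) (hφ.comp (by fun_prop))
      exact ((EuclideanSpace.proj (𝕜 := ℝ) j).contDiff).sub contDiff_const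
    set T := (fun x => a + t • (x - a)) '' tsupport φ with hT
    have hTc : IsCompact T := hφc.isCompact.image (by fun_prop)
    have hχT : tsupport χ ⊆ T := by
      refine closure_minimal (fun y hy => ?_) hTc.isClosed
      refine ⟨a + t⁻¹ • (y - a), ?_, by simp [smul_smul, ht.ne']⟩
      by_contra h'
      exact hy (by simp [hχ, hφ0 _ h'])
    have hTB : T ⊆ ball 0 1 := by
      rintro _ ⟨x, hx, rfl⟩
      exact add_smul_sub_mem_ball ha (hφs hx) ht.le ht1
    have h0 := hcurl χ hχd (hTc.of_isClosed_subset (isClosed_tsupport _) hχT)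
      (hχT.trans hTB) i j
    rw [setIntegral_eq_integral_of_forall_compl_eq_zero] at h0
    · have h1 := integral_comp_homothety volume (fun x =>
        g x i * fderiv ℝ χ x (EuclideanSpace.single j 1) -
          g x j * fderiv ℝ χ x (EuclideanSpace.single i 1)) a ht
      rw [h0, mul_zero] at h1
      refine Eq.trans ?_ h1
      congr 1 with x
      rw [fderiv_coord_mul_comp_inv_homothety (hφ.differentiable (by simp)) a x _ j ht,
        fderiv_coord_mul_comp_inv_homothety (hφ.differentiable (by simp)) a x _ j ht]
      simp [hγ, apply_ite]
    · intro x hx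
      have : fderiv ℝ χ x = 0 := image_eq_zero_of_notMem_tsupport fun h' =>
        hx (hTB (hχT (tsupport_fderiv_subset ℝ h')))
      simp [this]
  have hint1 : ∀ j, Integrable fun x => γ x i * (φ x + ((x j - a j : ℝ) : ℂ) *
        fderiv ℝ φ x (EuclideanSpace.single j 1)) := fun j =>
    hγi i _ (by fun_prop) fun x hx => by simp [hφ0 x hx, hdφ0 x hx]
  have hint2 : ∀ j, Integrable fun x => γ x j * ((if j = i then 1 else 0) * φ x +
        ((x j - a j : ℝ) : ℂ) * fderiv ℝ φ x (EuclideanSpace.single i 1)) := fun j =>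
    hγi j _ (by fun_prop) fun x hx => by simp [hφ0 x hx, hdφ0 x hx]
  have hsum := (integral_finsetSum Finset.univ fun j _ => (hint1 j).sub (hint2 j)).trans
    (Finset.sum_eq_zero fun j _ => key j)
  rw [eq_comm, ← sub_eq_zero, ← integral_sub]
  · refine Eq.trans ?_ hsum
    congr 1 with x
    simp only [Pi.sub_apply]
    rw [← sum_sub_mul_fderiv_single φ x a, Finset.sum_sub_distrib]
    simp only [mul_add, Finset.sum_add_distrib, Finset.mul_sum, Finset.sum_mul]
    simp only [Complex.ofReal_sub, Finset.sum_const, Finset.card_univ, Fintype.card_fin,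
      nsmul_eq_mul, Nat.cast_add, Nat.cast_one, ite_mul, one_mul, zero_mul, mul_ite, mul_zero,
      Finset.sum_ite_eq', Finset.mem_univ, if_true]
    have hswap : ∑ k, ((x k : ℂ) - (a k : ℂ)) * γ x k *
        fderiv ℝ φ x (EuclideanSpace.single i 1)
        = ∑ k, γ x k * (((x k : ℂ) - (a k : ℂ)) * fderiv ℝ φ x (EuclideanSpace.single i 1)) :=
      Finset.sum_congr rfl fun k _ => by ring
    simp only [hγ] at hswap ⊢
    rw [hswap]
    ring
  · exact hγi i _ (by fun_prop) fun x hx => by simp [hφ0 x hx, hdφ0 x hx]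
  · simp_rw [Finset.sum_mul]
    refine integrable_finsetSum _ fun j _ => ?_
    have := hγi j (fun x => ((x j - a j : ℝ) : ℂ) * fderiv ℝ φ x (EuclideanSpace.single i 1))
      (by fun_prop) fun x hx => by simp [hdφ0 x hx]
    refine this.congr (.of_forall fun x => ?_)
    simp only
    ring

theorem exists_center_integrable_segment (hgm : ∀ j, Measurable (g · j))
    (hg : ∀ j, ∀ r < 1, IntegrableOn (g · j) (ball (0 : EuclideanSpace ℝ (Fin (n + 1))) r)) :
    ∃ a ∈ ball (0 : EuclideanSpace ℝ (Fin (n + 1))) 1, ∀ r < 1, ∀ j,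
      Integrable (fun p : ℝ × EuclideanSpace ℝ (Fin (n + 1)) => g (a + p.1 • (p.2 - a)) j)
        ((volume.restrict (Set.Ioc 0 1)).prod (volume.restrict (ball 0 r))) := by
  have hae : ∀ᵐ a : EuclideanSpace ℝ (Fin (n + 1)), ∀ (k : ℕ) (j : Fin (n + 1)),
      a ∈ ball (0 : EuclideanSpace ℝ (Fin (n + 1))) (1 - 1 / ((k : ℝ) + 2)) →
      ∫⁻ t in Set.Ioc (0 : ℝ) 1, ∫⁻ x in ball (0 : EuclideanSpace ℝ (Fin (n + 1)))
        (1 - 1 / ((k : ℝ) + 2)), ‖g (a + t • (x - a)) j‖ₑ < ⊤ := by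
    rw [ae_all_iff]
    intro k
    rw [ae_all_iff]
    intro j
    refine ae_lintegral_segment_lt_top volume (f := fun y => ‖g y j‖ₑ) (hgm j).enorm _ ?_
    exact (hg j _ (by simp only [sub_lt_self_iff]; positivity)).2
  have hpos : volume (ball (0 : EuclideanSpace ℝ (Fin (n + 1))) (1 / 2)) ≠ 0 :=
    (measure_ball_pos volume _ (by norm_num)).ne'
  obtain ⟨a, ha, haP⟩ := (frequently_ae_mem_iff.mpr hpos).and_eventually hae |>.exists
  refine ⟨a, ball_subset_ball (by norm_num) ha, fun r hr j => ?_⟩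
  obtain ⟨k, hk⟩ := exists_nat_one_div_lt (sub_pos.mpr hr)
  have hk2 : 1 / ((k : ℝ) + 2) ≤ 1 / ((k : ℝ) + 1) :=
    one_div_le_one_div_of_le (by positivity) (by linarith)
  have hk3 : 1 / ((k : ℝ) + 2) ≤ 1 / 2 :=
    one_div_le_one_div_of_le (by norm_num) (by linarith [(k.cast_nonneg : (0 : ℝ) ≤ k)])
  have h := integrable_comp_segment volume (hgm j) a _
    (haP k j (ball_subset_ball (by linarith) ha))
  exact h.mono_measure (Measure.prod_mono le_rfl
    (Measure.restrict_mono (ball_subset_ball (by linarith)) le_rfl))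

/-- **Poincaré lemma** on the unit ball for locally integrable fields. -/
theorem exists_potential_of_curl_eq_zero (hgm : ∀ j, Measurable (g · j))
    (hg : ∀ j, ∀ r < 1, IntegrableOn (g · j) (ball (0 : EuclideanSpace ℝ (Fin (n + 1))) r))
    (hcurl : ∀ φ : EuclideanSpace ℝ (Fin (n + 1)) → ℂ,
      ContDiff ℝ (⊤ : ℕ∞) φ → HasCompactSupport φ →
      tsupport φ ⊆ ball (0 : EuclideanSpace ℝ (Fin (n + 1))) 1 → ∀ i j,
      ∫ x in ball (0 : EuclideanSpace ℝ (Fin (n + 1))) 1,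
        (g x i * fderiv ℝ φ x (EuclideanSpace.single j 1) -
          g x j * fderiv ℝ φ x (EuclideanSpace.single i 1)) = 0) :
    ∃ u : EuclideanSpace ℝ (Fin (n + 1)) → ℂ,
      (∀ r < 1, IntegrableOn u (ball (0 : EuclideanSpace ℝ (Fin (n + 1))) r)) ∧
      ∀ φ : EuclideanSpace ℝ (Fin (n + 1)) → ℂ,
        ContDiff ℝ (⊤ : ℕ∞) φ → HasCompactSupport φ →
        tsupport φ ⊆ ball (0 : EuclideanSpace ℝ (Fin (n + 1))) 1 → ∀ i,
        ∫ x in ball (0 : EuclideanSpace ℝ (Fin (n + 1))) 1,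
          u x * fderiv ℝ φ x (EuclideanSpace.single i 1) =
        -∫ x in ball (0 : EuclideanSpace ℝ (Fin (n + 1))) 1, g x i * φ x := by
  obtain ⟨a, ha, hseg⟩ := exists_center_integrable_segment hgm hg
  have hmul : ∀ r < 1, ∀ j, ∀ w : EuclideanSpace ℝ (Fin (n + 1)) → ℂ, Continuous w →
      Integrable (fun p : ℝ × EuclideanSpace ℝ (Fin (n + 1)) =>
        g (a + p.1 • (p.2 - a)) j * w p.2)
        ((volume.restrict (Set.Ioc 0 1)).prod (volume.restrict (ball 0 r))) := by
    intro r hr j w hw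
    obtain ⟨C, hC⟩ := (isCompact_closedBall (0 : EuclideanSpace ℝ (Fin (n + 1))) r
      ).exists_bound_of_continuousOn hw.continuousOn
    refine (hseg r hr j).mul_bdd (c := C) (hw.comp continuous_snd).aestronglyMeasurable ?_
    rw [Measure.prod_restrict]
    filter_upwards [ae_restrict_mem (measurableSet_Ioc.prod measurableSet_ball)] with p hp
    exact hC _ (ball_subset_closedBall hp.2)
  set S : ℝ → EuclideanSpace ℝ (Fin (n + 1)) → ℂ := fun t x =>
    ∑ j, ((x j - a j : ℝ) : ℂ) * g (a + t • (x - a)) j with hS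
  have hSint : ∀ r < 1, ∀ w : EuclideanSpace ℝ (Fin (n + 1)) → ℂ, Continuous w →
      Integrable (fun p : ℝ × EuclideanSpace ℝ (Fin (n + 1)) => S p.1 p.2 * w p.2)
        ((volume.restrict (Set.Ioc 0 1)).prod (volume.restrict (ball 0 r))) := by
    intro r hr w hw
    simp only [hS, Finset.sum_mul]
    refine integrable_finsetSum _ fun j _ => ?_
    refine (hmul r hr j (fun x => ((x j - a j : ℝ) : ℂ) * w x) (by fun_prop)).congr
      (.of_forall fun p => ?_)
    simp only
    ring
  refine ⟨fun x => ∫ t in Set.Ioc (0 : ℝ) 1, S t x, fun r hr => ?_, ?_⟩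
  · simpa [IntegrableOn] using (hSint r hr (fun _ => 1) continuous_const).integral_prod_right
  intro φ hφ hφc hφs i
  obtain ⟨r, hr, hφr⟩ := exists_lt_subset_ball (isClosed_tsupport φ) hφs
  have hφ0 : ∀ x ∉ ball (0 : EuclideanSpace ℝ (Fin (n + 1))) r, φ x = 0 := fun x hx =>
    image_eq_zero_of_notMem_tsupport fun h => hx (hφr h)
  have hdφ0 : ∀ x ∉ ball (0 : EuclideanSpace ℝ (Fin (n + 1))) r, fderiv ℝ φ x = 0 :=
    fun x hx => image_eq_zero_of_notMem_tsupport fun h => hx (hφr (tsupport_fderiv_subset ℝ h))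
  have hcd := hφ.continuous_fderiv (by simp)
  have hr1 : ball (0 : EuclideanSpace ℝ (Fin (n + 1))) r ⊆ ball 0 1 := ball_subset_ball hr.le
  set F : ℝ → ℂ := fun t => ∫ x in ball (0 : EuclideanSpace ℝ (Fin (n + 1))) r,
    S t x * fderiv ℝ φ x (EuclideanSpace.single i 1) with hF
  set P : ℝ → ℂ := fun t => ∫ x in ball (0 : EuclideanSpace ℝ (Fin (n + 1))) r,
    g (a + t • (x - a)) i * φ x with hP
  have hSφ := hSint r hr (fun x => fderiv ℝ φ x (EuclideanSpace.single i 1)) (by fun_prop)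
  have hFint : IntegrableOn F (Set.Ioc 0 1) := hSφ.integral_prod_left
  have hPint : IntegrableOn P (Set.Ioc 0 1) :=
    (hmul r hr i φ hφ.continuous).integral_prod_left
  have hPeq : ∀ t, ∫ x, g (a + t • (x - a)) i * φ x = P t := fun t =>
    (setIntegral_eq_integral_of_forall_compl_eq_zero fun x hx => by simp [hφ0 x hx]).symm
  have hFδ : ∀ δ ∈ Set.Ioc (0 : ℝ) 1, ∫ t in δ..1, F t = δ * P δ - P 1 := by
    intro δ hδ
    have h := integral_Ioc_segment_eq volume (n := n) (by simp) (hg i) hφ hφs ha hδ.1 hδ.2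
    have hP1 := hPeq 1
    simp only [one_smul, add_sub_cancel] at hP1
    rw [hPeq, hP1] at h
    rw [← h]
    refine intervalIntegral.integral_congr fun t ht => ?_
    rw [Set.uIcc_of_le hδ.2] at ht
    rw [← integral_segment_mul_fderiv_of_curl_eq_zero hg hcurl hφ hφc hφs ha
      (hδ.1.trans_le ht.1) ht.2 i]
    exact setIntegral_eq_integral_of_forall_compl_eq_zero fun x hx => by simp [hdφ0 x hx]
  have hlim : Filter.Tendsto (fun δ : ℝ => (δ : ℂ) * P δ) (nhdsWithin 0 (Set.Ioi 0))
      (nhds ((∫ t in Set.Ioc (0 : ℝ) 1, F t) + P 1)) := by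
    have hcont : ContinuousOn (fun δ => ∫ t in δ..1, F t) (Set.uIcc (0 : ℝ) 1) :=
      intervalIntegral.continuousOn_primitive_interval_left
        (by rwa [Set.uIcc_of_le zero_le_one, integrableOn_Icc_iff_integrableOn_Ioc])
    have h0 := ((hcont 0 Set.left_mem_uIcc).tendsto.mono_left
      (nhdsWithin_mono 0 (Set.Ioc_subset_Icc_self.trans Set.Icc_subset_uIcc))).add_const (P 1)
    rw [intervalIntegral.integral_of_le zero_le_one,
      nhdsWithin_Ioc_eq_nhdsGT zero_lt_one] at h0
    refine h0.congr' ?_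
    filter_upwards [Ioc_mem_nhdsGT zero_lt_one] with δ hδ
    rw [hFδ δ hδ]
    ring
  have hzero := eq_zero_of_tendsto_mul_of_integrableOn hPint hlim
  calc ∫ x in ball (0 : EuclideanSpace ℝ (Fin (n + 1))) 1,
          (∫ t in Set.Ioc (0 : ℝ) 1, S t x) * fderiv ℝ φ x (EuclideanSpace.single i 1)
      = ∫ x in ball (0 : EuclideanSpace ℝ (Fin (n + 1))) r, ∫ t in Set.Ioc (0 : ℝ) 1,
          S t x * fderiv ℝ φ x (EuclideanSpace.single i 1) := by
        simp_rw [integral_mul_const]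
        exact setIntegral_eq_of_subset_of_forall_sdiff_eq_zero measurableSet_ball hr1
          fun x hx => by simp [hdφ0 x hx.2]
    _ = ∫ t in Set.Ioc (0 : ℝ) 1, F t := (integral_integral_swap hSφ).symm
    _ = -P 1 := eq_neg_of_add_eq_zero_left hzero
    _ = -∫ x in ball (0 : EuclideanSpace ℝ (Fin (n + 1))) 1, g x i * φ x := by
        simp only [hP, one_smul, add_sub_cancel]
        rw [setIntegral_eq_of_subset_of_forall_sdiff_eq_zero measurableSet_ball hr1
          fun x hx => by simp [hφ0 x hx.2]]

end Poincare

theorem memLp_two_of_lintegral_sum_sq_lt_top {X : Type*} [MeasurableSpace X] {μ : Measure X}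
    {ι κ : Type*} [Fintype ι] [Fintype κ] {g : X → ι → κ → ℂ} (hgm : Measurable g)
    (hg : ∫⁻ x, (∑ α, ∑ i, ((‖g x α i‖₊ : ℝ≥0∞) ^ 2)) ∂μ < ⊤) (α : ι) (i : κ) :
    MemLp (fun x => g x α i) 2 μ := by
  have hm : Measurable fun x => g x α i := by fun_prop
  refine ⟨hm.aestronglyMeasurable, ?_⟩
  rw [eLpNorm_lt_top_iff_lintegral_rpow_enorm_lt_top (by simp) (by simp)]
  refine (lintegral_mono fun x => ?_).trans_lt hg
  calc ‖g x α i‖ₑ ^ (2 : ℝ≥0∞).toReal = (‖g x α i‖₊ : ℝ≥0∞) ^ 2 := by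
        simp [enorm_eq_nnnorm]
    _ ≤ ∑ i, (‖g x α i‖₊ : ℝ≥0∞) ^ 2 :=
        Finset.single_le_sum (f := fun i => (‖g x α i‖₊ : ℝ≥0∞) ^ 2)
          (fun _ _ => zero_le) (Finset.mem_univ i)
    _ ≤ ∑ α, ∑ i, (‖g x α i‖₊ : ℝ≥0∞) ^ 2 :=
        Finset.single_le_sum (f := fun α => ∑ i, (‖g x α i‖₊ : ℝ≥0∞) ^ 2)
          (fun _ _ => zero_le) (Finset.mem_univ α)

theorem memLp_conj_mulVec {X : Type*} [MeasurableSpace X] {μ : Measure X}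
    {ι : Type*} [Fintype ι] {A : X → Matrix ι ι ℂ} (hA : ∀ p q, Measurable fun x => A x p q)
    {M : ℝ} (hAM : ∀ᵐ x ∂μ, ∀ p q, ‖A x p q‖ ≤ M) {f : X → ι → ℂ} {s : ℝ≥0∞}
    (hf : ∀ q, MemLp (fun x => f x q) s μ) (p : ι) :
    MemLp (fun x => (starRingEnd ℂ) ((A x).mulVec (f x) p)) s μ := by
  refine MemLp.star ?_
  simp only [Matrix.mulVec, dotProduct]
  refine memLp_finsetSum _ fun q _ => ?_
  refine (hf q).of_le_mul (c := M)
    ((hA p q).aestronglyMeasurable.mul (hf q).aestronglyMeasurable) ?_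
  filter_upwards [hAM] with x hx
  rw [norm_mul]
  gcongr
  exact hx p q

/-- A vector-valued test field satisfies the divergence identity as soon as each of its
components does. -/
theorem setIntegral_sum_mul_fderiv_pi_eq_zero {n m : ℕ}
    {H : EuclideanSpace ℝ (Fin (n + 1)) → Fin m × Fin (n + 1) → ℂ}
    (hH : ∀ p, ∀ r < 1, IntegrableOn (H · p) (ball (0 : EuclideanSpace ℝ (Fin (n + 1))) r))
    (hψ : ∀ ψ : EuclideanSpace ℝ (Fin (n + 1)) → ℂ, ContDiff ℝ (⊤ : ℕ∞) ψ →
      HasCompactSupport ψ → tsupport ψ ⊆ ball (0 : EuclideanSpace ℝ (Fin (n + 1))) 1 → ∀ α,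
      ∫ x in ball (0 : EuclideanSpace ℝ (Fin (n + 1))) 1,
        ∑ i, H x (α, i) * fderiv ℝ ψ x (EuclideanSpace.single i 1) = 0)
    {φ : EuclideanSpace ℝ (Fin (n + 1)) → Fin m → ℂ} (hφ : ContDiff ℝ (⊤ : ℕ∞) φ)
    (hφc : HasCompactSupport φ)
    (hφs : tsupport φ ⊆ ball (0 : EuclideanSpace ℝ (Fin (n + 1))) 1) :
    ∫ x in ball (0 : EuclideanSpace ℝ (Fin (n + 1))) 1,
      ∑ p : Fin m × Fin (n + 1),
        H x p * fderiv ℝ φ x (EuclideanSpace.single p.2 1) p.1 = 0 := by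
  have hφα : ∀ α, ContDiff ℝ (⊤ : ℕ∞) fun x => φ x α := fun α => contDiff_pi.mp hφ α
  have hsub : ∀ α, tsupport (fun x => φ x α) ⊆ tsupport φ := fun α =>
    closure_mono fun x hx h => hx (by simp [h])
  have hfd : ∀ x v α, fderiv ℝ φ x v α = fderiv ℝ (fun x => φ x α) x v := by
    intro x v α
    rw [fderiv_pi fun α => (hφα α).differentiable (by simp) x]
    rfl
  simp only [hfd, Fintype.sum_prod_type]
  rw [integral_finsetSum]
  · exact Finset.sum_eq_zero fun α _ => hψ _ (hφα α)
      (hφc.of_isClosed_subset (isClosed_tsupport _) (hsub α)) ((hsub α).trans hφs) α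
  · intro α _
    refine integrable_finsetSum _ fun i _ => Integrable.integrableOn ?_
    exact integrable_mul_of_tsupport_subset_ball volume
      (w := fun x => fderiv ℝ (fun x => φ x α) x (EuclideanSpace.single i 1)) (hH (α, i))
      (((hφα α).continuous_fderiv (by simp)).clm_apply continuous_const)
      ((tsupport_fderiv_apply_subset ℝ _).trans ((hsub α).trans hφs))

/-- **Existence of a potential for curl-free, divergence-controlled fields with a point
singularity.** If `g ∈ L²_loc(B; ℂ^{(1+n)m})` satisfies `div (A g) = 0` and `curl g = 0`
distributionally on `B \ {0}`, then there exists a locally integrable `u` on `B` whose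
distributional gradient is `g` on all of `B`, and `u` is a weak solution of
`div (A ∇u) = 0` in `B`. -/
theorem potential_for_curl_free_field
    (n m : ℕ) (hn : 1 ≤ n) (hm : 1 ≤ m)
    (A : EuclideanSpace ℝ (Fin (n + 1)) →
      Matrix (Fin m × Fin (n + 1)) (Fin m × Fin (n + 1)) ℂ)
    (hAmeas : ∀ p q, Measurable (fun x => A x p q))
    (M : ℝ)
    (hAbound : ∀ᵐ x ∂(volume : Measure (EuclideanSpace ℝ (Fin (n + 1)))),
      ∀ p q, ‖A x p q‖ ≤ M)
    (g : EuclideanSpace ℝ (Fin (n + 1)) → Fin m → Fin (n + 1) → ℂ)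
    (hgmeas : Measurable g)
    (hgloc : ∀ K : Set (EuclideanSpace ℝ (Fin (n + 1))), IsCompact K →
      K ⊆ ball (0 : EuclideanSpace ℝ (Fin (n + 1))) 1 →
      (∫⁻ x in K, (∑ α, ∑ i, ((‖g x α i‖₊ : ℝ≥0∞) ^ 2))) < ⊤)
    -- (a) div (A g) = 0 distributionally on B \ {0}
    (hdiv : ∀ φ : EuclideanSpace ℝ (Fin (n + 1)) → Fin m → ℂ,
      ContDiff ℝ (⊤ : ℕ∞) φ → HasCompactSupport φ →
      tsupport φ ⊆ ball (0 : EuclideanSpace ℝ (Fin (n + 1))) 1 \ {0} →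
      (∫ x in ball (0 : EuclideanSpace ℝ (Fin (n + 1))) 1,
        ∑ p : Fin m × Fin (n + 1),
          (starRingEnd ℂ) ((A x).mulVec (fun q => g x q.1 q.2) p) *
            fderiv ℝ φ x (EuclideanSpace.single p.2 1) p.1) = 0)
    -- (b) curl g = 0 distributionally on B \ {0}
    (hcurl : ∀ φ : EuclideanSpace ℝ (Fin (n + 1)) → ℂ,
      ContDiff ℝ (⊤ : ℕ∞) φ → HasCompactSupport φ →
      tsupport φ ⊆ ball (0 : EuclideanSpace ℝ (Fin (n + 1))) 1 \ {0} →
      ∀ (i j : Fin (n + 1)) (α : Fin m),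
      (∫ x in ball (0 : EuclideanSpace ℝ (Fin (n + 1))) 1,
        (g x α i * fderiv ℝ φ x (EuclideanSpace.single j 1) -
          g x α j * fderiv ℝ φ x (EuclideanSpace.single i 1))) = 0) :
    ∃ u : EuclideanSpace ℝ (Fin (n + 1)) → Fin m → ℂ,
      LocallyIntegrableOn u (ball (0 : EuclideanSpace ℝ (Fin (n + 1))) 1) volume ∧
      -- distributional gradient of u equals g on all of B
      (∀ φ : EuclideanSpace ℝ (Fin (n + 1)) → ℂ,
        ContDiff ℝ (⊤ : ℕ∞) φ → HasCompactSupport φ →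
        tsupport φ ⊆ ball (0 : EuclideanSpace ℝ (Fin (n + 1))) 1 →
        ∀ (i : Fin (n + 1)) (α : Fin m),
        (∫ x in ball (0 : EuclideanSpace ℝ (Fin (n + 1))) 1,
          u x α * fderiv ℝ φ x (EuclideanSpace.single i 1)) =
        -(∫ x in ball (0 : EuclideanSpace ℝ (Fin (n + 1))) 1, g x α i * φ x)) ∧
      -- u is a weak solution of div (A ∇u) = 0 in B
      (∀ φ : EuclideanSpace ℝ (Fin (n + 1)) → Fin m → ℂ,
        ContDiff ℝ (⊤ : ℕ∞) φ → HasCompactSupport φ →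
        tsupport φ ⊆ ball (0 : EuclideanSpace ℝ (Fin (n + 1))) 1 →
        (∫ x in ball (0 : EuclideanSpace ℝ (Fin (n + 1))) 1,
          ∑ p : Fin m × Fin (n + 1),
            (starRingEnd ℂ) ((A x).mulVec (fun q => g x q.1 q.2) p) *
              fderiv ℝ φ x (EuclideanSpace.single p.2 1) p.1) = 0) := by
  have hd : 2 ≤ Module.finrank ℝ (EuclideanSpace ℝ (Fin (n + 1))) := by simp; omega
  have hg2 : ∀ r < 1, ∀ α i,
      MemLp (fun x => g x α i) 2 (volume.restrict (ball (0 : EuclideanSpace ℝ (Fin (n + 1))) r)) :=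
    fun r hr => memLp_two_of_lintegral_sum_sq_lt_top hgmeas
      ((lintegral_mono_set ball_subset_closedBall).trans_lt
        (hgloc _ (isCompact_closedBall 0 r) (closedBall_subset_ball hr)))
  have hgint : ∀ α i, ∀ r < 1,
      IntegrableOn (fun x => g x α i) (ball (0 : EuclideanSpace ℝ (Fin (n + 1))) r) := by
    intro α i r hr
    have : IsFiniteMeasure (volume.restrict (ball (0 : EuclideanSpace ℝ (Fin (n + 1))) r)) :=
      isFiniteMeasure_restrict.mpr measure_ball_lt_top.ne
    exact (hg2 r hr α i).integrable (by norm_num)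
  have hAg : ∀ r < 1, ∀ p : Fin m × Fin (n + 1),
      MemLp (fun x => (starRingEnd ℂ) ((A x).mulVec (fun q => g x q.1 q.2) p)) 2
        (volume.restrict (ball (0 : EuclideanSpace ℝ (Fin (n + 1))) r)) := fun r hr p =>
    memLp_conj_mulVec hAmeas (ae_restrict_of_ae hAbound) (fun q => hg2 r hr q.1 q.2) p
  have hAgint : ∀ p : Fin m × Fin (n + 1), ∀ r < 1,
      IntegrableOn (fun x => (starRingEnd ℂ) ((A x).mulVec (fun q => g x q.1 q.2) p))
        (ball (0 : EuclideanSpace ℝ (Fin (n + 1))) r) := by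
    intro p r hr
    have : IsFiniteMeasure (volume.restrict (ball (0 : EuclideanSpace ℝ (Fin (n + 1))) r)) :=
      isFiniteMeasure_restrict.mpr measure_ball_lt_top.ne
    exact (hAg r hr p).integrable (by norm_num)
  have hcurl' : ∀ (α : Fin m) (φ : EuclideanSpace ℝ (Fin (n + 1)) → ℂ),
      ContDiff ℝ (⊤ : ℕ∞) φ → HasCompactSupport φ →
      tsupport φ ⊆ ball (0 : EuclideanSpace ℝ (Fin (n + 1))) 1 → ∀ i j,
      ∫ x in ball (0 : EuclideanSpace ℝ (Fin (n + 1))) 1,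
        (g x α i * fderiv ℝ φ x (EuclideanSpace.single j 1) -
          g x α j * fderiv ℝ φ x (EuclideanSpace.single i 1)) = 0 := by
    intro α φ hφ hφc hφs i j
    have h := integral_mul_fderiv_eq_zero_of_punctured volume hd
      (F := fun x => ![g x α i, -g x α j])
      ![EuclideanSpace.single j (1 : ℝ), EuclideanSpace.single i (1 : ℝ)]
      (fun r hr k => by
        fin_cases k
        · exact hg2 r hr α i
        · exact (hg2 r hr α j).neg)
      (fun ψ hψ hψc hψs => by
        simpa [Fin.sum_univ_two, sub_eq_add_neg] using hcurl ψ hψ hψc hψs i j α) hφ hφc hφs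
    simpa [Fin.sum_univ_two, sub_eq_add_neg] using h
  have hdiv' : ∀ ψ : EuclideanSpace ℝ (Fin (n + 1)) → ℂ, ContDiff ℝ (⊤ : ℕ∞) ψ →
      HasCompactSupport ψ → tsupport ψ ⊆ ball (0 : EuclideanSpace ℝ (Fin (n + 1))) 1 →
      ∀ α : Fin m, ∫ x in ball (0 : EuclideanSpace ℝ (Fin (n + 1))) 1,
        ∑ i, (starRingEnd ℂ) ((A x).mulVec (fun q => g x q.1 q.2) (α, i)) *
          fderiv ℝ ψ x (EuclideanSpace.single i 1) = 0 := by
    intro ψ hψ hψc hψs α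
    refine integral_mul_fderiv_eq_zero_of_punctured volume hd
      (F := fun x i => (starRingEnd ℂ) ((A x).mulVec (fun q => g x q.1 q.2) (α, i)))
      (fun i => EuclideanSpace.single i (1 : ℝ)) (fun r hr i => hAg r hr (α, i))
      (fun χ hχ hχc hχs => ?_) hψ hψc hψs
    have hsub : tsupport (fun x => (Pi.single α (χ x) : Fin m → ℂ)) ⊆ tsupport χ :=
      closure_mono fun x hx h => hx (by simp [h])
    have hfd : ∀ x v, fderiv ℝ (fun x => (Pi.single α (χ x) : Fin m → ℂ)) x v
        = Pi.single α (fderiv ℝ χ x v) := fun x v => by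
      have h := ((ContinuousLinearMap.single ℝ (fun _ : Fin m => ℂ) α).hasFDerivAt.comp x
        (hχ.differentiable (by simp) x).hasFDerivAt).fderiv
      exact DFunLike.congr_fun h v
    have h := hdiv (fun x => Pi.single α (χ x))
      ((ContinuousLinearMap.single ℝ (fun _ : Fin m => ℂ) α).contDiff.comp hχ)
      (hχc.of_isClosed_subset (isClosed_tsupport _) hsub) (hsub.trans hχs)
    simp only [hfd, Fintype.sum_prod_type] at h
    rw [← h]
    congr 1 with x
    rw [Finset.sum_eq_single α (fun β _ hβ => by simp [hβ]) (by simp)]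
    simp
  choose u hu hugrad using fun α => exists_potential_of_curl_eq_zero
    (g := fun x i => g x α i) (fun j => by fun_prop) (hgint α) (hcurl' α)
  refine ⟨fun x α => u α x, fun x hx => ?_, fun φ hφ hφc hφs i α => hugrad α φ hφ hφc hφs i,
    fun φ hφ hφc hφs => setIntegral_sum_mul_fderiv_pi_eq_zero hAgint hdiv' hφ hφc hφs⟩
  obtain ⟨r, hxr, hr⟩ := exists_between (mem_ball_zero_iff.mp hx)
  exact ⟨ball 0 r, mem_nhdsWithin_of_mem_nhds (isOpen_ball.mem_nhds (by simpa using hxr)),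
    Integrable.of_eval fun α => hu α r hr⟩
end

section
/- Let n ≥ 1, N ≥ 1 and let f : (0,∞)×Sⁿ → ℂ^N be measurable and locally square integrable. Then there exist constants C, C', C'' < ∞, depending only on n, c₀, c₁, such that sup_{0<t<1/2} (1/t) ∫_t^{2t} ‖f_s‖₂² ds ≤ C ∫_{Sⁿ} Ñ*(f)(x)² dσ(x) ≤ C' ∫_0^1 ‖f_s‖₂² ds/s, and consequently ∫_0^∞ ‖f_t‖₂² dt ≤ C'' ( ∫_{Sⁿ} Ñ*(f)(x)² dσ(x) + ∫_1^∞ ‖f_t‖₂² dt ). -/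
open MeasureTheory Metric
open scoped ENNReal NNReal

/-- The surface measure on the unit sphere `Sⁿ ⊂ ℝ^{1+n}`. -/
noncomputable def sphereMeasure (n : ℕ) :
    Measure (sphere (0 : EuclideanSpace ℝ (Fin (n + 1))) 1) :=
  (volume : Measure (EuclideanSpace ℝ (Fin (n + 1)))).toSphere

/-- The product measure `ds dσ(y)` on `ℝ × Sⁿ`. -/
noncomputable def stripMeasure (n : ℕ) :
    Measure (ℝ × sphere (0 : EuclideanSpace ℝ (Fin (n + 1))) 1) :=
  (volume : Measure ℝ).prod (sphereMeasure n)

/-- `‖f_s‖₂²`, the squared `L²(Sⁿ)` norm of the slice `f_s = f(s, ·)`. -/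
noncomputable def sliceNormSq (n N : ℕ)
    (f : ℝ × sphere (0 : EuclideanSpace ℝ (Fin (n + 1))) 1 → Fin N → ℂ) (s : ℝ) : ℝ≥0∞ :=
  ∫⁻ x, (∑ j, ((‖f (s, x) j‖₊ : ℝ≥0∞) ^ 2)) ∂(sphereMeasure n)

/-- The Whitney region `W(t,x) = {(s,y) : |y − x| < c₁ t, c₀⁻¹ < s/t < c₀}`. -/
def whitneyRegion (n : ℕ) (c₀ c₁ : ℝ)
    (t : ℝ) (x : sphere (0 : EuclideanSpace ℝ (Fin (n + 1))) 1) :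
    Set (ℝ × sphere (0 : EuclideanSpace ℝ (Fin (n + 1))) 1) :=
  {z | dist (z.2 : EuclideanSpace ℝ (Fin (n + 1))) (x : EuclideanSpace ℝ (Fin (n + 1)))
        < c₁ * t ∧ c₀⁻¹ < z.1 / t ∧ z.1 / t < c₀}

/-- The modified non-tangential maximal function
`Ñ*(f)(x) = sup_{0<t<c₀} t^{−(1+n)/2} (∬_{W(t,x)} |f(s,y)|² χ_{s<1} ds dσ(y))^{1/2}`. -/
noncomputable def ntMaximal (n N : ℕ) (c₀ c₁ : ℝ)
    (f : ℝ × sphere (0 : EuclideanSpace ℝ (Fin (n + 1))) 1 → Fin N → ℂ)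
    (x : sphere (0 : EuclideanSpace ℝ (Fin (n + 1))) 1) : ℝ≥0∞ :=
  ⨆ t ∈ Set.Ioo (0 : ℝ) c₀,
    ENNReal.ofReal t ^ (-(1 + (n : ℝ)) / 2) *
      (∫⁻ z in whitneyRegion n c₀ c₁ t x ∩ {z | z.1 < 1},
        (∑ j, ((‖f z j‖₊ : ℝ≥0∞) ^ 2)) ∂(stripMeasure n)) ^ ((1 : ℝ) / 2)

open scoped Pointwise

instance (n : ℕ) : IsFiniteMeasure (sphereMeasure n) := by
  unfold sphereMeasure
  infer_instance

instance (n : ℕ) : SFinite (stripMeasure n) := by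
  unfold stripMeasure
  infer_instance

/-- The cone of height one over the spherical ball `ball y r`. -/
def sphereSector (n : ℕ) (y : sphere (0 : EuclideanSpace ℝ (Fin (n + 1))) 1) (r : ℝ) :
    Set (EuclideanSpace ℝ (Fin (n + 1))) :=
  Set.Ioo (0 : ℝ) 1 • ((↑) '' ball y r)

theorem mem_sphereSector {n : ℕ} {y : sphere (0 : EuclideanSpace ℝ (Fin (n + 1))) 1} {r : ℝ}
    {z : EuclideanSpace ℝ (Fin (n + 1))} :
    z ∈ sphereSector n y r ↔ ∃ s ∈ Set.Ioo (0 : ℝ) 1, ∃ u : EuclideanSpace ℝ (Fin (n + 1)),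
      ‖u‖ = 1 ∧ dist u y < r ∧ s • u = z := by
  simp only [sphereSector, Set.mem_smul, Set.mem_image, mem_ball, Subtype.exists,
    Subtype.dist_eq, mem_sphere_zero_iff_norm]
  constructor
  · rintro ⟨s, hs, _, ⟨u, hu, hd, rfl⟩, rfl⟩
    exact ⟨s, hs, u, hu, hd, rfl⟩
  · rintro ⟨s, hs, u, hu, hd, rfl⟩
    exact ⟨s, hs, u, ⟨u, hu, hd, rfl⟩, rfl⟩

theorem norm_lt_one_of_mem_sphereSector {n : ℕ}
    {y : sphere (0 : EuclideanSpace ℝ (Fin (n + 1))) 1} {r : ℝ}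
    {z : EuclideanSpace ℝ (Fin (n + 1))} (hz : z ∈ sphereSector n y r) : ‖z‖ < 1 := by
  obtain ⟨s, hs, u, hu, -, rfl⟩ := mem_sphereSector.1 hz
  simpa [norm_smul, hu, abs_of_pos hs.1] using hs.2

theorem volume_sphereSector_ne_top (n : ℕ) (y : sphere (0 : EuclideanSpace ℝ (Fin (n + 1))) 1)
    (r : ℝ) : volume (sphereSector n y r) ≠ ⊤ :=
  ((measure_mono fun _ hz => mem_ball_zero_iff.2 (norm_lt_one_of_mem_sphereSector hz)).trans_lt
    (measure_ball_lt_top (x := (0 : EuclideanSpace ℝ (Fin (n + 1)))) (r := 1))).ne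

theorem sphereMeasure_ball (n : ℕ) (y : sphere (0 : EuclideanSpace ℝ (Fin (n + 1))) 1) (r : ℝ) :
    sphereMeasure n (ball y r) =
      ENNReal.ofReal ((n + 1) * volume.real (sphereSector n y r)) := by
  rw [sphereMeasure, Measure.toSphere_apply' _ measurableSet_ball, finrank_euclideanSpace_fin,
    ENNReal.ofReal_mul (by positivity), measureReal_def,
    ENNReal.ofReal_toReal (volume_sphereSector_ne_top n y r), sphereSector]
  congr 1
  rw [← Nat.cast_add_one, ENNReal.ofReal_natCast]

theorem volumeReal_smul_sphereSector (n : ℕ)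
    (y : sphere (0 : EuclideanSpace ℝ (Fin (n + 1))) 1) (r : ℝ) {l : ℝ} (hl : 0 ≤ l) :
    volume.real (l • sphereSector n y r) = l ^ (n + 1) * volume.real (sphereSector n y r) := by
  rw [measureReal_def, Measure.addHaar_smul_of_nonneg _ hl, finrank_euclideanSpace_fin,
    ENNReal.toReal_mul, ENNReal.toReal_ofReal (by positivity), measureReal_def]

theorem volumeReal_ball (n : ℕ) (x : EuclideanSpace ℝ (Fin (n + 1))) {r : ℝ} (hr : 0 ≤ r) :
    volume.real (ball x r) =
      r ^ (n + 1) * volume.real (ball (0 : EuclideanSpace ℝ (Fin (n + 1))) 1) := by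
  rw [measureReal_def, Measure.addHaar_ball _ _ hr, finrank_euclideanSpace_fin,
    ENNReal.toReal_mul, ENNReal.toReal_ofReal (by positivity), measureReal_def]

theorem sphereSector_subset {n : ℕ} {y : sphere (0 : EuclideanSpace ℝ (Fin (n + 1))) 1} {r : ℝ}
    (hr : r < 1) :
    sphereSector n y r ⊆
      (1 - r) • sphereSector n y r ∪ ball (y : EuclideanSpace ℝ (Fin (n + 1))) (2 * r) := by
  intro z hz
  obtain ⟨s, hs, u, hu, hd, rfl⟩ := mem_sphereSector.1 hz
  rcases lt_or_ge s (1 - r) with h | h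
  · left
    have h0 : 0 < 1 - r := by linarith
    refine ⟨(s / (1 - r)) • u, mem_sphereSector.2
      ⟨_, ⟨div_pos hs.1 h0, (div_lt_one h0).2 h⟩, u, hu, hd, rfl⟩, ?_⟩
    simp only [smul_smul]
    rw [mul_div_cancel₀ _ h0.ne']
  · right
    have h1 : dist (s • u) u = 1 - s := by
      rw [dist_comm, dist_eq_norm, show u - s • u = (1 - s) • u by rw [sub_smul, one_smul],
        norm_smul, hu, mul_one, Real.norm_of_nonneg (by linarith [hs.2])]
    have h2 := dist_triangle (s • u) u y
    rw [mem_ball]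
    linarith

theorem ball_subset_sphereSector {n : ℕ} {y : sphere (0 : EuclideanSpace ℝ (Fin (n + 1))) 1}
    {r : ℝ} (hr : r ≤ 1 / 2) :
    ball ((1 - r) • (y : EuclideanSpace ℝ (Fin (n + 1)))) r ⊆ sphereSector n y (4 * r) := by
  intro z hz
  have hy : ‖(y : EuclideanSpace ℝ (Fin (n + 1)))‖ = 1 := by simp
  rw [mem_ball] at hz
  have hr0 : 0 < r := dist_nonneg.trans_lt hz
  have hn1 : ‖(1 - r) • (y : EuclideanSpace ℝ (Fin (n + 1)))‖ = 1 - r := by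
    rw [norm_smul, hy, mul_one, Real.norm_of_nonneg (by linarith)]
  rw [dist_eq_norm] at hz
  have hlt := norm_sub_norm_le z ((1 - r) • (y : EuclideanSpace ℝ (Fin (n + 1))))
  have hgt := norm_sub_norm_le ((1 - r) • (y : EuclideanSpace ℝ (Fin (n + 1)))) z
  rw [norm_sub_rev] at hgt
  have hz0 : 0 < ‖z‖ := by linarith
  have hz1 : ‖z‖ < 1 := by linarith
  refine mem_sphereSector.2 ⟨‖z‖, ⟨hz0, hz1⟩, ‖z‖⁻¹ • z, ?_, ?_, ?_⟩
  · rw [norm_smul, norm_inv, norm_norm, inv_mul_cancel₀ hz0.ne']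
  · have h1 : dist (‖z‖⁻¹ • z) z = 1 - ‖z‖ := by
      rw [dist_eq_norm, show ‖z‖⁻¹ • z - z = (‖z‖⁻¹ - 1) • z by rw [sub_smul, one_smul],
        norm_smul, Real.norm_of_nonneg (by linarith [(one_lt_inv₀ hz0).2 hz1]), sub_mul,
        inv_mul_cancel₀ hz0.ne', one_mul]
    have h2 : dist z y < 2 * r := by
      have h3 : dist ((1 - r) • (y : EuclideanSpace ℝ (Fin (n + 1)))) y = r := by
        rw [dist_comm, dist_eq_norm,
          show (y : EuclideanSpace ℝ (Fin (n + 1))) - (1 - r) • (y : EuclideanSpace ℝ (Fin (n + 1)))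
            = r • (y : EuclideanSpace ℝ (Fin (n + 1))) by module,
          norm_smul, hy, mul_one, Real.norm_of_nonneg hr0.le]
      have h4 := dist_triangle z ((1 - r) • (y : EuclideanSpace ℝ (Fin (n + 1)))) y
      rw [dist_eq_norm z ((1 - r) • (y : EuclideanSpace ℝ (Fin (n + 1))))] at h4
      linarith
    have := dist_triangle (‖z‖⁻¹ • z) z y
    linarith
  · rw [smul_smul, mul_inv_cancel₀ hz0.ne', one_smul]

theorem volumeReal_sphereSector_le {n : ℕ}
    (y : sphere (0 : EuclideanSpace ℝ (Fin (n + 1))) 1) {r : ℝ} (hr0 : 0 < r) (hr : r < 1) :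
    volume.real (sphereSector n y r) ≤
      2 ^ (n + 1) * volume.real (ball (0 : EuclideanSpace ℝ (Fin (n + 1))) 1) * r ^ n := by
  have hfin : volume ((1 - r) • sphereSector n y r) ≠ ⊤ := by
    rw [Measure.addHaar_smul]
    exact ENNReal.mul_ne_top ENNReal.ofReal_ne_top (volume_sphereSector_ne_top n y r)
  have h := (measureReal_mono (sphereSector_subset (y := y) hr)
    (measure_union_ne_top hfin measure_ball_lt_top.ne)).trans (measureReal_union_le _ _)
  rw [volumeReal_smul_sphereSector _ _ _ (by linarith), volumeReal_ball _ _ (by linarith)] at h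
  have hV : 0 ≤ volume.real (sphereSector n y r) := measureReal_nonneg
  have hp : (1 - r) ^ (n + 1) ≤ 1 - r :=
    pow_le_of_le_one (by linarith) (by linarith) n.succ_ne_zero
  have h2 : r * volume.real (sphereSector n y r) ≤ r *
      (2 ^ (n + 1) * volume.real (ball (0 : EuclideanSpace ℝ (Fin (n + 1))) 1) * r ^ n) := by
    rw [mul_pow, pow_succ r] at h
    nlinarith [mul_le_mul_of_nonneg_right hp hV]
  exact le_of_mul_le_mul_left h2 hr0

theorem le_volumeReal_sphereSector {n : ℕ}
    (y : sphere (0 : EuclideanSpace ℝ (Fin (n + 1))) 1) {r : ℝ} (hr0 : 0 < r) (hr : r < 1 / 2) :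
    volume.real (ball (0 : EuclideanSpace ℝ (Fin (n + 1))) 1) * r ^ n ≤
      2 * (n + 1) * volume.real (sphereSector n y (4 * r)) := by
  have hsub : (1 - 2 * r) • sphereSector n y (4 * r) ∪
      ball ((1 - r) • (y : EuclideanSpace ℝ (Fin (n + 1)))) r ⊆ sphereSector n y (4 * r) := by
    refine Set.union_subset ?_ (ball_subset_sphereSector hr.le)
    rintro _ ⟨w, hw, rfl⟩
    obtain ⟨s, hs, u, hu, hd, rfl⟩ := mem_sphereSector.1 hw
    have hl : 0 < 1 - 2 * r := by linarith
    exact mem_sphereSector.2 ⟨(1 - 2 * r) * s, ⟨mul_pos hl hs.1, by nlinarith [hs.1, hs.2]⟩,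
      u, hu, hd, (smul_smul _ _ _).symm⟩
  have hdisj : Disjoint ((1 - 2 * r) • sphereSector n y (4 * r))
      (ball ((1 - r) • (y : EuclideanSpace ℝ (Fin (n + 1)))) r) := by
    rw [Set.disjoint_left]
    rintro _ ⟨w, hw, rfl⟩ hb
    have h1 := norm_lt_one_of_mem_sphereSector hw
    have hgt := norm_sub_norm_le ((1 - r) • (y : EuclideanSpace ℝ (Fin (n + 1))))
      ((1 - 2 * r) • w)
    simp only [mem_ball, dist_eq_norm] at hb
    rw [norm_sub_rev] at hb
    rw [norm_smul, norm_smul, Real.norm_of_nonneg (by linarith), Real.norm_of_nonneg (by linarith),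
      norm_eq_of_mem_sphere] at hgt
    nlinarith [mul_nonneg (show 0 ≤ 1 - 2 * r by linarith) (show 0 ≤ 1 - ‖w‖ by linarith)]
  have h := measureReal_mono hsub (volume_sphereSector_ne_top n y (4 * r))
  rw [measureReal_union hdisj measurableSet_ball
    (by
      rw [Measure.addHaar_smul]
      exact ENNReal.mul_ne_top ENNReal.ofReal_ne_top (volume_sphereSector_ne_top n y _))
    measure_ball_lt_top.ne,
    volumeReal_smul_sphereSector _ _ _ (by linarith), volumeReal_ball _ _ hr0.le] at h
  have hV : 0 ≤ volume.real (sphereSector n y (4 * r)) := measureReal_nonneg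
  have hp := one_add_mul_le_pow (a := -(2 * r)) (by linarith) (n + 1)
  push_cast at hp
  rw [← sub_eq_add_neg] at hp
  refine le_of_mul_le_mul_left (a := r) ?_ hr0
  rw [pow_succ r] at h
  nlinarith [mul_le_mul_of_nonneg_right hp hV]

/-- Spherical balls of radius `r` have surface measure at most `b rⁿ`. -/
theorem sphereMeasure_ball_le (n : ℕ) :
    ∃ b : ℝ≥0∞, b < ⊤ ∧ ∀ (y : sphere (0 : EuclideanSpace ℝ (Fin (n + 1))) 1) (r : ℝ), 0 < r →
      sphereMeasure n (ball y r) ≤ b * ENNReal.ofReal r ^ n := by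
  refine ⟨max (sphereMeasure n Set.univ) (ENNReal.ofReal ((n + 1) *
    (2 ^ (n + 1) * volume.real (ball (0 : EuclideanSpace ℝ (Fin (n + 1))) 1)))),
    max_lt (measure_lt_top _ _) ENNReal.ofReal_lt_top, fun y r hr => ?_⟩
  rcases lt_or_ge r 1 with h | h
  · refine le_trans ?_ (mul_le_mul_left (le_max_right _ _) _)
    rw [sphereMeasure_ball, ← ENNReal.ofReal_pow hr.le, ← ENNReal.ofReal_mul (by positivity)]
    refine ENNReal.ofReal_le_ofReal ?_
    rw [mul_assoc]
    exact mul_le_mul_of_nonneg_left (volumeReal_sphereSector_le y hr h) (by positivity)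
  · calc sphereMeasure n (ball y r) ≤ sphereMeasure n Set.univ * 1 := by
          rw [mul_one]
          exact measure_mono (Set.subset_univ _)
      _ ≤ _ := mul_le_mul' (le_max_left _ _)
          (one_le_pow₀ (by rwa [ENNReal.one_le_ofReal]))

/-- Spherical balls of radius `r ≤ 1` have surface measure at least `a rⁿ`. -/
theorem le_sphereMeasure_ball (n : ℕ) :
    ∃ a : ℝ≥0∞, a ≠ 0 ∧ a ≠ ⊤ ∧
      ∀ (y : sphere (0 : EuclideanSpace ℝ (Fin (n + 1))) 1) (r : ℝ), 0 < r → r ≤ 1 →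
        a * ENNReal.ofReal r ^ n ≤ sphereMeasure n (ball y r) := by
  have hv : 0 < volume.real (ball (0 : EuclideanSpace ℝ (Fin (n + 1))) 1) :=
    ENNReal.toReal_pos (measure_ball_pos _ _ one_pos).ne' measure_ball_lt_top.ne
  refine ⟨ENNReal.ofReal (volume.real (ball (0 : EuclideanSpace ℝ (Fin (n + 1))) 1)
    / (2 * 4 ^ n)), ?_, ENNReal.ofReal_ne_top, fun y r hr h1 => ?_⟩
  · rw [Ne, ENNReal.ofReal_eq_zero, not_le]
    positivity
  · rw [sphereMeasure_ball, ← ENNReal.ofReal_pow hr.le, ← ENNReal.ofReal_mul (by positivity)]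
    refine ENNReal.ofReal_le_ofReal ?_
    have h := le_volumeReal_sphereSector y (r := r / 4) (by linarith) (by linarith)
    rw [mul_div_cancel₀ r (by norm_num), div_pow] at h
    have e : volume.real (ball (0 : EuclideanSpace ℝ (Fin (n + 1))) 1) / (2 * 4 ^ n) * r ^ n
      = 1 / 2 * (volume.real (ball (0 : EuclideanSpace ℝ (Fin (n + 1))) 1)
        * (r ^ n / 4 ^ n)) := by
      field_simp
    rw [e]
    linarith

theorem lintegral_setLIntegral_section {X Z : Type*} [MeasurableSpace X] [MeasurableSpace Z]
    (σ : Measure X) (μ : Measure Z) [SFinite σ] [SFinite μ] {A : Set (X × Z)}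
    (hA : MeasurableSet A) {G : Z → ℝ≥0∞} (hG : Measurable G) :
    ∫⁻ x, ∫⁻ z in {z | (x, z) ∈ A}, G z ∂μ ∂σ = ∫⁻ z, G z * σ {x | (x, z) ∈ A} ∂μ := by
  have h1 : ∀ x, ∫⁻ z in {z | (x, z) ∈ A}, G z ∂μ
      = ∫⁻ z, A.indicator (fun p => G p.2) (x, z) ∂μ := fun x =>
    (lintegral_indicator (measurable_prodMk_left hA) G).symm
  simp_rw [h1]
  rw [lintegral_lintegral_swap (f := fun x z => A.indicator (fun p => G p.2) (x, z))
    (((hG.comp measurable_snd).indicator hA).aemeasurable)]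
  exact lintegral_congr fun z => lintegral_indicator_const (measurable_prodMk_right hA) (G z)

theorem ntMaximal_term_sq (n : ℕ) (a F : ℝ≥0∞) :
    (a ^ (-(1 + (n : ℝ)) / 2) * F ^ ((1 : ℝ) / 2)) ^ 2 = (a ^ (n + 1))⁻¹ * F := by
  rw [mul_pow, ← ENNReal.rpow_natCast, ← ENNReal.rpow_natCast, ← ENNReal.rpow_mul,
    ← ENNReal.rpow_mul, ← ENNReal.rpow_natCast, ← ENNReal.rpow_neg]
  congr 1
  · congr 1
    push_cast
    ring
  · norm_num

theorem sq_iSup₂_le {ι : Type*} {s : Set ι} {u : ι → ℝ≥0∞} {X : ℝ≥0∞}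
    (h : ∀ t ∈ s, u t ^ 2 ≤ X) : (⨆ t ∈ s, u t) ^ 2 ≤ X := by
  have h2 : ∀ v : ℝ≥0∞, v ^ 2 ≤ X ↔ v ≤ X ^ ((2 : ℝ)⁻¹) := fun v => by
    rw [ENNReal.le_rpow_inv_iff two_pos, ENNReal.rpow_two]
  rw [h2]
  exact iSup₂_le fun t ht => (h2 _).1 (h t ht)

theorem measurable_sum_nnnorm_sq {Z : Type*} [MeasurableSpace Z] {N : ℕ} {f : Z → Fin N → ℂ}
    (hf : Measurable f) : Measurable fun z => ∑ j, ((‖f z j‖₊ : ℝ≥0∞) ^ 2) := by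
  refine Finset.measurable_sum _ fun j _ => ?_
  exact ((measurable_pi_iff.1 hf j).nnnorm.coe_nnreal_ennreal).pow_const 2

theorem lintegral_mul_fst_stripMeasure {n N : ℕ}
    {f : ℝ × sphere (0 : EuclideanSpace ℝ (Fin (n + 1))) 1 → Fin N → ℂ} (hf : Measurable f)
    {w : ℝ → ℝ≥0∞} (hw : Measurable w) :
    ∫⁻ z, (∑ j, ((‖f z j‖₊ : ℝ≥0∞) ^ 2)) * w z.1 ∂(stripMeasure n) =
      ∫⁻ s, sliceNormSq n N f s * w s := by
  rw [stripMeasure, lintegral_prod (fun z => (∑ j, ((‖f z j‖₊ : ℝ≥0∞) ^ 2)) * w z.1)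
    ((measurable_sum_nnnorm_sq hf).mul (hw.comp measurable_fst)).aemeasurable]
  refine lintegral_congr fun s => ?_
  exact lintegral_mul_const (f := fun y => ∑ j, ((‖f (s, y) j‖₊ : ℝ≥0∞) ^ 2)) (w s)
    ((measurable_sum_nnnorm_sq hf).comp measurable_prodMk_left)

theorem lintegral_whitneyRegion (n : ℕ) (c₀ c₁ t : ℝ)
    {G : ℝ × sphere (0 : EuclideanSpace ℝ (Fin (n + 1))) 1 → ℝ≥0∞} (hG : Measurable G) :
    ∫⁻ x, ∫⁻ z in whitneyRegion n c₀ c₁ t x ∩ {z | z.1 < 1}, G z ∂(stripMeasure n)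
        ∂(sphereMeasure n) =
      ∫⁻ z, G z * {s : ℝ | c₀⁻¹ < s / t ∧ s / t < c₀ ∧ s < 1}.indicator 1 z.1 *
        sphereMeasure n (ball z.2 (c₁ * t)) ∂(stripMeasure n) := by
  have hA : MeasurableSet {p : sphere (0 : EuclideanSpace ℝ (Fin (n + 1))) 1 ×
      (ℝ × sphere (0 : EuclideanSpace ℝ (Fin (n + 1))) 1) |
      dist p.2.2 p.1 < c₁ * t ∧ c₀⁻¹ < p.2.1 / t ∧ p.2.1 / t < c₀ ∧ p.2.1 < 1} := by
    measurability
  have h := lintegral_setLIntegral_section (sphereMeasure n) (stripMeasure n) hA hG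
  refine Eq.trans ?_ (h.trans (lintegral_congr fun z => ?_))
  · refine lintegral_congr fun x => ?_
    congr 2
    ext z
    simp only [whitneyRegion, Set.mem_inter_iff, Set.mem_ofPred_eq, Subtype.dist_eq, and_assoc]
  · by_cases hz : c₀⁻¹ < z.1 / t ∧ z.1 / t < c₀ ∧ z.1 < 1
    · rw [Set.indicator_of_mem (by exact hz), Pi.one_apply, mul_one]
      congr 2
      ext x
      simp [hz, dist_comm]
    · rw [Set.indicator_of_notMem (by exact hz)]
      simp [hz]

/-- On a single Whitney scale `t ≤ 1` the `L²` mass of `f` is controlled by `t ‖Ñ*(f)‖₂²`. -/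
theorem setLIntegral_Ioc_sliceNormSq_le (n : ℕ) (c₀ c₁ : ℝ) (hc₀ : 1 < c₀) (hc₁ : 0 < c₁) :
    ∃ D : ℝ≥0∞, D < ⊤ ∧ ∀ (N : ℕ)
      (f : ℝ × sphere (0 : EuclideanSpace ℝ (Fin (n + 1))) 1 → Fin N → ℂ), Measurable f →
      ∀ t : ℝ, 0 < t → t ≤ 1 →
        ∫⁻ s in Set.Ioc (c₀⁻¹ * t) t ∩ Set.Iio 1, sliceNormSq n N f s ≤
          D * ENNReal.ofReal t * ∫⁻ x, (ntMaximal n N c₀ c₁ f x) ^ 2 ∂(sphereMeasure n) := by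
  obtain ⟨a, ha0, hat, ha⟩ := le_sphereMeasure_ball n
  set m := min c₁ 1 with hm
  have hm0 : 0 < m := lt_min hc₁ one_pos
  have hmm : ENNReal.ofReal m ^ n ≠ 0 := pow_ne_zero _ (by simpa using hm0)
  have hmt : ENNReal.ofReal m ^ n ≠ ⊤ := ENNReal.pow_ne_top ENNReal.ofReal_ne_top
  have hA0 : a * ENNReal.ofReal m ^ n ≠ 0 := mul_ne_zero ha0 hmm
  have hAt : a * ENNReal.ofReal m ^ n ≠ ⊤ := ENNReal.mul_ne_top hat hmt
  refine ⟨(a * ENNReal.ofReal m ^ n)⁻¹, ENNReal.inv_lt_top.2 (pos_iff_ne_zero.2 hA0),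
    fun N f hf t ht ht1 => ?_⟩
  set A := a * ENNReal.ofReal m ^ n with hAdef
  set M := ∫⁻ x, (ntMaximal n N c₀ c₁ f x) ^ 2 ∂(sphereMeasure n) with hM
  set T := ENNReal.ofReal t with hT
  have hT0 : T ≠ 0 := by simpa [hT] using ht
  have hTt : T ≠ ⊤ := ENNReal.ofReal_ne_top
  have hTn0 : T ^ n ≠ 0 := pow_ne_zero _ hT0
  have hTnt : T ^ n ≠ ⊤ := ENNReal.pow_ne_top hTt
  have hG := measurable_sum_nnnorm_sq hf
  have hball : ∀ y, A * T ^ n ≤ sphereMeasure n (ball y (c₁ * t)) := fun y => by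
    calc A * T ^ n = a * ENNReal.ofReal (m * t) ^ n := by
          rw [ENNReal.ofReal_mul hm0.le, mul_pow, hAdef, mul_assoc]
      _ ≤ sphereMeasure n (ball y (m * t)) :=
          ha y _ (mul_pos hm0 ht) (mul_le_one₀ (min_le_right _ _) ht.le ht1)
      _ ≤ _ := measure_mono (ball_subset_ball
          (mul_le_mul_of_nonneg_right (min_le_left _ _) ht.le))
  have hS : MeasurableSet (Set.Ioc (c₀⁻¹ * t) t ∩ Set.Iio (1 : ℝ)) :=
    measurableSet_Ioc.inter measurableSet_Iio
  have hlow : (∫⁻ s in Set.Ioc (c₀⁻¹ * t) t ∩ Set.Iio 1, sliceNormSq n N f s) * (A * T ^ n) ≤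
      ∫⁻ x, ∫⁻ z in whitneyRegion n c₀ c₁ t x ∩ {z | z.1 < 1},
        (∑ j, ((‖f z j‖₊ : ℝ≥0∞) ^ 2)) ∂(stripMeasure n) ∂(sphereMeasure n) := by
    rw [lintegral_whitneyRegion n c₀ c₁ t hG]
    have e : ∫⁻ s in Set.Ioc (c₀⁻¹ * t) t ∩ Set.Iio 1, sliceNormSq n N f s =
        ∫⁻ z, (∑ j, ((‖f z j‖₊ : ℝ≥0∞) ^ 2)) *
          (Set.Ioc (c₀⁻¹ * t) t ∩ Set.Iio 1).indicator 1 z.1 ∂(stripMeasure n) := by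
      rw [lintegral_mul_fst_stripMeasure hf (measurable_one.indicator hS), ← lintegral_indicator hS]
      refine lintegral_congr fun s => ?_
      by_cases h : s ∈ Set.Ioc (c₀⁻¹ * t) t ∩ Set.Iio 1
      · simp only [Set.indicator_of_mem h, Pi.one_apply, mul_one]
      · simp only [Set.indicator_of_notMem h, mul_zero]
    rw [e, ← lintegral_mul_const' _ _ (ENNReal.mul_ne_top hAt hTnt)]
    refine lintegral_mono fun z => mul_le_mul' (mul_le_mul' le_rfl ?_) (hball _)
    refine Set.indicator_le_indicator_of_subset ?_ (fun _ => zero_le) _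
    rintro s ⟨⟨h1, h2⟩, h3⟩
    exact ⟨(lt_div_iff₀ ht).2 h1, ((div_le_one ht).2 h2).trans_lt hc₀, h3⟩
  have hup : (T ^ (n + 1))⁻¹ * ∫⁻ x, ∫⁻ z in whitneyRegion n c₀ c₁ t x ∩ {z | z.1 < 1},
        (∑ j, ((‖f z j‖₊ : ℝ≥0∞) ^ 2)) ∂(stripMeasure n) ∂(sphereMeasure n) ≤ M := by
    rw [← lintegral_const_mul' _ _ (ENNReal.inv_ne_top.2 (pow_ne_zero _ hT0))]
    refine lintegral_mono fun x => ?_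
    simp only [← ntMaximal_term_sq]
    have htc : t ∈ Set.Ioo 0 c₀ := ⟨ht, ht1.trans_lt hc₀⟩
    exact pow_le_pow_left' (le_iSup₂_of_le (f := fun t (_ : t ∈ Set.Ioo 0 c₀) =>
      ENNReal.ofReal t ^ (-(1 + (n : ℝ)) / 2) *
      (∫⁻ z in whitneyRegion n c₀ c₁ t x ∩ {z | z.1 < 1},
        (∑ j, ((‖f z j‖₊ : ℝ≥0∞) ^ 2)) ∂(stripMeasure n)) ^ ((1 : ℝ) / 2)) t htc le_rfl) 2
  have key := (mul_le_mul_right hlow (T ^ (n + 1))⁻¹).trans hup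
  set I := ∫⁻ s in Set.Ioc (c₀⁻¹ * t) t ∩ Set.Iio 1, sliceNormSq n N f s
  calc I = A⁻¹ * T * ((T ^ (n + 1))⁻¹ * (I * (A * T ^ n))) := by
        rw [pow_succ, ENNReal.mul_inv (Or.inl hTn0) (Or.inl hTnt)]
        calc I = (A⁻¹ * A) * (T * T⁻¹) * ((T ^ n)⁻¹ * T ^ n) * I := by
              rw [ENNReal.inv_mul_cancel hA0 hAt, ENNReal.mul_inv_cancel hT0 hTt,
                ENNReal.inv_mul_cancel hTn0 hTnt, one_mul, one_mul, one_mul]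
          _ = _ := by ring
    _ ≤ A⁻¹ * T * M := mul_le_mul_right key _

/-- The `L²` mass of `f` on `(0, u) × Sⁿ`, `u ≤ 1`, is controlled by `u ‖Ñ*(f)‖₂²`. -/
theorem setLIntegral_Ioo_sliceNormSq_le (n : ℕ) (c₀ c₁ : ℝ) (hc₀ : 1 < c₀) (hc₁ : 0 < c₁) :
    ∃ D : ℝ≥0∞, D < ⊤ ∧ ∀ (N : ℕ)
      (f : ℝ × sphere (0 : EuclideanSpace ℝ (Fin (n + 1))) 1 → Fin N → ℂ), Measurable f →
      ∀ u : ℝ, 0 < u → u ≤ 1 →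
        ∫⁻ s in Set.Ioo 0 u, sliceNormSq n N f s ≤
          D * ENNReal.ofReal u * ∫⁻ x, (ntMaximal n N c₀ c₁ f x) ^ 2 ∂(sphereMeasure n) := by
  obtain ⟨D, hD, h⟩ := setLIntegral_Ioc_sliceNormSq_le n c₀ c₁ hc₀ hc₁
  have hc0 : 0 < c₀ := one_pos.trans hc₀
  have hq0 : 0 < c₀⁻¹ := inv_pos.2 hc0
  have hq1 : c₀⁻¹ < 1 := inv_lt_one_of_one_lt₀ hc₀
  have hsum : Summable fun k : ℕ => (c₀⁻¹) ^ k := summable_geometric_of_lt_one hq0.le hq1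
  refine ⟨D * ∑' k : ℕ, ENNReal.ofReal ((c₀⁻¹) ^ k), ENNReal.mul_lt_top hD ?_,
    fun N f hf u hu hu1 => ?_⟩
  · rw [← ENNReal.ofReal_tsum_of_nonneg (fun k => by positivity) hsum]
    exact ENNReal.ofReal_lt_top
  have hcov : Set.Ioo 0 u ⊆
      ⋃ k : ℕ, Set.Ioc (c₀⁻¹ * (u * (c₀⁻¹) ^ k)) (u * (c₀⁻¹) ^ k) ∩ Set.Iio 1 := by
    rintro s ⟨hs0, hsu⟩
    obtain ⟨k, hk1, hk2⟩ := exists_nat_pow_near_of_lt_one (x := u⁻¹ * s)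
      (by positivity) ((inv_mul_le_one₀ hu).2 hsu.le) hq0 hq1
    rw [lt_inv_mul_iff₀ hu] at hk1
    rw [inv_mul_le_iff₀ hu] at hk2
    refine Set.mem_iUnion.2 ⟨k, ⟨?_, hk2⟩, hsu.trans_le hu1⟩
    rwa [mul_left_comm, ← pow_succ']
  refine (lintegral_mono_set hcov).trans ((lintegral_iUnion_le _ _).trans ?_)
  calc _ ≤ ∑' k : ℕ, D * ENNReal.ofReal (u * (c₀⁻¹) ^ k) *
        ∫⁻ x, (ntMaximal n N c₀ c₁ f x) ^ 2 ∂(sphereMeasure n) :=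
      ENNReal.tsum_le_tsum fun k => h N f hf _ (by positivity)
        (mul_le_one₀ hu1 (by positivity) (pow_le_one₀ hq0.le hq1.le))
    _ = _ := by
      rw [ENNReal.tsum_mul_right, ENNReal.tsum_mul_left]
      simp_rw [ENNReal.ofReal_mul hu.le]
      rw [ENNReal.tsum_mul_left]
      ring

theorem lintegral_ntMaximal_sq_le (n : ℕ) (c₀ c₁ : ℝ) (hc₀ : 1 < c₀) (hc₁ : 0 < c₁) :
    ∃ D : ℝ≥0∞, D < ⊤ ∧ ∀ (N : ℕ)
      (f : ℝ × sphere (0 : EuclideanSpace ℝ (Fin (n + 1))) 1 → Fin N → ℂ), Measurable f →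
      (∫⁻ x, (ntMaximal n N c₀ c₁ f x) ^ 2 ∂(sphereMeasure n)) ≤
        D * ∫⁻ s in Set.Ioo (0 : ℝ) 1, sliceNormSq n N f s * (ENNReal.ofReal s)⁻¹ := by
  obtain ⟨b, hb, hball⟩ := sphereMeasure_ball_le n
  have hc0 : 0 < c₀ := one_pos.trans hc₀
  refine ⟨ENNReal.ofReal c₀ ^ (n + 1) * (b * ENNReal.ofReal (c₁ * c₀) ^ n),
    ENNReal.mul_lt_top (ENNReal.pow_lt_top ENNReal.ofReal_lt_top)
      (ENNReal.mul_lt_top hb (ENNReal.pow_lt_top ENNReal.ofReal_lt_top)), fun N f hf => ?_⟩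
  have hG := measurable_sum_nnnorm_sq hf
  set H : ℝ × sphere (0 : EuclideanSpace ℝ (Fin (n + 1))) 1 → ℝ≥0∞ :=
    fun z => (∑ j, ((‖f z j‖₊ : ℝ≥0∞) ^ 2)) * (ENNReal.ofReal z.1 ^ (n + 1))⁻¹ with hHdef
  have hH : Measurable H := hG.mul
    ((ENNReal.measurable_ofReal.comp measurable_fst).pow_const (n + 1)).inv
  set A : Set (sphere (0 : EuclideanSpace ℝ (Fin (n + 1))) 1 ×
      (ℝ × sphere (0 : EuclideanSpace ℝ (Fin (n + 1))) 1)) :=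
    {p | dist p.2.2 p.1 < c₁ * c₀ * p.2.1 ∧ 0 < p.2.1 ∧ p.2.1 < 1} with hAdef
  have hA : MeasurableSet A := by
    rw [hAdef]
    measurability
  have hpt : ∀ x, ntMaximal n N c₀ c₁ f x ^ 2 ≤ ENNReal.ofReal c₀ ^ (n + 1) *
      ∫⁻ z in {z | (x, z) ∈ A}, H z ∂(stripMeasure n) := fun x => by
    refine sq_iSup₂_le fun t ht => ?_
    have ht0 : 0 < t := ht.1
    rw [ntMaximal_term_sq, ← lintegral_const_mul' _ _ (ENNReal.inv_ne_top.2
      (pow_ne_zero _ (by simpa using ht0))), ← lintegral_const_mul' _ _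
      (ENNReal.pow_ne_top ENNReal.ofReal_ne_top)]
    have hsub : whitneyRegion n c₀ c₁ t x ∩ {z | z.1 < 1} ⊆ {z | (x, z) ∈ A} := by
      rintro z ⟨⟨h1, h2, h3⟩, h4⟩
      rw [lt_div_iff₀ ht0, inv_mul_lt_iff₀ hc0] at h2
      refine ⟨h1.trans ?_, ?_, h4⟩
      · rw [mul_assoc]
        exact mul_lt_mul_of_pos_left h2 hc₁
      · exact pos_of_mul_pos_right (ht0.trans h2) hc0.le
    have hWm : MeasurableSet (whitneyRegion n c₀ c₁ t x ∩ {z | z.1 < 1}) := by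
      unfold whitneyRegion
      measurability
    refine (setLIntegral_mono' hWm fun z hz => ?_).trans (lintegral_mono_set hsub)
    have hz0 : 0 < z.1 := (hsub hz).2.1
    have hzt : z.1 < c₀ * t := (div_lt_iff₀ ht0).1 hz.1.2.2
    rw [hHdef, mul_comm, mul_left_comm]
    refine mul_le_mul_right ?_ _
    rw [← div_eq_mul_inv, ENNReal.le_div_iff_mul_le (Or.inl (pow_ne_zero _ (by simpa using hz0)))
      (Or.inl (ENNReal.pow_ne_top ENNReal.ofReal_ne_top)), mul_comm, ← div_eq_mul_inv]
    refine ENNReal.div_le_of_le_mul ?_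
    rw [← mul_pow, ← ENNReal.ofReal_mul hc0.le]
    exact pow_le_pow_left' (ENNReal.ofReal_le_ofReal hzt.le) _
  refine (lintegral_mono hpt).trans ?_
  rw [lintegral_const_mul' _ _ (ENNReal.pow_ne_top ENNReal.ofReal_ne_top),
    lintegral_setLIntegral_section (sphereMeasure n) (stripMeasure n) hA hH, mul_assoc]
  refine mul_le_mul_right ?_ _
  have hw : Measurable fun s : ℝ => (Set.Ioo (0 : ℝ) 1).indicator
      (fun s => (ENNReal.ofReal s)⁻¹) s :=
    ENNReal.measurable_ofReal.inv.indicator measurableSet_Ioo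
  have e : ∫⁻ s in Set.Ioo (0 : ℝ) 1, sliceNormSq n N f s * (ENNReal.ofReal s)⁻¹ =
      ∫⁻ z, (∑ j, ((‖f z j‖₊ : ℝ≥0∞) ^ 2)) * (Set.Ioo (0 : ℝ) 1).indicator
        (fun s => (ENNReal.ofReal s)⁻¹) z.1 ∂(stripMeasure n) := by
    rw [lintegral_mul_fst_stripMeasure hf hw, ← lintegral_indicator measurableSet_Ioo]
    simp only [Set.indicator_mul_right]
  rw [e, ← lintegral_const_mul' _ _ (ENNReal.mul_ne_top hb.ne
    (ENNReal.pow_ne_top ENNReal.ofReal_ne_top))]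
  refine lintegral_mono fun z => ?_
  by_cases hz : z.1 ∈ Set.Ioo (0 : ℝ) 1
  · have hs : {x | (x, z) ∈ A} ⊆ ball z.2 (c₁ * c₀ * z.1) := fun x hx => by
      rw [mem_ball, dist_comm]
      exact hx.1
    have hZ0 : ENNReal.ofReal z.1 ≠ 0 := by simpa using hz.1
    have hb' := (measure_mono hs).trans (hball z.2 _ (mul_pos (mul_pos hc₁ hc0) hz.1))
    rw [Set.indicator_of_mem hz]
    refine (mul_le_mul_right hb' _).trans_eq ?_
    rw [ENNReal.ofReal_mul (by positivity), mul_pow, hHdef]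
    simp only
    rw [pow_succ, ENNReal.mul_inv (Or.inl (pow_ne_zero _ hZ0))
      (Or.inl (ENNReal.pow_ne_top ENNReal.ofReal_ne_top))]
    calc _ = ((ENNReal.ofReal z.1 ^ n)⁻¹ * ENNReal.ofReal z.1 ^ n) *
          (b * ENNReal.ofReal (c₁ * c₀) ^ n * ((∑ j, ((‖f z j‖₊ : ℝ≥0∞) ^ 2)) *
            (ENNReal.ofReal z.1)⁻¹)) := by ring
      _ = _ := by
        rw [ENNReal.inv_mul_cancel (pow_ne_zero _ hZ0)
          (ENNReal.pow_ne_top ENNReal.ofReal_ne_top), one_mul]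
  · have hs : {x | (x, z) ∈ A} = ∅ := Set.eq_empty_of_forall_notMem fun x hx => hz hx.2
    rw [hs, measure_empty, mul_zero]
    exact zero_le

/-- **`L²_loc` bounds for the modified non-tangential maximal function.**
`sup_{0<t<1/2} (1/t)∫_t^{2t}‖f_s‖₂² ds ≲ ‖Ñ*(f)‖₂² ≲ ∫_0^1 ‖f_s‖₂² ds/s`, and consequently
`∫_0^∞ ‖f_t‖₂² dt ≲ ‖Ñ*(f)‖₂² + ∫_1^∞ ‖f_t‖₂² dt`. -/
theorem ntMaximal_L2loc_bounds
    (n : ℕ) (hn : 1 ≤ n) (c₀ c₁ : ℝ) (hc₀ : 1 < c₀) (hc₁ : 0 < c₁) :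
    ∃ C C' C'' : ℝ≥0∞, C < ⊤ ∧ C' < ⊤ ∧ C'' < ⊤ ∧
    ∀ (N : ℕ), 1 ≤ N →
    ∀ f : ℝ × sphere (0 : EuclideanSpace ℝ (Fin (n + 1))) 1 → Fin N → ℂ,
      Measurable f →
      (∀ K : Set (ℝ × sphere (0 : EuclideanSpace ℝ (Fin (n + 1))) 1), IsCompact K →
        K ⊆ Set.Ioi (0 : ℝ) ×ˢ Set.univ →
        (∫⁻ z in K, (∑ j, ((‖f z j‖₊ : ℝ≥0∞) ^ 2)) ∂(stripMeasure n)) < ⊤) →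
      (⨆ t ∈ Set.Ioo (0 : ℝ) (1 / 2),
          (ENNReal.ofReal t)⁻¹ * ∫⁻ s in Set.Ioo t (2 * t), sliceNormSq n N f s) ≤
        C * ∫⁻ x, (ntMaximal n N c₀ c₁ f x) ^ 2 ∂(sphereMeasure n) ∧
      (∫⁻ x, (ntMaximal n N c₀ c₁ f x) ^ 2 ∂(sphereMeasure n)) ≤
        C' * ∫⁻ s in Set.Ioo (0 : ℝ) 1, sliceNormSq n N f s * (ENNReal.ofReal s)⁻¹ ∧
      (∫⁻ s in Set.Ioi (0 : ℝ), sliceNormSq n N f s) ≤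
        C'' * ((∫⁻ x, (ntMaximal n N c₀ c₁ f x) ^ 2 ∂(sphereMeasure n)) +
          ∫⁻ s in Set.Ioi (1 : ℝ), sliceNormSq n N f s) := by
  obtain ⟨D, hD, h1⟩ := setLIntegral_Ioo_sliceNormSq_le n c₀ c₁ hc₀ hc₁
  obtain ⟨D', hD', h2⟩ := lintegral_ntMaximal_sq_le n c₀ c₁ hc₀ hc₁
  refine ⟨D * 2, D', max D 1, ENNReal.mul_lt_top hD (by simp), hD', max_lt hD (by simp),
    fun N _ f hf _ => ⟨iSup₂_le fun t ht => ?_, h2 N f hf, ?_⟩⟩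
  · have ht0 : ENNReal.ofReal t ≠ 0 := by simpa using ht.1
    rw [mul_comm, ← div_eq_mul_inv]
    refine ENNReal.div_le_of_le_mul ?_
    have h := h1 N f hf (2 * t) (by linarith [ht.1]) (by linarith [ht.2])
    rw [ENNReal.ofReal_mul zero_le_two, ENNReal.ofReal_ofNat] at h
    refine (lintegral_mono_set (Set.Ioo_subset_Ioo_left ht.1.le)).trans (h.trans_eq ?_)
    ring
  · have hu : Set.Ioi (0 : ℝ) = Set.Ioo 0 1 ∪ Set.Ici 1 :=
      (Set.Ioo_union_Ici_eq_Ioi zero_lt_one).symm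
    have h := h1 N f hf 1 one_pos le_rfl
    rw [ENNReal.ofReal_one, mul_one] at h
    rw [hu, mul_add]
    refine (lintegral_union_le _ _ _).trans (add_le_add
      (h.trans (mul_le_mul_left (le_max_left _ _) _)) ?_)
    rw [← setLIntegral_congr (Ioi_ae_eq_Ici (a := (1 : ℝ)) (μ := volume))]
    exact le_mul_of_one_le_left zero_le (le_max_right _ _)
end

section
/- Let m ≥ 1, let O² ⊂ ℝ² be the open unit disk and S¹ its boundary circle with arclength measure dσ. Let A : O² → ℒ(ℂ^{2m}) be bounded measurable, and suppose A is strictly accretive with constant κ > 0 in the integrated sense: for a.e. r ∈ (0,1) and every u ∈ C¹(O²; ℂ^m), ∫_{S¹} Re⟨A(rx)∇u(rx), ∇u(rx)⟩ dσ(x) ≥ κ ∫_{S¹} |∇u(rx)|² dσ(x). Then A is pointwise strictly accretive with the same constant: Re⟨A(x)v, v⟩ ≥ κ |v|² for every v ∈ ℂ^{2m} and a.e. x ∈ O². -/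
open MeasureTheory Metric
open scoped ENNReal NNReal

/-- The linear isometric identification of the Euclidean plane with `ℂ`. -/
noncomputable def planeToComplex : EuclideanSpace ℝ (Fin 2) ≃ₗᵢ[ℝ] ℂ :=
  Complex.orthonormalBasisOneI.repr.symm

theorem planeToComplex_single (j : Fin 2) :
    planeToComplex (EuclideanSpace.single j 1) = if j = 0 then 1 else Complex.I := by
  fin_cases j <;> simp [planeToComplex]

/-- Every polynomial multiple `z ^ 2 * P z • v` of a constant field `v` is, along the circle of
radius `r`, the gradient of a smooth function. -/
theorem exists_contDiff_fderiv_eq_on_circle {m : ℕ} (r : ℝ) (v : Fin m × Fin 2 → ℂ)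
    (P : Polynomial ℂ) :
    ∃ u : EuclideanSpace ℝ (Fin 2) → Fin m → ℂ, ContDiff ℝ 1 u ∧
      ∀ y, ‖y‖ = r → ∀ q : Fin m × Fin 2,
        fderiv ℝ u y (EuclideanSpace.single q.2 1) q.1 =
          planeToComplex y ^ 2 * P.eval (planeToComplex y) * v q := by
  induction P using Polynomial.induction_on' with
  | add P Q hP hQ =>
    obtain ⟨f, hf, hfP⟩ := hP
    obtain ⟨g, hg, hgQ⟩ := hQ
    refine ⟨f + g, hf.add hg, fun y hy q => ?_⟩
    rw [fderiv_add (hf.differentiable one_ne_zero y) (hg.differentiable one_ne_zero y)]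
    simp only [add_apply, Pi.add_apply, hfP y hy, hgQ y hy, Polynomial.eval_add]
    ring
  | monomial n c =>
    set Z : EuclideanSpace ℝ (Fin 2) →L[ℝ] ℂ :=
      (planeToComplex.toContinuousLinearEquiv : EuclideanSpace ℝ (Fin 2) →L[ℝ] ℂ) with hZ
    have hZa : ∀ y, Z y = planeToComplex y := fun y => rfl
    set W : EuclideanSpace ℝ (Fin 2) →L[ℝ] ℂ := (Complex.conjCLE : ℂ →L[ℝ] ℂ).comp Z with hW
    have hWa : ∀ y, W y = (starRingEnd ℂ) (planeToComplex y) := fun y => rfl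
    let p : Fin m → ℂ := fun α => (v (α, 0) - Complex.I * v (α, 1)) / 2
    let s : Fin m → ℂ := fun α => (v (α, 0) + Complex.I * v (α, 1)) / 2
    let u : EuclideanSpace ℝ (Fin 2) → Fin m → ℂ := fun y α =>
      c * (p α / (n + 3) * Z y ^ (n + 3) +
        s α * (Z y ^ (n + 2) * W y - (n + 2) / (n + 1) * r ^ 2 * Z y ^ (n + 1)))
    have hu : ContDiff ℝ 1 u := by
      rw [contDiff_pi]
      intro α
      fun_prop
    refine ⟨u, hu, fun y hy q => ?_⟩
    obtain ⟨α, j⟩ := q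
    have h1 : fderiv ℝ u y (EuclideanSpace.single j 1) α
        = fderiv ℝ (fun y => u y α) y (EuclideanSpace.single j 1) := by
      rw [fderiv_apply (hu.differentiable one_ne_zero y)]
      rfl
    have hZd : HasFDerivAt Z Z y := Z.hasFDerivAt
    have hWd : HasFDerivAt W W y := W.hasFDerivAt
    have hd : HasFDerivAt (fun y => u y α) _ y :=
      ((((hZd.pow (n + 3)).const_mul (p α / (n + 3))).add
        ((((hZd.pow (n + 2)).mul hWd).sub ((hZd.pow (n + 1)).const_mul
          ((n + 2) / (n + 1) * (r : ℂ) ^ 2))).const_mul (s α))).const_mul c)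
    have hzw : planeToComplex y * (starRingEnd ℂ) (planeToComplex y) = (r : ℂ) ^ 2 := by
      rw [Complex.mul_conj, Complex.normSq_eq_norm_sq, planeToComplex.norm_map, hy]
      push_cast; rfl
    rw [h1, hd.fderiv]
    have hn1 : (n : ℂ) + 1 ≠ 0 := by exact_mod_cast Nat.succ_ne_zero n
    have hn3 : (n : ℂ) + 3 ≠ 0 := by exact_mod_cast (Nat.succ_ne_zero (n + 2))
    simp only [FunLike.coe_smul, FunLike.coe_add, FunLike.coe_sub, Pi.smul_apply, Pi.add_apply,
      Pi.sub_apply, smul_eq_mul, nsmul_eq_mul, hZa, hWa,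
      planeToComplex_single, Polynomial.eval_monomial, Nat.add_sub_cancel, ← hzw]
    push_cast
    generalize planeToComplex y = z
    fin_cases j
    · simp [p, s]
      field_simp
      ring
    · simp [p, s]
      field_simp
      linear_combination (-2 * c * v (α, 1) * z ^ 2 * z ^ n) * Complex.I_sq


open Filter Topology in
/-- An integrable function whose integrals against all `‖f‖ ^ 2`, `f` continuous, are nonnegative
is nonnegative almost everywhere. -/
theorem ae_nonneg_of_forall_integral_normSq_mul_nonneg {X : Type*} [MetricSpace X] [CompactSpace X]
    [MeasurableSpace X] [BorelSpace X] {μ : Measure X} [IsFiniteMeasure μ] {g : X → ℝ}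
    (hgm : Measurable g) (hg : Integrable g μ)
    (h : ∀ f : C(X, ℂ), 0 ≤ ∫ x, ‖f x‖ ^ 2 * g x ∂μ) : ∀ᵐ x ∂μ, 0 ≤ g x := by
  have hclosed : ∀ F : Set X, IsClosed F → 0 ≤ ∫ x in F, g x ∂μ := by
    intro F hF
    have hlim : Tendsto (fun n => ∫ x, ‖((hF.apprSeq n x : ℝ) : ℂ)‖ ^ 2 * g x ∂μ) atTop
        (𝓝 (∫ x, F.indicator g x ∂μ)) := by
      refine tendsto_integral_of_dominated_convergence (fun x => ‖g x‖) (fun n => ?_) hg.norm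
        (fun n => ?_) ?_
      · refine AEStronglyMeasurable.mul ?_ hg.aestronglyMeasurable
        exact Continuous.aestronglyMeasurable (by fun_prop)
      · refine ae_of_all _ fun x => ?_
        have h1 : (hF.apprSeq n x : ℝ) ≤ 1 :=
          mod_cast HasOuterApproxClosed.apprSeq_apply_le_one hF n x
        have h0 : (0 : ℝ) ≤ hF.apprSeq n x := NNReal.coe_nonneg _
        rw [norm_mul, norm_pow, norm_norm, Complex.norm_real, Real.norm_of_nonneg h0]
        exact mul_le_of_le_one_left (norm_nonneg _) (pow_le_one₀ h0 h1)
      · refine ae_of_all _ fun x => ?_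
        have hx := tendsto_pi_nhds.1 (HasOuterApproxClosed.tendsto_apprSeq hF) x
        have hx' := (NNReal.tendsto_coe.2 hx)
        have := ((hx'.pow 2).mul_const (g x))
        simp only [Complex.norm_real, NNReal.norm_eq]
        convert! this using 2
        by_cases hxF : x ∈ F <;> simp [hxF]
    rw [← integral_indicator hF.measurableSet]
    refine ge_of_tendsto' hlim fun n => ?_
    exact h ⟨fun x => ((hF.apprSeq n x : ℝ) : ℂ), by fun_prop⟩
  have hS : MeasurableSet {x | g x < 0} := measurableSet_lt hgm measurable_const
  suffices μ {x | g x < 0} = 0 by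
    rw [ae_iff]; simpa only [not_le] using this
  by_contra hne
  obtain ⟨F, hFS, hF, hFpos⟩ := hS.exists_lt_isClosed_of_ne_top (measure_ne_top μ _)
    (pos_iff_ne_zero.2 hne)
  have hpos : 0 < ∫ x in F, (-g x) ∂μ := by
    rw [setIntegral_pos_iff_support_of_nonneg_ae]
    · refine hFpos.trans_le (measure_mono fun x hx => ⟨?_, hx⟩)
      have := hFS hx
      simp only [Set.mem_ofPred_eq] at this
      simp [this.ne]
    · filter_upwards [ae_restrict_mem hF.measurableSet] with x hx
      have := hFS hx
      simp only [Set.mem_ofPred_eq] at this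
      simp [this.le]
    · exact hg.neg.integrableOn
  rw [integral_neg] at hpos
  linarith [hclosed F hF]

open Filter Topology in
/-- Nonnegativity of the integrals of `‖f‖ ^ 2 * g` passes from a dense set of continuous functions
`f` to all of them. -/
theorem integral_normSq_mul_nonneg_of_dense {X : Type*} [TopologicalSpace X] [CompactSpace X]
    [MeasurableSpace X] [BorelSpace X] {μ : Measure X} [IsFiniteMeasure μ] {g : X → ℝ}
    (hg : Integrable g μ) {S : Set C(X, ℂ)} (hS : Dense S)
    (h : ∀ f ∈ S, 0 ≤ ∫ x, ‖f x‖ ^ 2 * g x ∂μ) (f : C(X, ℂ)) :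
    0 ≤ ∫ x, ‖f x‖ ^ 2 * g x ∂μ := by
  have hcont : Continuous fun f : C(X, ℂ) => ∫ x, ‖f x‖ ^ 2 * g x ∂μ := by
    rw [continuous_iff_continuousAt]
    intro f
    refine continuousAt_of_dominated (bound := fun x => (‖f‖ + 1) ^ 2 * ‖g x‖) ?_ ?_ ?_ ?_
    · refine Eventually.of_forall fun k => ?_
      refine AEStronglyMeasurable.mul ?_ hg.aestronglyMeasurable
      exact Continuous.aestronglyMeasurable_of_compactSpace (by fun_prop)
    · filter_upwards [Metric.ball_mem_nhds f one_pos] with k hk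
      refine ae_of_all _ fun x => ?_
      rw [norm_mul, norm_pow, norm_norm]
      have hk' : ‖k x‖ ≤ ‖f‖ + 1 := by
        refine (k.norm_coe_le_norm x).trans ?_
        have := norm_le_norm_add_norm_sub' k f
        rw [mem_ball, dist_eq_norm] at hk
        linarith
      gcongr
    · exact hg.norm.const_mul _
    · refine ae_of_all _ fun x => ?_
      exact Continuous.continuousAt (by fun_prop)
  exact (isClosed_le continuous_const hcont).closure_subset_iff.2 h (hS f)

/-- The functions on the unit circle of the plane which become polynomials in `z` after
multiplication with a power of `z` are dense among the continuous functions. -/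
theorem dense_trigonometricPolynomials_sphere :
    Dense {f : C(sphere (0 : EuclideanSpace ℝ (Fin 2)) 1, ℂ) |
      ∃ (N : ℕ) (P : Polynomial ℂ), ∀ x : sphere (0 : EuclideanSpace ℝ (Fin 2)) 1,
        planeToComplex x ^ N * f x = P.eval (planeToComplex x)} := by
  let B : Subalgebra ℂ C(sphere (0 : EuclideanSpace ℝ (Fin 2)) 1, ℂ) :=
    { carrier := {f | ∃ (N : ℕ) (P : Polynomial ℂ),
        ∀ x : sphere (0 : EuclideanSpace ℝ (Fin 2)) 1, planeToComplex x ^ N * f x = P.eval (planeToComplex x)}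
      mul_mem' := by
        rintro f g ⟨N, P, hP⟩ ⟨K, Q, hQ⟩
        refine ⟨N + K, P * Q, fun x => ?_⟩
        rw [Polynomial.eval_mul, ← hP, ← hQ, ContinuousMap.mul_apply]
        ring
      add_mem' := by
        rintro f g ⟨N, P, hP⟩ ⟨K, Q, hQ⟩
        refine ⟨N + K, Polynomial.X ^ K * P + Polynomial.X ^ N * Q, fun x => ?_⟩
        simp only [Polynomial.eval_add, Polynomial.eval_mul, Polynomial.eval_pow,
          Polynomial.eval_X, ← hP, ← hQ, ContinuousMap.add_apply]
        ring
      algebraMap_mem' := fun c => ⟨0, Polynomial.C c, fun x => by simp⟩ }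
  let z : C(sphere (0 : EuclideanSpace ℝ (Fin 2)) 1, ℂ) :=
    ⟨fun x => planeToComplex x, by fun_prop⟩
  have hz : z ∈ B := ⟨0, Polynomial.X, fun x => by simp [z]⟩
  have hzs : star z ∈ B := by
    refine ⟨1, 1, fun x => ?_⟩
    have hx : ‖planeToComplex x‖ = 1 := by
      rw [planeToComplex.norm_map]; simp
    change planeToComplex x ^ 1 * (starRingEnd ℂ) (planeToComplex x) = _
    rw [pow_one, Complex.mul_conj, Complex.normSq_eq_norm_sq, hx]
    simp
  have hle : (StarAlgebra.adjoin ℂ {z}).toSubalgebra ≤ B := by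
    rw [StarAlgebra.adjoin_toSubalgebra, Algebra.adjoin_le_iff]
    rintro f (rfl | hf)
    · exact hz
    · rw [Set.star_singleton, Set.mem_singleton_iff] at hf
      exact hf ▸ hzs
  have htop := ContinuousMap.starSubalgebra_topologicalClosure_eq_top_of_separatesPoints
    (StarAlgebra.adjoin ℂ {z}) (fun x y hxy => ⟨z, ⟨z, StarAlgebra.self_mem_adjoin_singleton ℂ z,
      rfl⟩, fun h => hxy (Subtype.ext (planeToComplex.injective h))⟩)
  have hdense : Dense (StarAlgebra.adjoin ℂ {z} :
      Set C(sphere (0 : EuclideanSpace ℝ (Fin 2)) 1, ℂ)) := by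
    rw [dense_iff_closure_eq, ← StarSubalgebra.topologicalClosure_coe, htop]
    rfl
  exact hdense.mono hle

/-- Polar coordinates for properties holding almost everywhere. -/
theorem ae_iff_ae_radius_ae_sphere {E : Type*} [NormedAddCommGroup E] [NormedSpace ℝ E]
    [Nontrivial E] [FiniteDimensional ℝ E] [MeasurableSpace E] [BorelSpace E] (μ : Measure E)
    [μ.IsAddHaarMeasure] {p : E → Prop} (hp : MeasurableSet {y | p y}) :
    (∀ᵐ y ∂μ, p y) ↔ ∀ᵐ r ∂(volume : Measure ℝ).restrict (Set.Ioi 0),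
      ∀ᵐ x : sphere (0 : E) 1 ∂μ.toSphere, p (r • (x : E)) := by
  have hmp := μ.measurePreserving_homeomorphUnitSphereProd
  have hpre : MeasurableSet {w : sphere (0 : E) 1 × Set.Ioi (0 : ℝ) | p (w.2.1 • (w.1 : E))} := by
    refine measurableSet_preimage (f := fun w : sphere (0 : E) 1 × Set.Ioi (0 : ℝ) =>
      w.2.1 • (w.1 : E)) ?_ hp
    fun_prop
  have h1 : (∀ᵐ y ∂μ, p y) ↔
      ∀ᵐ w ∂μ.toSphere.prod (Measure.volumeIoiPow (Module.finrank ℝ E - 1)),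
        p (w.2.1 • (w.1 : E)) := by
    conv_lhs => rw [← restrict_compl_singleton (μ := μ) 0,
      ae_restrict_iff_subtype (measurableSet_singleton (0 : E)).compl]
    rw [← hmp.map_eq, ae_map_iff hmp.aemeasurable hpre]
    refine Filter.eventually_congr (Filter.Eventually.of_forall fun y => ?_)
    rw [← homeomorphUnitSphereProd_symm_apply_coe, Homeomorph.symm_apply_apply]
  rw [h1, Measure.ae_prod_iff_ae_ae hpre, Measure.ae_ae_comm hpre, Measure.volumeIoiPow,
    ae_withDensity_iff (by fun_prop), ae_restrict_iff_subtype measurableSet_Ioi]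
  refine Filter.eventually_congr (Filter.Eventually.of_forall fun r => ?_)
  have hr : ENNReal.ofReal (r.1 ^ (Module.finrank ℝ E - 1)) ≠ 0 := by
    have := r.2.out
    simp; positivity
  simp only [hr, ne_eq, not_false_eq_true, forall_const]

/-- The real part of the sesquilinear form of a matrix scales with the squared modulus. -/
theorem re_sum_conj_mulVec_mul_smul {ι : Type*} [Fintype ι] (B : Matrix ι ι ℂ) (c : ℂ)
    (v : ι → ℂ) :
    (∑ q, (starRingEnd ℂ) (B.mulVec (fun q' => c * v q') q) * (c * v q)).re =
      ‖c‖ ^ 2 * (∑ q, (starRingEnd ℂ) (B.mulVec v q) * v q).re := by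
  have hc : B.mulVec (fun q' => c * v q') = c • B.mulVec v := B.mulVec_smul c v
  have hsum : ∑ q, (starRingEnd ℂ) (B.mulVec (fun q' => c * v q') q) * (c * v q) =
      ((‖c‖ ^ 2 : ℝ) : ℂ) * ∑ q, (starRingEnd ℂ) (B.mulVec v q) * v q := by
    rw [hc, ← Complex.normSq_eq_norm_sq, Complex.normSq_eq_conj_mul_self, Finset.mul_sum]
    refine Finset.sum_congr rfl fun q _ => ?_
    rw [Pi.smul_apply, smul_eq_mul, map_mul]
    ring
  rw [hsum, Complex.re_ofReal_mul]

theorem measurable_re_sum_conj_mulVec_mul {X ι : Type*} [MeasurableSpace X] [Fintype ι]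
    {A : X → Matrix ι ι ℂ} (hA : ∀ i j, Measurable fun x => A x i j) (v : ι → ℂ) :
    Measurable fun x => (∑ q, (starRingEnd ℂ) ((A x).mulVec v q) * v q).re := by
  simp only [Matrix.mulVec, dotProduct]
  refine Complex.measurable_re.comp (Finset.measurable_fun_sum _ fun q _ => ?_)
  refine Measurable.mul_const (Complex.continuous_conj.measurable.comp ?_) _
  exact Finset.measurable_fun_sum _ fun q' _ => (hA q q').mul_const _

/-- On a single circle, the integrated accretivity inequality for gradients implies the pointwise
one. -/
theorem ae_accretive_on_circle {m : ℕ}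
    {A : EuclideanSpace ℝ (Fin 2) → Matrix (Fin m × Fin 2) (Fin m × Fin 2) ℂ}
    (hAmeas : ∀ i j, Measurable (fun x => A x i j)) {M κ r : ℝ} (hr : 0 < r)
    (hAbound : ∀ᵐ x : sphere (0 : EuclideanSpace ℝ (Fin 2)) 1
      ∂(volume : Measure (EuclideanSpace ℝ (Fin 2))).toSphere,
      ∀ i j, ‖A (r • (x : EuclideanSpace ℝ (Fin 2))) i j‖ ≤ M)
    (hacc : ∀ u : EuclideanSpace ℝ (Fin 2) → Fin m → ℂ,
        ContDiffOn ℝ 1 u (ball (0 : EuclideanSpace ℝ (Fin 2)) 1) →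
        κ * (∫ x : sphere (0 : EuclideanSpace ℝ (Fin 2)) 1,
            ∑ q : Fin m × Fin 2,
              ‖fderiv ℝ u (r • (x : EuclideanSpace ℝ (Fin 2)))
                (EuclideanSpace.single q.2 1) q.1‖ ^ 2
            ∂((volume : Measure (EuclideanSpace ℝ (Fin 2))).toSphere)) ≤
        (∫ x : sphere (0 : EuclideanSpace ℝ (Fin 2)) 1,
            (∑ q : Fin m × Fin 2,
              (starRingEnd ℂ) ((A (r • (x : EuclideanSpace ℝ (Fin 2)))).mulVec
                (fun q' => fderiv ℝ u (r • (x : EuclideanSpace ℝ (Fin 2)))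
                  (EuclideanSpace.single q'.2 1) q'.1) q) *
                fderiv ℝ u (r • (x : EuclideanSpace ℝ (Fin 2)))
                  (EuclideanSpace.single q.2 1) q.1).re
            ∂((volume : Measure (EuclideanSpace ℝ (Fin 2))).toSphere)))
    (v : Fin m × Fin 2 → ℂ) :
    ∀ᵐ x : sphere (0 : EuclideanSpace ℝ (Fin 2)) 1
      ∂(volume : Measure (EuclideanSpace ℝ (Fin 2))).toSphere,
      κ * (∑ q, ‖v q‖ ^ 2) ≤ (∑ q, (starRingEnd ℂ)
        ((A (r • (x : EuclideanSpace ℝ (Fin 2)))).mulVec v q) * v q).re := by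
  set σ := (volume : Measure (EuclideanSpace ℝ (Fin 2))).toSphere
  set form : sphere (0 : EuclideanSpace ℝ (Fin 2)) 1 → ℝ := fun x => (∑ q, (starRingEnd ℂ)
    ((A (r • (x : EuclideanSpace ℝ (Fin 2)))).mulVec v q) * v q).re with hform
  have hformMeas : Measurable form :=
    (measurable_re_sum_conj_mulVec_mul hAmeas v).comp
      (g := fun y => (∑ q, (starRingEnd ℂ) ((A y).mulVec v q) * v q).re) (by fun_prop)
  have hformInt : Integrable form σ := by
    refine Integrable.of_bound hformMeas.aestronglyMeasurable
      (∑ q, (∑ q', M * ‖v q'‖) * ‖v q‖) ?_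
    filter_upwards [hAbound] with x hx
    refine (Complex.abs_re_le_norm _).trans (norm_sum_le_of_le _ fun q _ => ?_)
    rw [norm_mul, RCLike.norm_conj]
    refine mul_le_mul_of_nonneg_right (norm_sum_le_of_le _ fun q' _ => ?_) (norm_nonneg _)
    rw [norm_mul]
    exact mul_le_mul_of_nonneg_right (hx q q') (norm_nonneg _)
  have hgInt : Integrable (fun x => form x - κ * ∑ q, ‖v q‖ ^ 2) σ :=
    hformInt.sub (integrable_const _)
  have key : ∀ᵐ x ∂σ, 0 ≤ form x - κ * ∑ q, ‖v q‖ ^ 2 := by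
    refine ae_nonneg_of_forall_integral_normSq_mul_nonneg (hformMeas.sub_const _) hgInt
      (integral_normSq_mul_nonneg_of_dense hgInt dense_trigonometricPolynomials_sphere ?_)
    rintro f ⟨N, P, hP⟩
    obtain ⟨u, hu, hgrad⟩ := exists_contDiff_fderiv_eq_on_circle r v
      (P.comp (Polynomial.C (r : ℂ)⁻¹ * Polynomial.X))
    let ψ : sphere (0 : EuclideanSpace ℝ (Fin 2)) 1 → ℂ := fun x =>
      (r * planeToComplex x) ^ 2 * (planeToComplex x ^ N * f x)
    have hgradψ : ∀ (x : sphere (0 : EuclideanSpace ℝ (Fin 2)) 1) (q : Fin m × Fin 2),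
        fderiv ℝ u (r • (x : EuclideanSpace ℝ (Fin 2))) (EuclideanSpace.single q.2 1) q.1 =
          ψ x * v q := by
      intro x q
      have hr' : (r : ℂ) ≠ 0 := mod_cast hr.ne'
      rw [hgrad _ (by rw [norm_smul, norm_eq_of_mem_sphere, mul_one, Real.norm_of_nonneg hr.le])]
      simp [ψ, hP, hr']
    have hψ : ∀ x, ‖ψ x‖ ^ 2 = r ^ 4 * ‖f x‖ ^ 2 := by
      intro x
      have hx : ‖planeToComplex x‖ = 1 := by
        rw [planeToComplex.norm_map, norm_eq_of_mem_sphere]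
      simp only [ψ, norm_mul, norm_pow, hx, Complex.norm_real, Real.norm_of_nonneg hr.le]
      ring
    have hineq := hacc u hu.contDiffOn
    simp only [hgradψ, re_sum_conj_mulVec_mul_smul, norm_mul, mul_pow, ← Finset.mul_sum, hψ]
      at hineq
    have hfInt : Integrable (fun x => ‖f x‖ ^ 2 * form x) σ := by
      refine hformInt.bdd_mul (c := ‖f‖ ^ 2)
        (Continuous.aestronglyMeasurable (by fun_prop)) (ae_of_all _ fun x => ?_)
      rw [norm_pow, norm_norm]
      gcongr
      exact f.norm_coe_le_norm x
    have hfInt' : Integrable (fun x => ‖f x‖ ^ 2 * (κ * ∑ q, ‖v q‖ ^ 2)) σ :=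
      (Continuous.integrable_of_hasCompactSupport (by fun_prop)
        (HasCompactSupport.of_compactSpace _))
    simp only [mul_sub]
    rw [integral_sub hfInt hfInt', integral_mul_const]
    simp only [mul_assoc, integral_const_mul, integral_mul_const] at hineq
    rw [mul_left_comm] at hineq
    have := le_of_mul_le_mul_left hineq (by positivity : (0 : ℝ) < r ^ 4)
    linarith
  filter_upwards [key] with x hx
  linarith

/-- **In the unit disk, integrated (Gårding) strict accretivity implies pointwise strict
accretivity with the same constant.** -/
theorem disk_garding_implies_pointwise_accretive
    (m : ℕ) (hm : 1 ≤ m)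
    (A : EuclideanSpace ℝ (Fin 2) → Matrix (Fin m × Fin 2) (Fin m × Fin 2) ℂ)
    (hAmeas : ∀ i j, Measurable (fun x => A x i j))
    (M : ℝ)
    (hAbound : ∀ᵐ x ∂(volume : Measure (EuclideanSpace ℝ (Fin 2))), ∀ i j, ‖A x i j‖ ≤ M)
    (κ : ℝ) (hκ : 0 < κ)
    -- integrated strict accretivity in the sense of Gårding on circles
    (hacc : ∀ᵐ r ∂((volume : Measure ℝ).restrict (Set.Ioo (0 : ℝ) 1)),
      ∀ u : EuclideanSpace ℝ (Fin 2) → Fin m → ℂ,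
        ContDiffOn ℝ 1 u (ball (0 : EuclideanSpace ℝ (Fin 2)) 1) →
        κ * (∫ x : sphere (0 : EuclideanSpace ℝ (Fin 2)) 1,
            ∑ q : Fin m × Fin 2,
              ‖fderiv ℝ u (r • (x : EuclideanSpace ℝ (Fin 2)))
                (EuclideanSpace.single q.2 1) q.1‖ ^ 2
            ∂((volume : Measure (EuclideanSpace ℝ (Fin 2))).toSphere)) ≤
        (∫ x : sphere (0 : EuclideanSpace ℝ (Fin 2)) 1,
            (∑ q : Fin m × Fin 2,
              (starRingEnd ℂ) ((A (r • (x : EuclideanSpace ℝ (Fin 2)))).mulVec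
                (fun q' => fderiv ℝ u (r • (x : EuclideanSpace ℝ (Fin 2)))
                  (EuclideanSpace.single q'.2 1) q'.1) q) *
                fderiv ℝ u (r • (x : EuclideanSpace ℝ (Fin 2)))
                  (EuclideanSpace.single q.2 1) q.1).re
            ∂((volume : Measure (EuclideanSpace ℝ (Fin 2))).toSphere))) :
    -- pointwise strict accretivity with the same constant
    ∀ᵐ x ∂((volume : Measure (EuclideanSpace ℝ (Fin 2))).restrict
        (ball (0 : EuclideanSpace ℝ (Fin 2)) 1)),
      ∀ v : Fin m × Fin 2 → ℂ,
        κ * (∑ q, ‖v q‖ ^ 2) ≤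
          (∑ q, (starRingEnd ℂ) ((A x).mulVec v q) * v q).re := by
  have hbound := (ae_iff_ae_radius_ae_sphere volume
    (p := fun x => ∀ i j, ‖A x i j‖ ≤ M) (by
      simp only [Set.ofPred_forall]
      exact MeasurableSet.iInter fun i => MeasurableSet.iInter fun j =>
        measurableSet_le (hAmeas i j).norm measurable_const)).1 hAbound
  have hfixed : ∀ v : Fin m × Fin 2 → ℂ,
      ∀ᵐ x ∂((volume : Measure (EuclideanSpace ℝ (Fin 2))).restrict
        (ball (0 : EuclideanSpace ℝ (Fin 2)) 1)),
        κ * (∑ q, ‖v q‖ ^ 2) ≤ (∑ q, (starRingEnd ℂ) ((A x).mulVec v q) * v q).re := by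
    intro v
    rw [ae_restrict_iff' measurableSet_ball, ae_iff_ae_radius_ae_sphere volume
      (p := fun x => x ∈ ball (0 : EuclideanSpace ℝ (Fin 2)) 1 → κ * (∑ q, ‖v q‖ ^ 2) ≤
        (∑ q, (starRingEnd ℂ) ((A x).mulVec v q) * v q).re)
      (measurableSet_ball.imp (measurableSet_le measurable_const
        (measurable_re_sum_conj_mulVec_mul hAmeas v)))]
    rw [ae_restrict_iff' measurableSet_Ioo] at hacc
    filter_upwards [hbound, ae_restrict_mem measurableSet_Ioi, ae_restrict_of_ae hacc]
      with r hrb hr0 hra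
    by_cases hr1 : r < 1
    · filter_upwards [ae_accretive_on_circle hAmeas hr0 hrb (hra ⟨hr0, hr1⟩) v] with x hx _
      exact hx
    · refine ae_of_all _ fun x hx => absurd ?_ hr1
      rwa [mem_ball_zero_iff, norm_smul, norm_eq_of_mem_sphere, mul_one,
        Real.norm_of_nonneg (le_of_lt hr0)] at hx
  obtain ⟨D, hDc, hDd⟩ := TopologicalSpace.exists_countable_dense (Fin m × Fin 2 → ℂ)
  filter_upwards [(ae_ball_iff hDc).2 fun v _ => hfixed v] with x hx v
  have hclosed : IsClosed {v : Fin m × Fin 2 → ℂ | κ * (∑ q, ‖v q‖ ^ 2) ≤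
      (∑ q, (starRingEnd ℂ) ((A x).mulVec v q) * v q).re} := by
    refine isClosed_le (by fun_prop) ?_
    simp only [Matrix.mulVec, dotProduct]
    fun_prop
  exact hclosed.closure_subset_iff.2 hx (hDd v)
end

section
/- Let k, l ≥ 1 and let A = [[A⊥⊥, A⊥∥],[A∥⊥, A∥∥]] ∈ ℒ(ℂ^k ⊕ ℂ^l) have invertible block A⊥⊥, with transform Â. For v = (v⊥, v∥) ∈ ℂ^k ⊕ ℂ^l set w := ((Av)⊥, v∥), where (Av)⊥ = A⊥⊥v⊥ + A⊥∥v∥ denotes the first block component of Av. Then: (i) the map v ↦ w is a linear bijection of ℂ^k ⊕ ℂ^l; (ii) Re⟨Â w, w⟩ = Re⟨A v, v⟩ for all v; (iii) consequently, if Re⟨A v, v⟩ ≥ κ |v|² for all v ∈ ℂ^{k+l} with some κ > 0, then there exists κ' > 0, depending only on κ and the operator norm ‖A‖, such that Re⟨Â w, w⟩ ≥ κ' |w|² for all w ∈ ℂ^{k+l}. -/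
open scoped Matrix

/-- The transformed matrix `Â` of a block matrix `A = [[A⊥⊥, A⊥∥],[A∥⊥, A∥∥]]`
with invertible block `A⊥⊥`. -/
noncomputable def hatTransform {k l : ℕ}
    (App : Matrix (Fin k) (Fin k) ℂ) (Apr : Matrix (Fin k) (Fin l) ℂ)
    (Arp : Matrix (Fin l) (Fin k) ℂ) (Arr : Matrix (Fin l) (Fin l) ℂ) :
    Matrix (Fin k ⊕ Fin l) (Fin k ⊕ Fin l) ℂ :=
  Matrix.fromBlocks App⁻¹ (-(App⁻¹ * Apr)) (Arp * App⁻¹) (Arr - Arp * App⁻¹ * Apr)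

/-- The change of unknowns `v = (v⊥, v∥) ↦ w = ((Av)⊥, v∥)`. -/
noncomputable def hatMap {k l : ℕ}
    (App : Matrix (Fin k) (Fin k) ℂ) (Apr : Matrix (Fin k) (Fin l) ℂ)
    (Arp : Matrix (Fin l) (Fin k) ℂ) (Arr : Matrix (Fin l) (Fin l) ℂ)
    (v : Fin k ⊕ Fin l → ℂ) : Fin k ⊕ Fin l → ℂ :=
  Sum.elim (fun i => (Matrix.fromBlocks App Apr Arp Arr).mulVec v (Sum.inl i))
    (fun j => v (Sum.inr j))

section

variable {k l : ℕ} {App : Matrix (Fin k) (Fin k) ℂ} {Apr : Matrix (Fin k) (Fin l) ℂ}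
  {Arp : Matrix (Fin l) (Fin k) ℂ} {Arr : Matrix (Fin l) (Fin l) ℂ}

/-- `Â` maps `w = ((Av)⊥, v∥)` to `(v⊥, (Av)∥)`. -/
theorem hatTransform_mulVec_hatMap (h : IsUnit App) (v : Fin k ⊕ Fin l → ℂ) :
    (hatTransform App Apr Arp Arr).mulVec (hatMap App Apr Arp Arr v) =
      Sum.elim (fun i => v (Sum.inl i))
        (fun j => (Matrix.fromBlocks App Apr Arp Arr).mulVec v (Sum.inr j)) := by
  have hinv : App⁻¹ * App = 1 :=
    Matrix.nonsing_inv_mul App ((Matrix.isUnit_iff_isUnit_det App).mp h)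
  have hw : hatMap App Apr Arp Arr v =
      Sum.elim (App *ᵥ (v ∘ Sum.inl) + Apr *ᵥ (v ∘ Sum.inr)) (v ∘ Sum.inr) := by
    funext p
    cases p <;> simp [hatMap, Matrix.fromBlocks_mulVec]
  rw [hw, hatTransform, Matrix.fromBlocks_mulVec]
  funext p
  cases p <;>
    simp [Matrix.fromBlocks_mulVec, Matrix.mulVec_add, Matrix.mulVec_mulVec, Matrix.sub_mulVec,
      Matrix.neg_mulVec, Matrix.mul_assoc, hinv]

/-- The change of unknowns `v ↦ ((Av)⊥, v∥)` is injective. -/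
theorem hatMap_injective (h : IsUnit App) : Function.Injective (hatMap App Apr Arp Arr) := by
  intro v v' hv
  have hA := congrArg (hatTransform App Apr Arp Arr).mulVec hv
  rw [hatTransform_mulVec_hatMap h, hatTransform_mulVec_hatMap h] at hA
  funext p
  cases p with
  | inl i => exact congrFun hA (Sum.inl i)
  | inr j => exact congrFun hv (Sum.inr j)

/-- The change of unknowns `v ↦ ((Av)⊥, v∥)` as a linear equivalence. -/
theorem exists_linearEquiv_eq_hatMap (h : IsUnit App) :
    ∃ T : (Fin k ⊕ Fin l → ℂ) ≃ₗ[ℂ] (Fin k ⊕ Fin l → ℂ),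
      ∀ v, T v = hatMap App Apr Arp Arr v := by
  let L : (Fin k ⊕ Fin l → ℂ) →ₗ[ℂ] (Fin k ⊕ Fin l → ℂ) :=
    { toFun := hatMap App Apr Arp Arr
      map_add' := fun x y => by
        funext p
        cases p <;> simp [hatMap, Matrix.mulVec_add]
      map_smul' := fun c x => by
        funext p
        cases p <;> simp [hatMap, Matrix.mulVec_smul] }
  exact ⟨LinearEquiv.ofInjectiveEndo L (hatMap_injective h), fun _ => rfl⟩

theorem re_hatTransform_hatMap (h : IsUnit App) (v : Fin k ⊕ Fin l → ℂ) :
    (∑ p, (starRingEnd ℂ)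
        ((hatTransform App Apr Arp Arr).mulVec (hatMap App Apr Arp Arr v) p) *
      hatMap App Apr Arp Arr v p).re =
    (∑ p, (starRingEnd ℂ) ((Matrix.fromBlocks App Apr Arp Arr).mulVec v p) * v p).re := by
  rw [hatTransform_mulVec_hatMap h, Fintype.sum_sum_type, Fintype.sum_sum_type, Complex.add_re,
    Complex.add_re]
  congr 1
  rw [Complex.re_sum, Complex.re_sum]
  refine Finset.sum_congr rfl fun i _ => ?_
  simp only [hatMap, Sum.elim_inl, Complex.mul_re, Complex.conj_re, Complex.conj_im]
  ring

/-- The block `A⊥⊥` of a strictly accretive matrix is invertible. -/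
theorem isUnit_of_accretive {κ : ℝ} (hκ : 0 < κ)
    (hacc : ∀ v : Fin k ⊕ Fin l → ℂ,
      κ * ∑ p, ‖v p‖ ^ 2 ≤
        (∑ p, (starRingEnd ℂ) ((Matrix.fromBlocks App Apr Arp Arr).mulVec v p) * v p).re) :
    IsUnit App := by
  rw [← Matrix.mulVec_injective_iff_isUnit]
  refine (injective_iff_map_eq_zero (Matrix.mulVecLin App)).mpr fun x hx => ?_
  rw [Matrix.mulVecLin_apply] at hx
  have h := hacc (Sum.elim x 0)
  simp only [Matrix.fromBlocks_mulVec, Sum.elim_comp_inl, Sum.elim_comp_inr, hx,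
    Fintype.sum_sum_type, Sum.elim_inl, Sum.elim_inr] at h
  simp at h
  have h0 : ∑ i, ‖x i‖ ^ 2 = 0 :=
    le_antisymm (nonpos_of_mul_nonpos_right h hκ) (Finset.sum_nonneg fun i _ => by positivity)
  funext i
  have hi := (Finset.sum_eq_zero_iff_of_nonneg fun i _ => by positivity).mp h0 i
    (Finset.mem_univ i)
  simpa using hi

/-- `|w|² ≤ |Av|² + |v|²` for `w = ((Av)⊥, v∥)`. -/
theorem sum_norm_sq_hatMap_le (v : Fin k ⊕ Fin l → ℂ) :
    ∑ p, ‖hatMap App Apr Arp Arr v p‖ ^ 2 ≤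
      ∑ p, ‖(Matrix.fromBlocks App Apr Arp Arr).mulVec v p‖ ^ 2 + ∑ p, ‖v p‖ ^ 2 := by
  rw [← Finset.sum_add_distrib]
  refine Finset.sum_le_sum fun p _ => ?_
  cases p <;> simp [hatMap]

end

/-- **The hat transform and the change of unknowns `v ↦ w = ((Av)⊥, v∥)`:**
(i) `v ↦ w` is a linear bijection; (ii) `Re⟨Â w, w⟩ = Re⟨A v, v⟩`;
(iii) strict accretivity of `A` transfers to `Â`, with a constant depending
only on the accretivity constant and the operator norm of `A`. -/
theorem hatTransform_accretivity
    (k l : ℕ) (hk : 1 ≤ k) (hl : 1 ≤ l) :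
    (∀ (App : Matrix (Fin k) (Fin k) ℂ) (Apr : Matrix (Fin k) (Fin l) ℂ)
        (Arp : Matrix (Fin l) (Fin k) ℂ) (Arr : Matrix (Fin l) (Fin l) ℂ),
      IsUnit App →
      -- (i) v ↦ w is a linear bijection
      (∃ T : (Fin k ⊕ Fin l → ℂ) ≃ₗ[ℂ] (Fin k ⊕ Fin l → ℂ),
        ∀ v, T v = hatMap App Apr Arp Arr v) ∧
      -- (ii) Re⟨Â w, w⟩ = Re⟨A v, v⟩
      (∀ v : Fin k ⊕ Fin l → ℂ,
        (∑ p, (starRingEnd ℂ)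
            ((hatTransform App Apr Arp Arr).mulVec (hatMap App Apr Arp Arr v) p) *
          hatMap App Apr Arp Arr v p).re =
        (∑ p, (starRingEnd ℂ) ((Matrix.fromBlocks App Apr Arp Arr).mulVec v p) *
          v p).re)) ∧
    -- (iii) transfer of strict accretivity
    (∀ κ M : ℝ, 0 < κ →
      ∃ κ' : ℝ, 0 < κ' ∧
      ∀ (App : Matrix (Fin k) (Fin k) ℂ) (Apr : Matrix (Fin k) (Fin l) ℂ)
        (Arp : Matrix (Fin l) (Fin k) ℂ) (Arr : Matrix (Fin l) (Fin l) ℂ),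
        (∀ v : Fin k ⊕ Fin l → ℂ,
          ∑ p, ‖(Matrix.fromBlocks App Apr Arp Arr).mulVec v p‖ ^ 2 ≤
            M ^ 2 * ∑ p, ‖v p‖ ^ 2) →
        (∀ v : Fin k ⊕ Fin l → ℂ,
          κ * ∑ p, ‖v p‖ ^ 2 ≤
            (∑ p, (starRingEnd ℂ) ((Matrix.fromBlocks App Apr Arp Arr).mulVec v p) *
              v p).re) →
        ∀ w : Fin k ⊕ Fin l → ℂ,
          κ' * ∑ p, ‖w p‖ ^ 2 ≤
            (∑ p, (starRingEnd ℂ) ((hatTransform App Apr Arp Arr).mulVec w p) *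
              w p).re) := by
  refine ⟨fun App Apr Arp Arr h =>
    ⟨exists_linearEquiv_eq_hatMap h, re_hatTransform_hatMap h⟩, fun κ M hκ => ?_⟩
  refine ⟨κ / (M ^ 2 + 1), by positivity, fun App Apr Arp Arr hM hacc w => ?_⟩
  have h : IsUnit App := isUnit_of_accretive hκ hacc
  obtain ⟨T, hT⟩ := exists_linearEquiv_eq_hatMap (Apr := Apr) (Arp := Arp) (Arr := Arr) h
  obtain ⟨v, rfl⟩ := T.surjective w
  rw [hT, re_hatTransform_hatMap h]
  refine le_trans ?_ (hacc v)
  have hle : ∑ p, ‖hatMap App Apr Arp Arr v p‖ ^ 2 ≤ (M ^ 2 + 1) * ∑ p, ‖v p‖ ^ 2 := by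
    linarith [sum_norm_sq_hatMap_le (App := App) (Apr := Apr) (Arp := Arp) (Arr := Arr) v, hM v]
  calc κ / (M ^ 2 + 1) * ∑ p, ‖hatMap App Apr Arp Arr v p‖ ^ 2
      ≤ κ / (M ^ 2 + 1) * ((M ^ 2 + 1) * ∑ p, ‖v p‖ ^ 2) := by gcongr
    _ = κ * ∑ p, ‖v p‖ ^ 2 := by field_simp
end

section
/- Liouville theorem for global L² solutions of elliptic divergence-curl systems: let n, m ≥ 1 and let A : ℝ^{1+n} → ℒ(ℂ^{(1+n)m}) be measurable with ‖A‖_∞ < ∞ and pointwise strictly accretive, i.e. Re⟨A(x)ξ, ξ⟩ ≥ κ|ξ|² for some κ > 0, a.e. x and all ξ ∈ ℂ^{(1+n)m}. Suppose g ∈ L²(ℝ^{1+n}; ℂ^{(1+n)m}) satisfies, in the distributional sense on ℝ^{1+n}: (a) div(Ag) = 0, i.e. ∫ ⟨A(x)g(x), ∇φ(x)⟩ dx = 0 for all φ ∈ C_c^∞(ℝ^{1+n}; ℂ^m), where (∇φ)^α_i = ∂_i φ^α; and (b) curl g = 0, i.e. ∫ (g^α_i ∂_j φ − g^α_j ∂_i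 φ) dx = 0 for all 0 ≤ i, j ≤ n, all α, and all scalar φ ∈ C_c^∞(ℝ^{1+n}). Then g = 0 almost everywhere. -/
open MeasureTheory Metric
open scoped ENNReal NNReal

open scoped FourierTransform LineDeriv SchwartzMap in
/-- An `L²` field annihilating the directional derivatives of all test functions also annihilates
the directional derivatives of all Schwartz functions. -/
theorem sum_inner_lineDeriv_schwartz_eq_zero {E ι : Type*} [NormedAddCommGroup E]
    [InnerProductSpace ℝ E] [FiniteDimensional ℝ E] [MeasurableSpace E] [BorelSpace E]
    [Fintype ι] (v : ι → E) (h : ι → Lp (α := E) ℂ 2)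
    (H : ∀ φ : E → ℂ, ContDiff ℝ (⊤ : ℕ∞) φ → HasCompactSupport φ →
      ∑ i, ∫ x, inner ℂ (h i x) (fderiv ℝ φ x (v i)) = 0) (φ : 𝓢(E, ℂ)) :
    ∑ i, inner ℂ (h i) ((∂_{v i} φ : 𝓢(E, ℂ)).toLp 2) = 0 := by
  let b : ContDiffBump (0 : E) := ⟨1, 2, one_pos, one_lt_two⟩
  have hb : ContDiff ℝ (⊤ : ℕ∞) b := b.contDiff
  obtain ⟨C, hC⟩ : ∃ C, ∀ x, ‖fderiv ℝ b x‖ ≤ C := by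
    obtain ⟨C, hC⟩ := (b.hasCompactSupport.fderiv ℝ).exists_bound_of_continuous
      (hb.continuous_fderiv (by simp))
    exact ⟨C, hC⟩
  have hC0 : 0 ≤ C := (norm_nonneg _).trans (hC 0)
  let c : ℕ → ℝ := fun k => ((k : ℝ) + 1)⁻¹
  have hc0 : ∀ k, 0 < c k := fun k => by positivity
  have hc1 : ∀ k, c k ≤ 1 := fun k => inv_le_one_of_one_le₀ (by simp)
  have hc : Filter.Tendsto c Filter.atTop (nhds 0) := by
    simpa [c] using tendsto_one_div_add_atTop_nhds_zero_nat (𝕜 := ℝ)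
  let χ : ℕ → E → ℝ := fun k x => b (c k • x)
  have hχ : ∀ k, ContDiff ℝ (⊤ : ℕ∞) (χ k) := fun k => hb.comp (contDiff_const_smul _)
  have hχd : ∀ k x w, fderiv ℝ (χ k) x w = c k * fderiv ℝ b (c k • x) w := by
    intro k x w
    have := (hb.differentiable (by simp) (c k • x)).hasFDerivAt.comp x
      ((hasFDerivAt_id (𝕜 := ℝ) x).const_smul (c k))
    rw [show χ k = b ∘ fun y => c k • id y from rfl]
    erw [this.fderiv]
    simp
  have hχs : ∀ k, HasCompactSupport (χ k) := fun k =>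
    b.hasCompactSupport.comp_homeomorph (Homeomorph.smulOfNeZero (c k) (hc0 k).ne')
  let ψ : ℕ → E → ℂ := fun k x => χ k x • φ x
  have hψd : ∀ k x w, fderiv ℝ (ψ k) x w
      = χ k x • fderiv ℝ φ x w + (c k * fderiv ℝ b (c k • x) w) • φ x := by
    intro k x w
    have := ((hχ k).differentiable (by simp) x).hasFDerivAt.smul
      (φ.differentiableAt (x := x)).hasFDerivAt
    rw [show ψ k = χ k • ⇑φ from rfl, this.fderiv]
    simp [hχd]
  have hψ : ∀ k, ContDiff ℝ (⊤ : ℕ∞) (ψ k) := fun k => (hχ k).smul (φ.smooth _)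
  have hψs : ∀ k, HasCompactSupport (ψ k) := fun k => (hχs k).smul_right
  have key : ∀ i, Filter.Tendsto (fun k => ∫ x, inner ℂ (h i x) (fderiv ℝ (ψ k) x (v i)))
      Filter.atTop (nhds (inner ℂ (h i) ((∂_{v i} φ : 𝓢(E, ℂ)).toLp 2))) := by
    intro i
    have e : inner ℂ (h i) ((∂_{v i} φ : 𝓢(E, ℂ)).toLp 2)
        = ∫ x, inner ℂ (h i x) (fderiv ℝ φ x (v i)) := by
      rw [L2.inner_def]
      refine integral_congr_ae ?_
      filter_upwards [(∂_{v i} φ : 𝓢(E, ℂ)).coeFn_toLp 2 volume] with x hx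
      rw [hx, SchwartzMap.lineDerivOp_apply_eq_fderiv]
    rw [e]
    refine tendsto_integral_of_dominated_convergence
      (fun x => ‖h i x‖ * (‖(∂_{v i} φ : 𝓢(E, ℂ)) x‖ + C * ‖v i‖ * ‖φ x‖)) ?_ ?_ ?_ ?_
    · intro k
      refine (Lp.aestronglyMeasurable (h i)).inner ?_
      exact (((hψ k).continuous_fderiv (by simp)).clm_apply continuous_const).aestronglyMeasurable
    · refine MemLp.integrable_mul (p := 2) (q := 2) (Lp.memLp (h i)).norm ?_
      exact ((∂_{v i} φ : 𝓢(E, ℂ)).memLp 2 volume).norm.add ((φ.memLp 2 volume).norm.const_mul _)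
    · intro k
      refine Filter.Eventually.of_forall fun x => ?_
      refine (norm_inner_le_norm _ _).trans ?_
      gcongr
      rw [hψd, SchwartzMap.lineDerivOp_apply_eq_fderiv]
      refine (norm_add_le _ _).trans ?_
      rw [norm_smul, norm_smul, norm_mul]
      refine add_le_add ?_ (mul_le_mul_of_nonneg_right ?_ (norm_nonneg _))
      · rw [Real.norm_of_nonneg b.nonneg]
        exact mul_le_of_le_one_left (norm_nonneg _) b.le_one
      · rw [Real.norm_of_nonneg (hc0 k).le]
        calc c k * ‖fderiv ℝ b (c k • x) (v i)‖ ≤ 1 * (C * ‖v i‖) := by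
              gcongr
              · exact hc1 k
              · exact ContinuousLinearMap.le_of_opNorm_le _ (hC _) _
          _ = _ := one_mul _
    · refine Filter.Eventually.of_forall fun x => ?_
      refine Filter.Tendsto.inner tendsto_const_nhds ?_
      simp only [hψd]
      have hcx : Filter.Tendsto (fun k => c k • x) Filter.atTop (nhds 0) := by
        simpa using hc.smul_const x
      have t1 : Filter.Tendsto (fun k => χ k x) Filter.atTop (nhds 1) := by
        have := (hb.continuous.tendsto 0).comp hcx
        rwa [b.one_of_mem_closedBall (by simp [b])] at this
      have t2 : Filter.Tendsto (fun k => c k * fderiv ℝ b (c k • x) (v i))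
          Filter.atTop (nhds 0) := by
        have h1 : Continuous fun y => fderiv ℝ b y (v i) :=
          (hb.continuous_fderiv (by simp)).clm_apply continuous_const
        simpa using hc.mul ((h1.tendsto 0).comp hcx)
      simpa using (t1.smul_const (fderiv ℝ φ x (v i))).add (t2.smul_const (φ x))
  refine tendsto_nhds_unique (tendsto_finsetSum _ fun i _ => key i) ?_
  simp only [H _ (hψ _) (hψs _)]
  exact tendsto_const_nhds

open scoped FourierTransform LineDeriv SchwartzMap in
/-- A weakly divergence-free `L²` field has Fourier transform orthogonal to the frequency. -/
theorem ae_sum_inner_mul_conj_fourier_eq_zero {E ι : Type*} [NormedAddCommGroup E]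
    [InnerProductSpace ℝ E] [FiniteDimensional ℝ E] [MeasurableSpace E] [BorelSpace E]
    [Fintype ι] (v : ι → E) (h : ι → Lp (α := E) ℂ 2)
    (H : ∀ φ : E → ℂ, ContDiff ℝ (⊤ : ℕ∞) φ → HasCompactSupport φ →
      ∑ i, ∫ x, inner ℂ (h i x) (fderiv ℝ φ x (v i)) = 0) :
    ∀ᵐ x : E, ∑ i, ((inner ℝ x (v i) : ℝ) : ℂ) *
      (starRingEnd ℂ) ((𝓕 (h i) : Lp ℂ 2 (volume : Measure E)) x) = 0 := by
  have hloc : ∀ i, LocallyIntegrable (fun x : E => ((inner ℝ x (v i) : ℝ) : ℂ) *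
      (starRingEnd ℂ) ((𝓕 (h i) : Lp ℂ 2 (volume : Measure E)) x)) := by
    intro i
    have h1 : LocallyIntegrable fun x : E => (starRingEnd ℂ) ((𝓕 (h i)) x) :=
      ((Lp.memLp (𝓕 (h i))).star).locallyIntegrable (by norm_num)
    rw [locallyIntegrable_iff] at h1 ⊢
    intro K hK
    exact (h1 K hK).continuousOn_mul (by fun_prop) hK
  refine ae_eq_zero_of_integral_contDiff_smul_eq_zero
    (locallyIntegrable_finsetSum _ fun i _ => hloc i) ?_
  intro θ hθ hθs
  have hθ' : ContDiff ℝ (⊤ : ℕ∞) fun x => (θ x : ℂ) := Complex.ofRealCLM.contDiff.comp hθ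
  have hθs' : HasCompactSupport fun x => (θ x : ℂ) := hθs.comp_left (g := Complex.ofReal) rfl
  let ψ : 𝓢(E, ℂ) := hθs'.toSchwartzMap hθ'
  have hz := sum_inner_lineDeriv_schwartz_eq_zero v h H (𝓕⁻ ψ)
  have hi : ∀ i, inner ℂ (h i) ((∂_{v i} (𝓕⁻ ψ) : 𝓢(E, ℂ)).toLp 2)
      = (2 * Real.pi * Complex.I) * ∫ x, θ x • (((inner ℝ x (v i) : ℝ) : ℂ) *
        (starRingEnd ℂ) ((𝓕 (h i)) x)) := by
    intro i
    rw [← Lp.inner_fourier_eq, SchwartzMap.toLp_fourier_eq, SchwartzMap.fourier_lineDerivOp_eq,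
      FourierTransform.fourier_fourierInv_eq, L2.inner_def, ← integral_const_mul]
    refine integral_congr_ae ?_
    filter_upwards [((2 * Real.pi * Complex.I) •
      SchwartzMap.smulLeftCLM ℂ (inner ℝ · (v i)) ψ).coeFn_toLp 2 volume] with x hx
    rw [hx]
    have hg : (fun x : E => inner ℝ x (v i)).HasTemperateGrowth := by fun_prop
    simp [SchwartzMap.smulLeftCLM_apply_apply hg, ψ]
    ring
  simp only [hi, ← Finset.mul_sum] at hz
  rw [mul_eq_zero] at hz
  replace hz := hz.resolve_left (by simp [Real.pi_ne_zero])
  simp only [Finset.smul_sum]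
  rw [integral_finsetSum]
  · exact hz
  · intro i _
    exact (hloc i).integrable_smul_left_of_hasCompactSupport hθ.continuous hθs

open scoped FourierTransform in
/-- Weakly divergence-free and weakly curl-free `L²` fields are orthogonal. -/
theorem sum_inner_eq_zero_of_div_curl (n : ℕ)
    (F g : Fin (n + 1) → Lp (α := EuclideanSpace ℝ (Fin (n + 1))) ℂ 2)
    (hF : ∀ φ : EuclideanSpace ℝ (Fin (n + 1)) → ℂ,
      ContDiff ℝ (⊤ : ℕ∞) φ → HasCompactSupport φ →
      ∑ i, ∫ x, inner ℂ (F i x) (fderiv ℝ φ x (EuclideanSpace.single i 1)) = 0)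
    (hg : ∀ φ : EuclideanSpace ℝ (Fin (n + 1)) → ℂ,
      ContDiff ℝ (⊤ : ℕ∞) φ → HasCompactSupport φ → ∀ i j,
      (∫ x, inner ℂ (g i x) (fderiv ℝ φ x (EuclideanSpace.single j 1))) =
        ∫ x, inner ℂ (g j x) (fderiv ℝ φ x (EuclideanSpace.single i 1))) :
    ∑ i, inner ℂ (F i) (g i) = 0 := by
  have h1 := ae_sum_inner_mul_conj_fourier_eq_zero
    (fun i : Fin (n + 1) => EuclideanSpace.single i (1 : ℝ)) F hF
  have h2 : ∀ i j, ∀ᵐ x : EuclideanSpace ℝ (Fin (n + 1)),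
      (x j : ℂ) * (𝓕 (g i)) x =
        (x i : ℂ) * (𝓕 (g j)) x := by
    intro i j
    have := ae_sum_inner_mul_conj_fourier_eq_zero
      (![EuclideanSpace.single j (1 : ℝ), -EuclideanSpace.single i (1 : ℝ)]) ![g i, g j] (by
        intro φ hφ hφs
        simp only [Fin.sum_univ_two, Matrix.cons_val_zero, Matrix.cons_val_one, map_neg,
          inner_neg_right, integral_neg, hg φ hφ hφs i j, add_neg_cancel])
    filter_upwards [this] with x hx
    simp only [Fin.sum_univ_two, Matrix.cons_val_zero, Matrix.cons_val_one, inner_neg_right,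
      EuclideanSpace.inner_single_right, one_mul] at hx
    have := congrArg (starRingEnd ℂ) hx
    simp at this
    linear_combination this
  have h2' := ae_all_iff.2 fun i => ae_all_iff.2 (h2 i)
  have h0 : ∀ᵐ x : EuclideanSpace ℝ (Fin (n + 1)), x ≠ 0 := by
    simp [ae_iff]
  simp only [← Lp.inner_fourier_eq (F _), L2.inner_def]
  rw [← integral_finsetSum _ fun i _ => L2.integrable_inner _ _]
  refine integral_eq_zero_of_ae ?_
  filter_upwards [h1, h2', h0] with x hx1 hx2 hx0
  obtain ⟨j, hj⟩ : ∃ j, x j ≠ 0 := by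
    by_contra! hall
    exact hx0 (by ext j; simpa using hall j)
  have hj' : (x j : ℂ) ≠ 0 := by exact_mod_cast hj
  refine (mul_eq_zero.1 ?_).resolve_left hj'
  simp only [EuclideanSpace.inner_single_right, one_mul] at hx1
  calc _ = (∑ i, (x i : ℂ) * (starRingEnd ℂ)
        ((𝓕 (F i)) x)) *
          (𝓕 (g j)) x := by
        rw [Finset.mul_sum, Finset.sum_mul]
        refine Finset.sum_congr rfl fun i _ => ?_
        simp only [RCLike.inner_apply]
        linear_combination (starRingEnd ℂ)
          ((𝓕 (F i)) x) * hx2 i j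
    _ = 0 := by
        have : (∑ i, (x i : ℂ) * (starRingEnd ℂ)
          ((𝓕 (F i)) x)) = 0 := by
          simpa using hx1
        rw [this, zero_mul]

/-- **Liouville theorem for global `L²` solutions of elliptic divergence–curl systems:**
if `A` is bounded measurable and pointwise strictly accretive on `ℝ^{1+n}`, and
`g ∈ L²(ℝ^{1+n}; ℂ^{(1+n)m})` satisfies `div (A g) = 0` and `curl g = 0`
distributionally, then `g = 0` almost everywhere. -/
theorem liouville_div_curl_system
    (n m : ℕ) (hn : 1 ≤ n) (hm : 1 ≤ m)
    (A : EuclideanSpace ℝ (Fin (n + 1)) →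
      Matrix (Fin m × Fin (n + 1)) (Fin m × Fin (n + 1)) ℂ)
    (hAmeas : ∀ i j, Measurable (fun x => A x i j))
    (M : ℝ)
    (hAbound : ∀ᵐ x ∂(volume : Measure (EuclideanSpace ℝ (Fin (n + 1)))),
      ∀ i j, ‖A x i j‖ ≤ M)
    (κ : ℝ) (hκ : 0 < κ)
    -- pointwise strict accretivity
    (hacc : ∀ᵐ x ∂(volume : Measure (EuclideanSpace ℝ (Fin (n + 1)))),
      ∀ ξ : Fin m × Fin (n + 1) → ℂ,
        κ * (∑ p, ‖ξ p‖ ^ 2) ≤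
          (∑ p, (starRingEnd ℂ) ((A x).mulVec ξ p) * ξ p).re)
    (g : EuclideanSpace ℝ (Fin (n + 1)) → Fin m → Fin (n + 1) → ℂ)
    (hgmeas : Measurable g)
    -- g ∈ L²(ℝ^{1+n})
    (hgL2 : (∫⁻ x, (∑ α, ∑ i, ((‖g x α i‖₊ : ℝ≥0∞) ^ 2))
      ∂(volume : Measure (EuclideanSpace ℝ (Fin (n + 1))))) < ⊤)
    -- (a) div (A g) = 0 distributionally on ℝ^{1+n}
    (hdiv : ∀ φ : EuclideanSpace ℝ (Fin (n + 1)) → Fin m → ℂ,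
      ContDiff ℝ (⊤ : ℕ∞) φ → HasCompactSupport φ →
      (∫ x, ∑ p : Fin m × Fin (n + 1),
        (starRingEnd ℂ) ((A x).mulVec (fun q => g x q.1 q.2) p) *
          fderiv ℝ φ x (EuclideanSpace.single p.2 1) p.1) = 0)
    -- (b) curl g = 0 distributionally on ℝ^{1+n}
    (hcurl : ∀ φ : EuclideanSpace ℝ (Fin (n + 1)) → ℂ,
      ContDiff ℝ (⊤ : ℕ∞) φ → HasCompactSupport φ →
      ∀ (i j : Fin (n + 1)) (α : Fin m),
      (∫ x, (g x α i * fderiv ℝ φ x (EuclideanSpace.single j 1) -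
        g x α j * fderiv ℝ φ x (EuclideanSpace.single i 1))) = 0) :
    ∀ᵐ x ∂(volume : Measure (EuclideanSpace ℝ (Fin (n + 1)))),
      g x = 0 := by
  have hgm : ∀ α i, Measurable fun x => g x α i := fun α i => by fun_prop
  have hg2 : ∀ α i, MemLp (fun x => g x α i) 2
      (volume : Measure (EuclideanSpace ℝ (Fin (n + 1)))) := by
    intro α i
    refine ⟨(hgm α i).aestronglyMeasurable, ?_⟩
    rw [eLpNorm_lt_top_iff_lintegral_rpow_enorm_lt_top (by simp) (by simp)]
    refine lt_of_le_of_lt (lintegral_mono fun x => ?_) hgL2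
    simp only [ENNReal.toReal_ofNat, ENNReal.rpow_ofNat]
    exact (Finset.single_le_sum (f := fun i => ((‖g x α i‖₊ : ℝ≥0∞) ^ 2)) (fun _ _ => zero_le)
      (Finset.mem_univ i)).trans
      (Finset.single_le_sum (f := fun α => ∑ i, ((‖g x α i‖₊ : ℝ≥0∞) ^ 2)) (fun _ _ => zero_le)
      (Finset.mem_univ α))
  let F : Fin m × Fin (n + 1) → EuclideanSpace ℝ (Fin (n + 1)) → ℂ :=
    fun p x => (A x).mulVec (fun q => g x q.1 q.2) p
  have hF2 : ∀ p, MemLp (F p) 2 (volume : Measure (EuclideanSpace ℝ (Fin (n + 1)))) := by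
    intro p
    refine memLp_finsetSum (f := fun q x => A x p q * g x q.1 q.2) _ fun q _ => ?_
    refine (hg2 q.1 q.2).of_le_mul (c := M)
      ((hAmeas p q).mul (hgm q.1 q.2)).aestronglyMeasurable ?_
    filter_upwards [hAbound] with x hx
    rw [norm_mul]
    gcongr
    exact hx p q
  have hFint : ∀ p φ, ContDiff ℝ (⊤ : ℕ∞) φ → HasCompactSupport φ → ∀ w : EuclideanSpace ℝ _,
      Integrable fun x => (starRingEnd ℂ) (F p x) * fderiv ℝ φ x w := by
    intro p φ hφ hφs w
    refine MemLp.integrable_mul (p := 2) (q := 2) (hF2 p).star ?_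
    exact ((hφ.continuous_fderiv (by simp)).clm_apply continuous_const).memLp_of_hasCompactSupport
      (hφs.fderiv_apply ℝ w)
  have hgint : ∀ α i φ, ContDiff ℝ (⊤ : ℕ∞) φ → HasCompactSupport φ →
      ∀ w : EuclideanSpace ℝ _,
      Integrable fun x => g x α i * fderiv ℝ φ x w := by
    intro α i φ hφ hφs w
    refine MemLp.integrable_mul (p := 2) (q := 2) (hg2 α i) ?_
    exact ((hφ.continuous_fderiv (by simp)).clm_apply continuous_const).memLp_of_hasCompactSupport
      (hφs.fderiv_apply ℝ w)
  have horth : ∀ α, ∑ i, inner ℂ (hF2 (α, i)).toLp (hg2 α i).toLp = 0 := by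
    intro α
    refine sum_inner_eq_zero_of_div_curl n (fun i => (hF2 (α, i)).toLp)
      (fun i => (hg2 α i).toLp) ?_ ?_
    · intro φ hφ hφs
      have hφc : ContDiff ℝ (⊤ : ℕ∞) fun x => Pi.single (M := fun _ : Fin m => ℂ) α (φ x) :=
        (ContinuousLinearMap.single ℝ (fun _ : Fin m => ℂ) α).contDiff.comp hφ
      have hz := hdiv (fun x => Pi.single α (φ x)) hφc
        (hφs.comp_left (g := fun z => Pi.single (M := fun _ : Fin m => ℂ) α z) (by simp))
      have hd : ∀ x w, fderiv ℝ (fun x => Pi.single (M := fun _ : Fin m => ℂ) α (φ x)) x w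
          = Pi.single α (fderiv ℝ φ x w) := by
        intro x w
        have := (ContinuousLinearMap.single ℝ (fun _ : Fin m => ℂ) α).hasFDerivAt.comp x
          (hφ.differentiable (by simp) x).hasFDerivAt
        erw [this.fderiv]
        rfl
      rw [← hz, ← integral_finsetSum]
      · refine integral_congr_ae ?_
        filter_upwards [ae_all_iff.2 fun i => (hF2 (α, i)).coeFn_toLp] with x hx
        simp only [hd, hx, Fintype.sum_prod_type]
        rw [Finset.sum_eq_single α]
        · refine Finset.sum_congr rfl fun i _ => ?_
          simp [F, mul_comm]
        · intro β _ hβ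
          simp [Pi.single_eq_of_ne hβ]
        · simp
      · intro i _
        refine (hFint (α, i) φ hφ hφs (EuclideanSpace.single i 1)).congr ?_
        filter_upwards [(hF2 (α, i)).coeFn_toLp] with x hx
        simp [hx, mul_comm]
    · intro φ hφ hφs i j
      have hφc : ContDiff ℝ (⊤ : ℕ∞) fun x => (starRingEnd ℂ) (φ x) :=
        Complex.conjCLE.contDiff.comp hφ
      have hφcs : HasCompactSupport fun x => (starRingEnd ℂ) (φ x) :=
        hφs.comp_left (g := starRingEnd ℂ) (map_zero _)
      have hd : ∀ x w, fderiv ℝ (fun x => (starRingEnd ℂ) (φ x)) x w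
          = (starRingEnd ℂ) (fderiv ℝ φ x w) := by
        intro x w
        have := Complex.conjCLE.toContinuousLinearMap.hasFDerivAt.comp x
          (hφ.differentiable (by simp) x).hasFDerivAt
        erw [this.fderiv]
        rfl
      have hz := hcurl _ hφc hφcs i j α
      rw [integral_sub (hgint _ _ _ hφc hφcs _) (hgint _ _ _ hφc hφcs _), sub_eq_zero] at hz
      have hconj : ∀ i j, (∫ x, inner ℂ ((hg2 α i).toLp _ x)
          (fderiv ℝ φ x (EuclideanSpace.single j 1))) = (starRingEnd ℂ) (∫ x, g x α i *
            fderiv ℝ (fun x => (starRingEnd ℂ) (φ x)) x (EuclideanSpace.single j 1)) := by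
        intro i j
        rw [← integral_conj]
        refine integral_congr_ae ?_
        filter_upwards [(hg2 α i).coeFn_toLp] with x hx
        simp [hx, hd, mul_comm]
      rw [hconj, hconj, hz]
  have hint : ∀ p : Fin m × Fin (n + 1),
      Integrable fun x => (starRingEnd ℂ) (F p x) * g x p.1 p.2 := fun p =>
    MemLp.integrable_mul (p := 2) (q := 2) (hF2 p).star (hg2 p.1 p.2)
  have hzero : ∫ x, ∑ p, (starRingEnd ℂ) (F p x) * g x p.1 p.2 = 0 := by
    rw [integral_finsetSum _ fun p _ => hint p, Fintype.sum_prod_type]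
    refine Finset.sum_eq_zero fun α _ => (Finset.sum_congr rfl fun i _ => ?_).trans (horth α)
    rw [L2.inner_def]
    refine integral_congr_ae ?_
    filter_upwards [(hF2 (α, i)).coeFn_toLp, (hg2 α i).coeFn_toLp] with x hx hx'
    simp [hx, hx', mul_comm]
  have hsum := integrable_finsetSum Finset.univ fun p _ => hint p
  have hre : ∫ x, (∑ p, (starRingEnd ℂ) (F p x) * g x p.1 p.2).re = 0 := by
    have := integral_re hsum
    simp only [RCLike.re_to_complex] at this
    rw [this, hzero, Complex.zero_re]
  have hacc' : ∀ᵐ x, κ * (∑ p : Fin m × Fin (n + 1), ‖g x p.1 p.2‖ ^ 2) ≤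
      (∑ p, (starRingEnd ℂ) (F p x) * g x p.1 p.2).re := by
    filter_upwards [hacc] with x hx using hx fun q => g x q.1 q.2
  rw [integral_eq_zero_iff_of_nonneg_ae] at hre
  · filter_upwards [hre, hacc'] with x hx hx'
    rw [hx] at hx'
    have hle : ∑ p : Fin m × Fin (n + 1), ‖g x p.1 p.2‖ ^ 2 ≤ 0 := by
      by_contra! hpos
      exact absurd hx' (not_le.2 (mul_pos hκ hpos))
    have heq := le_antisymm hle (by positivity)
    rw [Finset.sum_eq_zero_iff_of_nonneg fun _ _ => by positivity] at heq
    ext α i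
    simpa using heq (α, i) (Finset.mem_univ _)
  · filter_upwards [hacc'] with x hx
    exact le_trans (by positivity) hx
  · exact hsum.re
end

section
/- Let H be a complex Hilbert space and let N⁺, N⁻ and E⁺, E⁻ be two pairs of complementary bounded projections on H, i.e. (N⁺)² = N⁺, N⁺ + N⁻ = I, (E⁺)² = E⁺, E⁺ + E⁻ = I. Then the restricted projection N⁺ : E⁺H → N⁺H is a bijection if and only if the restricted adjoint projection (N⁻)* : (E⁻)*H → (N⁻)*H is a bijection, where T* denotes the Hilbert space adjoint and E⁺H, (E⁻)*H, etc., denote the ranges of the respective projections. -/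
/-- For idempotents `E`, `N` on a Banach space, `N` restricts to a bijection from the range of `E`
to the range of `N` iff there is a bounded projection onto the range of `E` along the kernel
of `N`. -/
theorem bijective_restrict_range_iff_exists_projection
    {𝕜 X : Type*} [NontriviallyNormedField 𝕜] [NormedAddCommGroup X] [NormedSpace 𝕜 X]
    [CompleteSpace X] {E N : X →L[𝕜] X} (hE : IsIdempotentElem E) (hN : IsIdempotentElem N) :
    Function.Bijective (fun x : Set.range (⇑E) => (⟨N x.1, ⟨x.1, rfl⟩⟩ : Set.range (⇑N))) ↔
      ∃ P : X →L[𝕜] X, P * E = E ∧ E * P = P ∧ P * N = P ∧ N * P = N := by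
  have hEE (x : X) : E (E x) = E x := DFunLike.congr_fun hE x
  have hNN (x : X) : N (N x) = N x := DFunLike.congr_fun hN x
  constructor
  · intro h
    have : CompleteSpace E.range :=
      (ContinuousLinearMap.IsIdempotentElem.isClosed_range hE).completeSpace_coe
    have : CompleteSpace N.range :=
      (ContinuousLinearMap.IsIdempotentElem.isClosed_range hN).completeSpace_coe
    let f : E.range →L[𝕜] N.range :=
      (N.comp E.range.subtypeL).codRestrict N.range fun x => ⟨x.1, rfl⟩
    have hf : Function.Bijective f := h
    let e := ContinuousLinearEquiv.ofBijective f (LinearMap.ker_eq_bot.2 hf.1)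
      (LinearMap.range_eq_top.2 hf.2)
    let P : X →L[𝕜] X :=
      E.range.subtypeL.comp ((e.symm : N.range →L[𝕜] E.range).comp
        (N.codRestrict N.range fun x => ⟨x, rfl⟩))
    have hNP (x : X) : N (P x) = N x :=
      congrArg Subtype.val (e.apply_symm_apply ⟨N x, x, rfl⟩)
    have hEP (x : X) : E (P x) = P x := by
      obtain ⟨y, hy⟩ : ∃ y, E y = P x := (e.symm ⟨N x, x, rfl⟩).2
      rw [← hy, hEE]
    have hinj {x y : X} (hxy : N (E x) = N (E y)) : E x = E y :=
      congrArg Subtype.val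
        (h.1 (a₁ := ⟨E x, x, rfl⟩) (a₂ := ⟨E y, y, rfl⟩) (Subtype.ext hxy))
    refine ⟨P, ?_, ?_, ?_, ?_⟩ <;> ext x
    · change P (E x) = E x
      rw [← hEP]
      exact hinj (by rw [hEP, hNP])
    · exact hEP x
    · change P (N x) = P x
      rw [← hEP, ← hEP x]
      exact hinj (by rw [hEP, hEP, hNP, hNP, hNN])
    · exact hNP x
  · rintro ⟨P, hPE, hEP, hPN, hNP⟩
    have hPE (x : X) : P (E x) = E x := DFunLike.congr_fun hPE x
    have hEP (x : X) : E (P x) = P x := DFunLike.congr_fun hEP x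
    have hPN (x : X) : P (N x) = P x := DFunLike.congr_fun hPN x
    have hNP (x : X) : N (P x) = N x := DFunLike.congr_fun hNP x
    constructor
    · rintro ⟨_, x, rfl⟩ ⟨_, y, rfl⟩ hxy
      have hxy : N (E x) = N (E y) := congrArg Subtype.val hxy
      refine Subtype.ext ?_
      change E x = E y
      rw [← hPE x, ← hPE y, ← hPN (E x), hxy, hPN]
    · rintro ⟨_, y, rfl⟩
      exact ⟨⟨P y, P y, hEP y⟩, Subtype.ext (hNP y)⟩


open ContinuousLinearMap

/-- **Duality principle for pairs of complementary projections** (Prop. 2.52 of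
Auscher–Axelsson–Hofmann): `N⁺ : E⁺H → N⁺H` is a bijection if and only if
`(N⁻)* : (E⁻)*H → (N⁻)*H` is a bijection. -/
theorem restricted_projection_duality
    {H : Type*} [NormedAddCommGroup H] [InnerProductSpace ℂ H] [CompleteSpace H]
    (Np Nm Ep Em : H →L[ℂ] H)
    (hNp : Np.comp Np = Np) (hN : Np + Nm = 1)
    (hEp : Ep.comp Ep = Ep) (hE : Ep + Em = 1) :
    Function.Bijective
        (fun x : Set.range (⇑Ep) => (⟨Np x.1, ⟨x.1, rfl⟩⟩ : Set.range (⇑Np))) ↔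
      Function.Bijective
        (fun x : Set.range (⇑(adjoint Em)) =>
          (⟨adjoint Nm x.1, ⟨x.1, rfl⟩⟩ : Set.range (⇑(adjoint Nm)))) := by
  have hNp' : IsIdempotentElem Np := hNp
  have hEp' : IsIdempotentElem Ep := hEp
  obtain rfl : Nm = 1 - Np := eq_sub_of_add_eq' hN
  obtain rfl : Em = 1 - Ep := eq_sub_of_add_eq' hE
  have adj {T : H →L[ℂ] H} (hT : IsIdempotentElem T) : IsIdempotentElem (adjoint T) := by
    rw [← star_eq_adjoint, IsIdempotentElem, ← star_mul, hT.eq]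
  rw [bijective_restrict_range_iff_exists_projection hEp' hNp',
    bijective_restrict_range_iff_exists_projection (adj hEp'.one_sub) (adj hNp'.one_sub)]
  simp only [← star_eq_adjoint, star_sub, star_one]
  constructor
  · rintro ⟨P, hPE, hEP, hPN, hNP⟩
    replace hPE := congrArg star hPE
    replace hEP := congrArg star hEP
    replace hPN := congrArg star hPN
    replace hNP := congrArg star hNP
    rw [star_mul] at hPE hEP hPN hNP
    refine ⟨1 - star P, ?_, ?_, ?_, ?_⟩ <;>
      simp [mul_sub, sub_mul, hPE, hEP, hPN, hNP]
  · rintro ⟨Q, hQE, hEQ, hQN, hNQ⟩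
    replace hQE := congrArg star hQE
    replace hEQ := congrArg star hEQ
    replace hQN := congrArg star hQN
    replace hNQ := congrArg star hNQ
    simp only [star_mul, star_sub, star_one, star_star, mul_sub, sub_mul, mul_one, one_mul]
      at hQE hEQ hQN hNQ
    refine ⟨1 - star Q, ?_, ?_, ?_, ?_⟩ <;> simp only [mul_sub, sub_mul, mul_one, one_mul]
    · linear_combination (norm := abel) hEQ
    · linear_combination (norm := abel) hQE
    · linear_combination (norm := abel) hNQ
    · linear_combination (norm := abel) hQN
end
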